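/- Suppose that for all sufficiently large T, every nontrivial zero ρ = β + iγ of the Riemann zeta function with T < γ ≤ 2T satisfies |β − 1/2| < 0.3185/(2 log T). Then, as T → ∞, the number of nontrivial zeros ρ = β + iγ of ζ with T < γ ≤ 2T that are simple and satisfy β = 1/2 is at least (0.33333816 + o(1)) · (T/(2π)) log T. -/

import Mathlib

open Filter Topology MeasureTheory Set

/-- The multiplicity of `ρ` as a zero of the Riemann zeta function:
the least `n` such that the `n`-th iterated derivative of `ζ` is nonzero at `ρ`. -/
noncomputable def zetaMult (ρ : ℂ) : ℕ :=
  sInf {n : ℕ | iteratedDeriv n riemannZeta ρ ≠ 0}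

/-- `ρ` is a nontrivial zero of the Riemann zeta function. -/
def IsNontrivialZero (ρ : ℂ) : Prop :=
  riemannZeta ρ = 0 ∧ 0 < ρ.re ∧ ρ.re < 1

/-- The set of nontrivial zeros `ρ = β + iγ` with `T < γ ≤ 2T`. -/
def zeroBand (T : ℝ) : Set ℂ :=
  {ρ | IsNontrivialZero ρ ∧ T < ρ.im ∧ ρ.im ≤ 2 * T}

/-- Number of nontrivial zeros with `T < γ ≤ 2T`, counted with multiplicity. -/
noncomputable def Ntot (T : ℝ) : ℝ :=
  ∑ᶠ ρ ∈ zeroBand T, (zetaMult ρ : ℝ)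

/-- Number of simple nontrivial zeros with `T < γ ≤ 2T`. -/
noncomputable def Nsimple (T : ℝ) : ℝ :=
  ∑ᶠ ρ ∈ {ρ ∈ zeroBand T | zetaMult ρ = 1}, (1 : ℝ)

/-- Number of nontrivial zeros with `T < γ ≤ 2T` on the critical line, with multiplicity. -/
noncomputable def Nline (T : ℝ) : ℝ :=
  ∑ᶠ ρ ∈ {ρ ∈ zeroBand T | ρ.re = 1/2}, (zetaMult ρ : ℝ)

/-- Number of simple critical-line nontrivial zeros with `T < γ ≤ 2T`. -/
noncomputable def NlineSimple (T : ℝ) : ℝ :=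
  ∑ᶠ ρ ∈ {ρ ∈ zeroBand T | ρ.re = 1/2 ∧ zetaMult ρ = 1}, (1 : ℝ)

open Filter Topology MeasureTheory Set
namespace PC

lemma factor_one {f : ℂ → ℂ} (hf : Differentiable ℂ f) (a : ℂ) (h : analyticOrderAt f a ≠ ⊤) :
    ∃ g : ℂ → ℂ, Differentiable ℂ g ∧ (∀ z, f z = (z - a) ^ analyticOrderNatAt f a * g z) ∧
      g a ≠ 0 := by
  have hfa : AnalyticAt ℂ f a := hf.analyticAt a
  obtain ⟨g0, hg0, hg0a, hev⟩ := (hfa.analyticOrderNatAt_eq_iff h).1 rfl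
  set n := analyticOrderNatAt f a
  refine ⟨Function.update (fun z => f z / (z - a) ^ n) a (g0 a), ?_, ?_, by simpa using hg0a⟩
  · intro z
    by_cases hz : z = a
    · subst hz
      refine hg0.differentiableAt.congr_of_eventuallyEq ?_
      filter_upwards [hev] with w hw
      by_cases hwz : w = z
      · subst hwz; simp
      · rw [Function.update_of_ne hwz, hw, smul_eq_mul, mul_div_cancel_left₀]
        exact pow_ne_zero _ (sub_ne_zero.2 hwz)
    · have : DifferentiableAt ℂ (fun z => f z / (z - a) ^ n) z :=
        (hf z).div (by fun_prop) (pow_ne_zero _ (sub_ne_zero.2 hz))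
      refine this.congr_of_eventuallyEq ?_
      filter_upwards [isOpen_ne.mem_nhds hz] with w hw
      rw [Function.update_of_ne hw]
  · intro z
    by_cases hz : z = a
    · subst hz
      have := hev.self_of_nhds
      simpa using this
    · rw [Function.update_of_ne hz, mul_div_cancel₀]
      exact pow_ne_zero _ (sub_ne_zero.2 hz)

lemma factor_finset {f : ℂ → ℂ} (hf : Differentiable ℂ f) (h : ∀ a, analyticOrderAt f a ≠ ⊤)
    (S : Finset ℂ) :
    ∃ g : ℂ → ℂ, Differentiable ℂ g ∧ (∀ z, f z = (∏ ρ ∈ S, (z - ρ) ^ analyticOrderNatAt f ρ) * g z) ∧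
      (∀ ρ ∈ S, g ρ ≠ 0) ∧ ∀ ρ ∉ S, analyticOrderAt g ρ = analyticOrderAt f ρ := by
  classical
  induction S using Finset.induction_on with
  | empty => exact ⟨f, hf, by simp, by simp, by simp⟩
  | insert a S ha ih =>
    obtain ⟨g, hg, hfg, hgS, hgo⟩ := ih
    obtain ⟨g', hg', hgg', hg'a⟩ := factor_one hg a (by rw [hgo a ha]; exact h a)
    have hn : analyticOrderNatAt g a = analyticOrderNatAt f a := by
      simp [analyticOrderNatAt, hgo a ha]
    rw [hn] at hgg'
    refine ⟨g', hg', ?_, ?_, ?_⟩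
    · intro z
      rw [Finset.prod_insert ha, hfg z, hgg' z]; ring
    · intro ρ hρ
      rcases Finset.mem_insert.1 hρ with rfl | hρ
      · exact hg'a
      · intro h0
        apply hgS ρ hρ
        rw [hgg', h0, mul_zero]
    · intro ρ hρ
      have h1 : ρ ≠ a := fun h => hρ (h ▸ Finset.mem_insert_self _ _)
      have h2 : ρ ∉ S := fun h => hρ (Finset.mem_insert_of_mem h)
      rw [← hgo ρ h2]
      have : g = (fun z => (z - a) ^ analyticOrderNatAt f a) * g' := by
        ext z; simp [hgg' z]
      rw [this, analyticOrderAt_mul (by fun_prop) (hg'.analyticAt ρ)]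
      have h0 : analyticOrderAt (fun z : ℂ => (z - a) ^ analyticOrderNatAt f a) ρ = 0 := by
        rw [analyticOrderAt_eq_zero]
        right
        exact pow_ne_zero _ (sub_ne_zero.2 h1)
      rw [h0, zero_add]

lemma order_ne_top {f : ℂ → ℂ} (hf : Differentiable ℂ f) (h0 : f 0 = 1) (a : ℂ) :
    analyticOrderAt f a ≠ ⊤ := by
  intro h
  have h1 : AnalyticOnNhd ℂ f univ := fun z _ => hf.analyticAt z
  have h2 := h1.eqOn_zero_of_preconnected_of_eventuallyEq_zero isPreconnected_univ (mem_univ a)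
    (analyticOrderAt_eq_top.1 h)
  have := h2 (mem_univ 0)
  simp [h0] at this

lemma zeros_finite {f : ℂ → ℂ} (hf : Differentiable ℂ f) (h0 : f 0 = 1) (R : ℝ) :
    {ρ : ℂ | f ρ = 0 ∧ ‖ρ‖ ≤ R}.Finite := by
  by_contra hinf
  obtain ⟨a, -, ha⟩ := Set.Infinite.exists_accPt_of_subset_isCompact hinf
    (isCompact_closedBall (0:ℂ) R) (fun x hx => by simpa using hx.2)
  have h1 : AnalyticOnNhd ℂ f univ := fun z _ => hf.analyticAt z
  have h2 := h1.eqOn_zero_of_preconnected_of_frequently_eq_zero isPreconnected_univ (mem_univ a)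
    ((accPt_iff_frequently_nhdsNE.1 ha).mono fun x hx => hx.1)
  have := h2 (mem_univ 0)
  simp [h0] at this

lemma mult_pos {f : ℂ → ℂ} (hf : Differentiable ℂ f) (h0 : f 0 = 1) {ρ : ℂ} (h : f ρ = 0) :
    1 ≤ analyticOrderNatAt f ρ := by
  rw [Nat.one_le_iff_ne_zero]
  intro h1
  have h2 := Nat.cast_analyticOrderNatAt (order_ne_top hf h0 ρ)
  rw [h1] at h2
  exact (hf.analyticAt ρ).analyticOrderAt_eq_zero.1 h2.symm h

noncomputable def zerosF (f : ℂ → ℂ) (R : ℝ) : Finset ℂ :=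
  open Classical in if h : {ρ : ℂ | f ρ = 0 ∧ ‖ρ‖ ≤ R}.Finite then h.toFinset else ∅

lemma mem_zerosF {f : ℂ → ℂ} (hf : Differentiable ℂ f) (h0 : f 0 = 1) {R : ℝ} {ρ : ℂ} :
    ρ ∈ zerosF f R ↔ f ρ = 0 ∧ ‖ρ‖ ≤ R := by
  rw [zerosF, dif_pos (zeros_finite hf h0 R)]; simp

lemma hadamard_decomp {f : ℂ → ℂ} (hf : Differentiable ℂ f) (h0 : f 0 = 1) {R E : ℝ} (hR : 0 < R)
    (hE : ∀ z, ‖z‖ = 4 * R → ‖f z‖ ≤ E) :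
    ∃ G : ℂ → ℂ, Differentiable ℂ G ∧
      (∀ z, f z = (∏ ρ ∈ zerosF f R, (1 - z / ρ) ^ analyticOrderNatAt f ρ) * G z) ∧ G 0 = 1 ∧
      (∀ z, ‖z‖ ≤ R → G z ≠ 0) ∧
      (∀ z, ‖z‖ ≤ 4 * R → 3 ^ (∑ ρ ∈ zerosF f R, analyticOrderNatAt f ρ) * ‖G z‖ ≤ E) := by
  obtain ⟨g, hg, hfg, hgS, hgo⟩ := factor_finset hf (order_ne_top hf h0) (zerosF f R)
  set S := zerosF f R with hS
  set m := analyticOrderNatAt f with hm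
  have hmem : ∀ ρ ∈ S, ρ ≠ 0 ∧ ‖ρ‖ ≤ R := by
    intro ρ hρ
    have := (mem_zerosF hf h0).1 hρ
    refine ⟨?_, this.2⟩
    rintro rfl
    simp [h0] at this
  have key : ∀ z, f z = (∏ ρ ∈ S, (1 - z / ρ) ^ m ρ) * ((∏ ρ ∈ S, (-ρ) ^ m ρ) * g z) := by
    intro z
    rw [hfg z, ← mul_assoc, ← Finset.prod_mul_distrib]
    congr 1
    refine Finset.prod_congr rfl fun ρ hρ => ?_
    rw [← mul_pow]
    congr 1
    have := (hmem ρ hρ).1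
    field_simp
    ring
  have hPne : (∏ ρ ∈ S, (-ρ) ^ m ρ) ≠ 0 :=
    Finset.prod_ne_zero_iff.2 fun ρ hρ => pow_ne_zero _ (neg_ne_zero.2 (hmem ρ hρ).1)
  have hGd : Differentiable ℂ fun z => (∏ ρ ∈ S, (-ρ) ^ m ρ) * g z := hg.const_mul _
  refine ⟨fun z => (∏ ρ ∈ S, (-ρ) ^ m ρ) * g z, hGd, key, ?_, ?_, ?_⟩
  · have := key 0
    simpa [h0] using this.symm
  · intro z hz
    refine mul_ne_zero hPne ?_
    by_cases hzS : z ∈ S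
    · exact hgS z hzS
    · have h1 : f z ≠ 0 := fun h => hzS ((mem_zerosF hf h0).2 ⟨h, hz⟩)
      intro h2
      apply h1
      rw [hfg z, h2, mul_zero]
  · intro z hz
    have hb : Bornology.IsBounded (Metric.ball (0:ℂ) (4*R)) := Metric.isBounded_ball
    have hcl : closure (Metric.ball (0:ℂ) (4*R)) = Metric.closedBall 0 (4*R) :=
      closure_ball _ (by positivity)
    have := Complex.norm_le_of_forall_mem_frontier_norm_le (C := E)
      (f := fun z => 3 ^ (∑ ρ ∈ S, m ρ) * ((∏ ρ ∈ S, (-ρ) ^ m ρ) * g z)) hb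
      (hGd.const_mul _).diffContOnCl (z := z) ?_ ?_
    · simpa using this
    · intro w hw
      rw [frontier_ball _ (by positivity), mem_sphere_zero_iff_norm] at hw
      refine le_trans ?_ (hE w hw)
      rw [key w, norm_mul, norm_mul (∏ ρ ∈ S, (1 - w / ρ) ^ m ρ)]
      refine mul_le_mul_of_nonneg_right ?_ (norm_nonneg _)
      rw [norm_pow, norm_prod, ← Finset.prod_pow_eq_pow_sum]
      refine Finset.prod_le_prod (fun _ _ => by positivity) fun ρ hρ => ?_
      rw [norm_pow]
      refine pow_le_pow_left₀ (norm_nonneg _) ?_ _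
      have h1 : 4 ≤ ‖w / ρ‖ := by
        rw [norm_div, hw, le_div_iff₀ (norm_pos_iff.2 (hmem ρ hρ).1)]
        linarith [(hmem ρ hρ).2]
      have h2 := norm_sub_norm_le (w/ρ) 1
      rw [norm_sub_rev] at h2
      simp only [norm_one] at h2
      have h3 : ‖(3:ℂ)‖ = 3 := by simp
      linarith
    · rw [hcl]; simpa using hz

lemma log_deriv_bound {G : ℂ → ℂ} (hG : Differentiable ℂ G) (h1 : G 0 = 1) {R A : ℝ} (hR : 0 < R)
    (hA : 0 < A) (hne : ∀ z, ‖z‖ ≤ R → G z ≠ 0) (hb : ∀ z, ‖z‖ ≤ R → ‖G z‖ ≤ Real.exp A) (z : ℂ)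
    (hz : ‖z‖ < R / 4) :
    ‖logDeriv G z - logDeriv G 0‖ ≤ 64 * A / R ^ 2 * ‖z‖ := by
  have hd : DifferentiableOn ℂ (logDeriv G) (Metric.ball 0 R) := by
    intro w hw
    have : AnalyticAt ℂ (deriv G) w := (hG.analyticAt w).deriv
    exact (this.differentiableAt.div (hG w) (hne w (by simpa using (mem_ball_zero_iff.1 hw).le))).differentiableWithinAt
  obtain ⟨l, hl0, hl⟩ := hd.isExactOn_ball.with_val_at 0 0
  have hexp : ∀ w ∈ Metric.ball (0:ℂ) R, G w = Complex.exp (l w) := by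
    have hdd : ∀ w ∈ Metric.ball (0:ℂ) R,
        HasDerivAt (fun w => G w * Complex.exp (-(l w))) 0 w := by
      intro w hw
      have h2 := (hG w).hasDerivAt.mul ((hl w hw).neg.cexp)
      refine HasDerivAt.congr_deriv (f := fun w => G w * Complex.exp (-(l w))) h2 ?_
      have := hne w (by simpa using (mem_ball_zero_iff.1 hw).le)
      rw [logDeriv_apply]
      simp only [Pi.neg_apply]
      field_simp
      ring
    intro w hw
    have := IsOpen.is_const_of_deriv_eq_zero Metric.isOpen_ball
      (Metric.isPreconnected_ball (x := (0:ℂ)) (r := R))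
      (f := fun w => G w * Complex.exp (-(l w)))
      (fun w hw => (hdd w hw).differentiableAt.differentiableWithinAt)
      (fun w hw => (hdd w hw).deriv) hw (Metric.mem_ball_self hR)
    simp only [h1, hl0, neg_zero, Complex.exp_zero, mul_one] at this
    rw [Complex.exp_neg] at this
    exact (mul_inv_eq_one₀ (Complex.exp_ne_zero _)).1 this
  have hre : MapsTo l (Metric.ball 0 R) {z | z.re ≤ A} := by
    intro w hw
    have h2 := hb w (mem_ball_zero_iff.1 hw).le
    rw [hexp w hw, Complex.norm_exp] at h2
    exact Real.exp_le_exp.1 h2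
  have hld : DifferentiableOn ℂ l (Metric.ball 0 R) :=
    fun w hw => (hl w hw).differentiableAt.differentiableWithinAt
  have hl2 : ∀ w, ‖w‖ ≤ R / 2 → ‖l w‖ ≤ 2 * A := by
    intro w hw
    have := Complex.borelCaratheodory_zero hA hld hre hR (mem_ball_zero_iff.2 (by linarith)) hl0
    refine this.trans ?_
    rw [div_le_iff₀ (by linarith)]
    nlinarith
  have hl3 : ∀ w, ‖w‖ < R / 4 → ‖logDeriv G w‖ ≤ 2 * A / (R / 4) := by
    intro w hw
    have hwR : w ∈ Metric.ball (0:ℂ) R := mem_ball_zero_iff.2 (by linarith)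
    rw [← (hl w hwR).deriv]
    refine Complex.norm_deriv_le_of_forall_mem_sphere_norm_le (by positivity) ?_ ?_
    · refine (hld.mono ?_).diffContOnCl
      rw [closure_ball _ (by positivity)]
      intro u hu
      rw [Metric.mem_closedBall, dist_eq_norm] at hu
      rw [mem_ball_zero_iff]
      have := norm_add_le (u - w) w
      simp at this
      linarith
    · intro u hu
      apply hl2
      rw [mem_sphere_iff_norm] at hu
      have := norm_add_le (u - w) w
      simp at this
      linarith
  have hfin := Complex.dist_le_div_mul_dist_of_mapsTo_ball (f := logDeriv G) (c := 0) (z := z)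
    (R₁ := R / 4) (R₂ := 2 * (2 * A / (R / 4)))
    (hd.mono (Metric.ball_subset_ball (by linarith))) ?_ (mem_ball_zero_iff.2 hz)
  · rw [dist_eq_norm, dist_zero_right] at hfin
    refine hfin.trans (le_of_eq ?_)
    field_simp
    ring
  · intro w hw
    rw [mem_ball_zero_iff] at hw
    rw [Metric.mem_closedBall, dist_eq_norm]
    have h2 := hl3 w hw
    have h3 := hl3 0 (by simpa using by positivity)
    have := norm_sub_le (logDeriv G w) (logDeriv G 0)
    linarith

end PC

open Filter Topology MeasureTheory Set
namespace PC

lemma count_bound {f : ℂ → ℂ} (hf : Differentiable ℂ f) (h0 : f 0 = 1) {C : ℝ}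
    (hg : ∀ z, ‖f z‖ ≤ Real.exp (C * (1 + ‖z‖) ^ (5/4 : ℝ))) {R : ℝ} (hR : 0 < R) :
    (∑ ρ ∈ zerosF f R, (analyticOrderNatAt f ρ : ℝ)) ≤ C * (1 + 4 * R) ^ (5/4 : ℝ) := by
  obtain ⟨G, hG, hfG, hG0, hGne, hGb⟩ := hadamard_decomp hf h0 (R := R)
    (E := Real.exp (C * (1 + 4 * R) ^ (5/4 : ℝ))) hR (fun z hz => by have := hg z; rwa [hz] at this)
  have h1 := hGb 0 (by simp; positivity)
  rw [hG0, norm_one, mul_one] at h1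
  have h2 := Real.log_le_log (by positivity) h1
  rw [Real.log_exp, Real.log_pow] at h2
  have h3 : 1 ≤ Real.log 3 := by
    rw [Real.le_log_iff_exp_le (by norm_num)]
    linarith [Real.exp_one_lt_d9]
  push_cast at h2
  refine le_trans ?_ h2
  exact le_mul_of_one_le_right (Finset.sum_nonneg fun _ _ => by positivity) h3

lemma summable_weight {f : ℂ → ℂ} (hf : Differentiable ℂ f) (h0 : f 0 = 1) {C : ℝ} (hC : 0 < C)
    (hg : ∀ z, ‖f z‖ ≤ Real.exp (C * (1 + ‖z‖) ^ (5/4 : ℝ))) :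
    Summable fun ρ : {ρ : ℂ // f ρ = 0} =>
      (analyticOrderNatAt f ρ : ℝ) * (1 + ‖(ρ : ℂ)‖) ^ (-(3/2) : ℝ) := by
  classical
  set a : ℝ := 2 ^ (5/4 : ℝ) with ha
  set q : ℝ := 2 ^ (-(3/2) : ℝ) with hq
  have hq0 : 0 < q := by positivity
  have hq1 : q < 1 := Real.rpow_lt_one_of_one_lt_of_neg (by norm_num) (by norm_num)
  have haq : a * q < 1 := by
    rw [ha, hq, ← Real.rpow_add (by norm_num)]
    exact Real.rpow_lt_one_of_one_lt_of_neg (by norm_num) (by norm_num)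
  set c : ℝ := 2 ^ (3/2 : ℝ) with hc
  set K : ℝ := C * 8 ^ (5/4 : ℝ) with hK
  have hS : Summable fun j : ℕ => c * K * (a * q) ^ j :=
    (summable_geometric_of_lt_one (by positivity) haq).mul_left _
  have hcount : ∀ j : ℕ, (∑ ρ ∈ zerosF f (2 ^ j), (analyticOrderNatAt f ρ : ℝ)) ≤ K * a ^ j := by
    intro j
    refine (count_bound hf h0 hg (by positivity)).trans ?_
    rw [hK, mul_assoc]
    refine mul_le_mul_of_nonneg_left ?_ hC.le
    have h1 : a ^ j = ((2:ℝ) ^ j) ^ (5/4 : ℝ) := by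
      rw [ha, ← Real.rpow_natCast, ← Real.rpow_natCast, ← Real.rpow_mul (by norm_num),
        ← Real.rpow_mul (by norm_num), mul_comm]
    rw [h1, ← Real.mul_rpow (by norm_num) (by positivity)]
    refine Real.rpow_le_rpow (by positivity) ?_ (by norm_num)
    have : (1:ℝ) ≤ 2 ^ j := one_le_pow₀ (by norm_num)
    linarith
  have hw : ∀ x : ℝ, 0 ≤ x → (1 + x) ^ (-(3/2) : ℝ) ≤ ∑' j : ℕ, c * (if x ≤ 2 ^ j then q ^ j else 0) := by
    intro x hx
    have hex : ∃ j : ℕ, x ≤ 2 ^ j := by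
      obtain ⟨n, hn⟩ := pow_unbounded_of_one_lt x (one_lt_two)
      exact ⟨n, hn.le⟩
    have hmin : (2:ℝ) ^ (Nat.find hex) / 2 ≤ 1 + x := by
      rcases Nat.eq_zero_or_pos (Nat.find hex) with h | h
      · rw [h]; norm_num; linarith
      · have := Nat.find_min hex (m := Nat.find hex - 1) (by omega)
        push Not at this
        have h2 : (2:ℝ) ^ (Nat.find hex) = 2 * 2 ^ (Nat.find hex - 1) := by
          rw [← pow_succ']; congr 1; omega
        rw [h2]; linarith
    have hsum : Summable fun j : ℕ => c * (if x ≤ 2 ^ j then q ^ j else 0) := by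
      refine Summable.mul_left _ (Summable.of_nonneg_of_le (fun j => ?_) (fun j => ?_)
        (summable_geometric_of_lt_one hq0.le hq1))
      · split_ifs <;> positivity
      · split_ifs
        · exact le_rfl
        · positivity
    refine le_trans ?_ (hsum.le_tsum (Nat.find hex) fun j _ => by split_ifs <;> positivity)
    rw [if_pos (Nat.find_spec hex)]
    have h1 : q ^ (Nat.find hex) = ((2:ℝ) ^ (Nat.find hex)) ^ (-(3/2) : ℝ) := by
      rw [hq, ← Real.rpow_natCast, ← Real.rpow_natCast, ← Real.rpow_mul (by norm_num),
        ← Real.rpow_mul (by norm_num), mul_comm]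
    have h2 : c = (2⁻¹ : ℝ) ^ (-(3/2) : ℝ) := by
      rw [hc, Real.inv_rpow (by norm_num), ← Real.rpow_neg (by norm_num), neg_neg]
    rw [h1, h2, ← Real.mul_rpow (by norm_num) (by positivity)]
    refine Real.rpow_le_rpow_of_nonpos (by positivity) (by linarith) (by norm_num)
  refine summable_of_sum_le (c := ∑' j : ℕ, c * K * (a * q) ^ j) (fun _ => by positivity) fun u => ?_
  have hsj : ∀ ρ ∈ u, Summable fun j : ℕ => (analyticOrderNatAt f ρ : ℝ) *
      (c * (if ‖(ρ : ℂ)‖ ≤ 2 ^ j then q ^ j else 0)) := by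
    intro ρ _
    refine Summable.mul_left _ (Summable.mul_left _ (Summable.of_nonneg_of_le (fun j => ?_)
      (fun j => ?_) (summable_geometric_of_lt_one hq0.le hq1)))
    · split_ifs <;> positivity
    · split_ifs
      · exact le_rfl
      · positivity
  calc _ ≤ ∑ ρ ∈ u, ∑' j : ℕ, (analyticOrderNatAt f ρ : ℝ) *
      (c * (if ‖(ρ : ℂ)‖ ≤ 2 ^ j then q ^ j else 0)) := by
        refine Finset.sum_le_sum fun ρ _ => ?_
        rw [tsum_mul_left]
        exact mul_le_mul_of_nonneg_left (hw _ (norm_nonneg _)) (by positivity)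
    _ = ∑' j : ℕ, ∑ ρ ∈ u, (analyticOrderNatAt f ρ : ℝ) *
      (c * (if ‖(ρ : ℂ)‖ ≤ 2 ^ j then q ^ j else 0)) := (Summable.tsum_finsetSum hsj).symm
    _ ≤ _ := by
        refine Summable.tsum_le_tsum (fun j => ?_) (summable_sum hsj) hS
        calc _ = c * q ^ j * ∑ ρ ∈ u.filter (fun ρ : {ρ : ℂ // f ρ = 0} => ‖(ρ:ℂ)‖ ≤ 2 ^ j), (analyticOrderNatAt f ρ : ℝ) := by
              rw [Finset.mul_sum, Finset.sum_filter]
              refine Finset.sum_congr rfl fun ρ _ => ?_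
              split_ifs <;> ring
          _ ≤ c * q ^ j * (K * a ^ j) := by
              refine mul_le_mul_of_nonneg_left (le_trans ?_ (hcount j)) (by positivity)
              refine (Finset.sum_map _ (Function.Embedding.subtype (fun ρ => f ρ = 0))
                (fun ρ => (analyticOrderNatAt f ρ : ℝ))).symm.trans_le ?_
              refine Finset.sum_le_sum_of_subset_of_nonneg ?_ fun _ _ _ => by positivity
              intro ρ hρ
              simp only [Finset.mem_map, Finset.mem_filter] at hρ
              obtain ⟨ρ', ⟨_, h2⟩, rfl⟩ := hρ
              exact (mem_zerosF hf h0).2 ⟨ρ'.2, h2⟩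
          _ = _ := by rw [mul_pow]; ring

lemma finite_zeros_sub {f : ℂ → ℂ} (hf : Differentiable ℂ f) (h0 : f 0 = 1) (R : ℝ) :
    {ρ : {ρ : ℂ // f ρ = 0} | ‖(ρ:ℂ)‖ ≤ R}.Finite := by
  refine Set.Finite.of_finite_image (f := Subtype.val) ((zeros_finite hf h0 R).subset ?_)
    Subtype.val_injective.injOn
  rintro _ ⟨ρ, hρ, rfl⟩
  exact ⟨ρ.2, hρ⟩

lemma summable_term {f : ℂ → ℂ} (hf : Differentiable ℂ f) (h0 : f 0 = 1) {C : ℝ} (hC : 0 < C)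
    (hg : ∀ z, ‖f z‖ ≤ Real.exp (C * (1 + ‖z‖) ^ (5/4 : ℝ))) (z : ℂ) :
    Summable fun ρ : {ρ : ℂ // f ρ = 0} =>
      (analyticOrderNatAt f ρ : ℂ) * (1 / (z - ρ) + 1 / ρ) := by
  refine Summable.of_norm_bounded_eventually ((summable_weight hf h0 hC hg).mul_left (8 * ‖z‖)) ?_
  have := finite_zeros_sub hf h0 (max (2 * ‖z‖) 1)
  filter_upwards [this.compl_mem_cofinite] with ρ hρ
  simp only [mem_compl_iff, mem_ofPred_eq, not_le, max_lt_iff] at hρ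
  have hρ0 : (ρ:ℂ) ≠ 0 := norm_pos_iff.1 (by linarith)
  have h1 : ‖(ρ:ℂ)‖ / 2 ≤ ‖z - ρ‖ := by
    have := norm_sub_norm_le (ρ:ℂ) z
    rw [norm_sub_rev] at this; linarith
  have h2 : z - ρ ≠ 0 := norm_pos_iff.1 (by linarith)
  have h3 : (1 / (z - ρ) + 1 / ρ) = z / ((z - ρ) * ρ) := by field_simp; ring
  rw [h3, norm_mul, norm_div, norm_mul, Complex.norm_natCast, mul_left_comm]
  refine mul_le_mul_of_nonneg_left ?_ (by positivity)
  have h4 : (1 + ‖(ρ:ℂ)‖) ^ (-2 : ℝ) ≤ (1 + ‖(ρ:ℂ)‖) ^ (-(3/2) : ℝ) :=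
    Real.rpow_le_rpow_of_exponent_le (by linarith) (by norm_num)
  rw [Real.rpow_neg (by positivity), Real.rpow_two] at h4
  refine le_trans ?_ (mul_le_mul_of_nonneg_left h4 (by positivity))
  rw [← div_eq_mul_inv, div_le_div_iff₀ (by nlinarith) (by positivity)]
  have h5 : (1 + ‖(ρ:ℂ)‖) ^ 2 ≤ 8 * (‖z - ρ‖ * ‖(ρ:ℂ)‖) := by nlinarith
  nlinarith [norm_nonneg z]

lemma logDeriv_decomp {f G : ℂ → ℂ} {S : Finset ℂ} {m : ℂ → ℕ} (hG : Differentiable ℂ G)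
    (hS : ∀ ρ ∈ S, ρ ≠ 0)
    (hfG : ∀ z, f z = (∏ ρ ∈ S, (1 - z / ρ) ^ m ρ) * G z) (z : ℂ) (hz : ∀ ρ ∈ S, z ≠ ρ)
    (hGz : G z ≠ 0) :
    logDeriv f z = ∑ ρ ∈ S, (m ρ : ℂ) * (1 / (z - ρ)) + logDeriv G z := by
  have h1 : ∀ ρ ∈ S, (1 - z / ρ) ≠ 0 := by
    intro ρ hρ
    rw [sub_ne_zero]
    intro h
    exact hz ρ hρ (by have := (eq_div_iff (hS ρ hρ)).1 h; simpa using this.symm)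
  have : f = fun z => (∏ ρ ∈ S, (1 - z / ρ) ^ m ρ) * G z := funext hfG
  rw [this, logDeriv_mul z (Finset.prod_ne_zero_iff.2 fun ρ hρ => pow_ne_zero _ (h1 ρ hρ)) hGz
    (by fun_prop) (hG z)]
  congr 1
  rw [logDeriv_prod (f := fun ρ z => (1 - z / ρ) ^ m ρ) (fun ρ hρ => pow_ne_zero _ (h1 ρ hρ)) (fun ρ _ => by fun_prop)]
  refine Finset.sum_congr rfl fun ρ hρ => ?_
  rw [logDeriv_fun_pow (by fun_prop)]
  congr 1
  rw [logDeriv_apply]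
  have h2 : HasDerivAt (fun z : ℂ => 1 - z / ρ) (-(1 / ρ)) z := by
    simpa using ((hasDerivAt_id z).div_const ρ).const_sub 1
  rw [h2.deriv]
  have := h1 ρ hρ
  have h3 := hS ρ hρ
  have h4 : z - ρ ≠ 0 := sub_ne_zero.2 (hz ρ hρ)
  rw [div_eq_div_iff this h4]
  field_simp
  ring

lemma hadamard_hasSum {f : ℂ → ℂ} (hf : Differentiable ℂ f) (h0 : f 0 = 1) {C : ℝ} (hC : 0 < C)
    (hg : ∀ z, ‖f z‖ ≤ Real.exp (C * (1 + ‖z‖) ^ (5/4 : ℝ))) (z : ℂ) (hz : f z ≠ 0) :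
    HasSum (fun ρ : {ρ : ℂ // f ρ = 0} =>
      (analyticOrderNatAt f ρ : ℂ) * (1 / (z - ρ) + 1 / ρ)) (logDeriv f z - logDeriv f 0) := by
  classical
  have hsum := (summable_term hf h0 hC hg z).hasSum
  convert hsum using 1
  have ht : Tendsto (fun n : ℕ => (zerosF f n).subtype (fun ρ => f ρ = 0)) atTop atTop := by
    refine tendsto_atTop_finset_of_monotone ?_ ?_
    · intro a b hab ρ hρ
      rw [Finset.mem_subtype, mem_zerosF hf h0] at hρ ⊢
      exact ⟨hρ.1, hρ.2.trans (by exact_mod_cast hab)⟩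
    · intro ρ
      obtain ⟨n, hn⟩ := exists_nat_ge ‖(ρ:ℂ)‖
      exact ⟨n, by rw [Finset.mem_subtype, mem_zerosF hf h0]; exact ⟨ρ.2, hn⟩⟩
  have h1 := hsum.comp ht
  refine tendsto_nhds_unique ?_ h1
  have hlim : Tendsto (fun n : ℕ => 64 * (C * 8 ^ (5/4 : ℝ)) * ‖z‖ * ((n:ℝ) ^ (-(3/4) : ℝ))) atTop (𝓝 0) := by
    have := (tendsto_rpow_neg_atTop (show (0:ℝ) < 3/4 by norm_num)).comp tendsto_natCast_atTop_atTop
    simpa using this.const_mul (64 * (C * 8 ^ (5/4 : ℝ)) * ‖z‖)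
  refine tendsto_iff_norm_sub_tendsto_zero.2 (squeeze_zero' (Eventually.of_forall fun _ => norm_nonneg _) ?_ hlim)
  obtain ⟨N, hN⟩ := exists_nat_gt (4 * ‖z‖)
  filter_upwards [eventually_ge_atTop (N + 1)] with n hn
  have hn1 : (1:ℝ) ≤ n := by exact_mod_cast (by omega : 1 ≤ n)
  have hnz : 4 * ‖z‖ < n := hN.trans_le (by exact_mod_cast (by omega : N ≤ n))
  have hR : (0:ℝ) < n := by linarith
  obtain ⟨G, hG, hfG, hG0, hGne, hGb⟩ := hadamard_decomp hf h0 (R := n)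
    (E := Real.exp (C * (1 + 4 * n) ^ (5/4 : ℝ))) hR (fun z hz => by have := hg z; rwa [hz] at this)
  have hS : ∀ ρ ∈ zerosF f n, ρ ≠ 0 := by
    rintro ρ hρ rfl
    have := ((mem_zerosF hf h0).1 hρ).1
    simp [h0] at this
  have e1 := logDeriv_decomp hG hS hfG z
    (fun ρ hρ h => hz (h ▸ ((mem_zerosF hf h0).1 hρ).1)) (hGne z (by linarith [norm_nonneg z]))
  have e2 := logDeriv_decomp hG hS hfG 0 (fun ρ hρ h => hS ρ hρ h.symm) (by simp [hG0])
  have e3 := log_deriv_bound hG hG0 hR (A := C * (1 + 4 * n) ^ (5/4 : ℝ)) (by positivity) hGne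
    (fun w hw => le_trans (le_mul_of_one_le_left (norm_nonneg _) (one_le_pow₀ (by norm_num)))
      (hGb w (by linarith))) z (by linarith)
  have e4 : (∑ ρ ∈ (zerosF f n).subtype (fun ρ => f ρ = 0),
      (analyticOrderNatAt f ρ : ℂ) * (1 / (z - ρ) + 1 / ρ)) =
      ∑ ρ ∈ zerosF f n, (analyticOrderNatAt f ρ : ℂ) * (1 / (z - ρ) + 1 / ρ) := by
    refine (Finset.sum_map _ (Function.Embedding.subtype (fun ρ => f ρ = 0))
      (fun ρ => (analyticOrderNatAt f ρ : ℂ) * (1 / (z - ρ) + 1 / ρ))).symm.trans ?_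
    rw [Finset.subtype_map_of_mem]
    intro ρ hρ
    exact ((mem_zerosF hf h0).1 hρ).1
  simp only [Function.comp_apply, e4]
  have e5 : logDeriv f z - logDeriv f 0 - ∑ ρ ∈ zerosF f n,
      (analyticOrderNatAt f ρ : ℂ) * (1 / (z - ρ) + 1 / ρ) = logDeriv G z - logDeriv G 0 := by
    rw [e1, e2]
    simp only [mul_add, Finset.sum_add_distrib, zero_sub, div_neg, mul_neg, Finset.sum_neg_distrib]
    ring
  rw [norm_sub_rev, e5]
  refine e3.trans ?_
  have e6 : (1 + 4 * (n:ℝ)) ^ (5/4 : ℝ) ≤ 8 ^ (5/4 : ℝ) * (n:ℝ) ^ (5/4 : ℝ) := by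
    rw [← Real.mul_rpow (by norm_num) (by positivity)]
    exact Real.rpow_le_rpow (by positivity) (by linarith) (by norm_num)
  have e7 : (n:ℝ) ^ (5/4 : ℝ) / (n:ℝ) ^ 2 = (n:ℝ) ^ (-(3/4) : ℝ) := by
    rw [← Real.rpow_natCast, ← Real.rpow_sub hR]; norm_num
  rw [← e7]
  calc 64 * (C * (1 + 4 * (n:ℝ)) ^ (5/4 : ℝ)) / (n:ℝ) ^ 2 * ‖z‖
      ≤ 64 * (C * (8 ^ (5/4 : ℝ) * (n:ℝ) ^ (5/4 : ℝ))) / (n:ℝ) ^ 2 * ‖z‖ := by gcongr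
    _ = _ := by ring

end PC

open Filter Topology MeasureTheory Set
namespace PC

lemma evenK_ge_one {t : ℝ} (ht : 0 < t) : 1 ≤ HurwitzZeta.evenKernel 0 t := by
  have h := HurwitzZeta.hasSum_int_evenKernel 0 ht
  have := le_hasSum h 0 (fun _ _ => by positivity)
  simpa using this

lemma fmodif_nonneg {t : ℝ} (ht : 0 < t) :
    (HurwitzZeta.hurwitzEvenFEPair 0).f_modif t = (‖(HurwitzZeta.hurwitzEvenFEPair 0).f_modif t‖ : ℂ) := by
  suffices h : ∃ r : ℝ, 0 ≤ r ∧ (HurwitzZeta.hurwitzEvenFEPair 0).f_modif t = r by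
    obtain ⟨r, hr, h⟩ := h
    rw [h, Complex.norm_real, Real.norm_of_nonneg hr]
  have h1 := evenK_ge_one ht
  have h2 : t ^ (-(1/2) : ℝ) ≤ HurwitzZeta.evenKernel 0 t := by
    rw [HurwitzZeta.evenKernel_functional_equation, ← HurwitzZeta.evenKernel_eq_cosKernel_of_zero,
      Real.rpow_neg ht.le, one_div (t ^ _)]
    exact le_mul_of_one_le_right (by positivity) (evenK_ge_one (by positivity))
  rcases lt_trichotomy t 1 with h | h | h
  · refine ⟨HurwitzZeta.evenKernel 0 t - t ^ (-(1/2) : ℝ), by linarith, ?_⟩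
    simp only [WeakFEPair.f_modif, Pi.add_apply]
    rw [indicator_of_notMem (by simp; exact h.le), indicator_of_mem (by exact ⟨ht, h⟩)]
    simp [HurwitzZeta.hurwitzEvenFEPair]
  · refine ⟨0, le_rfl, ?_⟩
    simp [WeakFEPair.f_modif, h]
  · refine ⟨HurwitzZeta.evenKernel 0 t - 1, by linarith, ?_⟩
    simp only [WeakFEPair.f_modif, Pi.add_apply]
    rw [indicator_of_mem (by exact h), indicator_of_notMem (by simp; intro _; exact h.le)]
    simp [HurwitzZeta.hurwitzEvenFEPair]

lemma mellin_int (s : ℂ) : IntegrableOn (fun t : ℝ => t ^ (s.re - 1) *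
    ‖(HurwitzZeta.hurwitzEvenFEPair 0).f_modif t‖) (Ioi 0) := by
  have h : MellinConvergent (HurwitzZeta.hurwitzEvenFEPair 0).f_modif s :=
    (HurwitzZeta.hurwitzEvenFEPair 0).isStrongFEPair_toStrongFEPair.hasMellin s |>.1
  have h2 : IntegrableOn (fun t : ℝ => ‖(t:ℂ) ^ (s - 1) •
    (HurwitzZeta.hurwitzEvenFEPair 0).f_modif t‖) (Ioi 0) := Integrable.norm h
  refine h2.congr_fun (fun t ht => ?_) measurableSet_Ioi
  simp only [norm_smul]
  rw [Complex.norm_cpow_eq_rpow_re_of_pos ht]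
  simp

lemma norm_Lambda_real (A : ℝ) : ‖(HurwitzZeta.hurwitzEvenFEPair 0).Λ₀ A‖ =
    ∫ t in Ioi (0:ℝ), t ^ (A - 1) * ‖(HurwitzZeta.hurwitzEvenFEPair 0).f_modif t‖ := by
  have : (HurwitzZeta.hurwitzEvenFEPair 0).Λ₀ A =
    ((∫ t in Ioi (0:ℝ), t ^ (A - 1) * ‖(HurwitzZeta.hurwitzEvenFEPair 0).f_modif t‖ : ℝ) : ℂ) := by
    rw [WeakFEPair.Λ₀, mellin, ← integral_complex_ofReal]
    refine setIntegral_congr_fun measurableSet_Ioi fun t ht => ?_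
    rw [fmodif_nonneg ht, smul_eq_mul]
    push_cast
    rw [Complex.ofReal_cpow (le_of_lt ht)]
    simp
  rw [this, Complex.norm_real, Real.norm_of_nonneg]
  exact setIntegral_nonneg measurableSet_Ioi fun t ht => mul_nonneg (Real.rpow_nonneg (le_of_lt ht) _) (norm_nonneg _)

lemma norm_Lambda_le (s : ℂ) (A : ℝ) (h1 : s.re ≤ A) (h2 : -A ≤ s.re) :
    ‖(HurwitzZeta.hurwitzEvenFEPair 0).Λ₀ s‖ ≤ ‖(HurwitzZeta.hurwitzEvenFEPair 0).Λ₀ A‖ +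
      ‖(HurwitzZeta.hurwitzEvenFEPair 0).Λ₀ ((-A : ℝ) : ℂ)‖ := by
  have hA := mellin_int (A : ℂ)
  have hA' := mellin_int ((-A : ℝ) : ℂ)
  simp only [Complex.ofReal_re] at hA hA'
  rw [norm_Lambda_real, norm_Lambda_real, ← integral_add hA hA', WeakFEPair.Λ₀, mellin]
  refine norm_integral_le_of_norm_le (hA.add hA') ?_
  filter_upwards [ae_restrict_mem measurableSet_Ioi] with t ht
  have ht' : 0 < t := ht
  rw [norm_smul, Complex.norm_cpow_eq_rpow_re_of_pos ht, ← add_mul]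
  refine mul_le_mul_of_nonneg_right ?_ (norm_nonneg _)
  simp only [Complex.sub_re, Complex.one_re]
  have p1 : 0 < t ^ (A - 1) := Real.rpow_pos_of_pos ht' _
  have p2 : 0 < t ^ (-A - 1) := Real.rpow_pos_of_pos ht' _
  rcases le_total 1 t with h | h
  · have := Real.rpow_le_rpow_of_exponent_le h (show s.re - 1 ≤ A - 1 by linarith)
    linarith
  · have := Real.rpow_le_rpow_of_exponent_ge ht' h (show -A - 1 ≤ s.re - 1 by linarith)
    linarith

lemma norm_zeta0_le (s : ℂ) (A : ℝ) (h1 : ‖s‖ ≤ A) :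
    ‖completedRiemannZeta₀ s‖ ≤ ‖completedRiemannZeta₀ A‖ + ‖completedRiemannZeta₀ ((1 + A : ℝ) : ℂ)‖ := by
  have h2 : completedRiemannZeta₀ ((1 + A : ℝ) : ℂ) = completedRiemannZeta₀ ((-A : ℝ) : ℂ) := by
    rw [← completedRiemannZeta₀_one_sub]; congr 1; push_cast; ring
  rw [h2]
  have h3 := norm_Lambda_le (s / 2) (A / 2) ?_ ?_
  · simp only [completedRiemannZeta₀, HurwitzZeta.completedHurwitzZetaEven₀, norm_div]
    push_cast at h3 ⊢
    rw [← add_div, neg_div]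
    exact div_le_div_of_nonneg_right h3 (by simp)
  · have := Complex.re_le_norm s
    simp; linarith
  · have := neg_le_of_abs_le (Complex.abs_re_le_norm s)
    simp; linarith

lemma Gamma_le {y : ℝ} (hy : 2 ≤ y) : Real.Gamma y ≤ Real.exp (4 * (2 * y) ^ (5/4 : ℝ)) := by
  set n := ⌈y⌉₊ with hn
  have h1 : y ≤ n := Nat.le_ceil y
  have h2 : (n:ℝ) < y + 1 := Nat.ceil_lt_add_one (by linarith)
  have h3 : Real.Gamma y ≤ Real.Gamma (n + 1) :=
    Real.Gamma_strictMonoOn_Ici.monotoneOn (by exact hy) (by simp; linarith) (by linarith)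
  rw [Real.Gamma_nat_eq_factorial] at h3
  have h4 : (n.factorial : ℝ) ≤ (n:ℝ) ^ n := by exact_mod_cast Nat.factorial_le_pow n
  have hn0 : (0:ℝ) < n := by linarith
  refine h3.trans (h4.trans ?_)
  rw [← Real.rpow_natCast, Real.rpow_def_of_pos hn0]
  apply Real.exp_le_exp.2
  have h5 := Real.log_le_rpow_div hn0.le (show (0:ℝ) < 1/4 by norm_num)
  calc Real.log n * n ≤ ((n:ℝ) ^ (1/4 : ℝ) / (1/4)) * n := by gcongr
    _ = 4 * (n:ℝ) ^ (5/4 : ℝ) := by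
      have : (n:ℝ) ^ (5/4 : ℝ) = (n:ℝ) ^ (1/4 : ℝ) * n := by
        rw [show (5/4:ℝ) = 1/4 + 1 by norm_num, Real.rpow_add hn0, Real.rpow_one]
      rw [this]; ring
    _ ≤ _ := by
      gcongr
      linarith

lemma exists_zeta0_real : ∃ K : ℝ, 0 < K ∧ ∀ x : ℝ, 4 ≤ x →
    ‖completedRiemannZeta₀ x‖ ≤ K * Real.exp (4 * x ^ (5/4 : ℝ)) := by
  have hs2 : Summable fun n : ℕ => 1 / (n:ℝ) ^ (2:ℝ) := Real.summable_one_div_nat_rpow.2 (by norm_num)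
  refine ⟨(∑' n : ℕ, 1 / (n:ℝ) ^ (2:ℝ)) + 2, by positivity, fun x hx => ?_⟩
  have h1 := completedRiemannZeta_eq (x:ℂ)
  have h2 : completedRiemannZeta₀ x = completedRiemannZeta x + 1 / x + 1 / (1 - x) := by
    rw [h1]; ring
  have h3 : ‖(1:ℂ) / x‖ ≤ 1 := by
    rw [norm_div, norm_one, Complex.norm_real, Real.norm_of_nonneg (by linarith)]
    rw [div_le_one (by linarith)]; linarith
  have h4 : ‖(1:ℂ) / (1 - x)‖ ≤ 1 := by
    have : (1:ℂ) - x = ((1 - x : ℝ) : ℂ) := by push_cast; ring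
    rw [this, norm_div, norm_one, Complex.norm_real, Real.norm_of_nonpos (by linarith)]
    rw [div_le_one (by linarith)]; linarith
  have h5 : ‖completedRiemannZeta x‖ ≤ Real.exp (4 * x ^ (5/4 : ℝ)) * ∑' n : ℕ, 1 / (n:ℝ) ^ (2:ℝ) := by
    rw [completedZeta_eq_tsum_of_one_lt_re (by simp; linarith), norm_mul, norm_mul]
    have e1 : ‖(Real.pi : ℂ) ^ (-(x:ℂ) / 2)‖ ≤ 1 := by
      rw [Complex.norm_cpow_eq_rpow_re_of_pos Real.pi_pos]
      apply Real.rpow_le_one_of_one_le_of_nonpos (by linarith [Real.pi_gt_three])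
      simp; linarith
    have e2 : ‖Complex.Gamma ((x:ℂ) / 2)‖ ≤ Real.exp (4 * x ^ (5/4 : ℝ)) := by
      have : (x:ℂ) / 2 = ((x / 2 : ℝ) : ℂ) := by push_cast; ring
      rw [this, Complex.Gamma_ofReal, Complex.norm_real, Real.norm_of_nonneg (Real.Gamma_pos_of_pos (by linarith)).le]
      have := Gamma_le (y := x / 2) (by linarith)
      rwa [mul_div_cancel₀ _ (two_ne_zero)] at this
    have e3 : ‖∑' n : ℕ, 1 / (n : ℂ) ^ (x:ℂ)‖ ≤ ∑' n : ℕ, 1 / (n:ℝ) ^ (2:ℝ) := by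
      refine tsum_of_norm_bounded hs2.hasSum fun n => ?_
      rcases Nat.eq_zero_or_pos n with rfl | hn
      · rw [Nat.cast_zero, Complex.zero_cpow (by exact_mod_cast (by linarith : x ≠ 0))]; simp
      · rw [norm_div, norm_one, Complex.norm_natCast_cpow_of_pos hn]
        simp only [Complex.ofReal_re]
        refine one_div_le_one_div_of_le (by positivity) ?_
        exact Real.rpow_le_rpow_of_exponent_le (by exact_mod_cast hn) (by linarith)
    calc _ ≤ 1 * Real.exp (4 * x ^ (5/4 : ℝ)) * ∑' n : ℕ, 1 / (n:ℝ) ^ (2:ℝ) := by gcongr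
      _ = _ := by ring
  rw [h2]
  have h6 : (1:ℝ) ≤ Real.exp (4 * x ^ (5/4 : ℝ)) := Real.one_le_exp (by positivity)
  calc _ ≤ ‖completedRiemannZeta x‖ + ‖(1:ℂ) / x‖ + ‖(1:ℂ) / (1 - x)‖ := norm_add₃_le
    _ ≤ _ := by nlinarith

noncomputable def xi (s : ℂ) : ℂ := s * (s - 1) * completedRiemannZeta₀ s + 1

lemma xi_diff : Differentiable ℂ xi := by
  unfold xi
  have := differentiable_completedZeta₀
  fun_prop

lemma xi_zero : xi 0 = 1 := by simp [xi]

lemma xi_growth : ∃ C : ℝ, 0 < C ∧ ∀ z, ‖xi z‖ ≤ Real.exp (C * (1 + ‖z‖) ^ (5/4 : ℝ)) := by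
  obtain ⟨K, hK, hb⟩ := exists_zeta0_real
  refine ⟨2 * K + 1 + 2 + 4 * 5 ^ (5/4 : ℝ), by positivity, fun z => ?_⟩
  set u := 1 + ‖z‖ with hu
  have hu1 : 1 ≤ u := by simp [hu]
  set E := 4 * (5 * u) ^ (5/4 : ℝ) with hE
  have hx : ∀ x : ℝ, 4 ≤ x → x ≤ 5 * u → ‖completedRiemannZeta₀ x‖ ≤ K * Real.exp E := by
    intro x h4 h5
    refine (hb x h4).trans ?_
    rw [hE]
    gcongr
  have h1 := norm_zeta0_le z (‖z‖ + 4) (by linarith)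
  have h2 := hx (‖z‖ + 4) (by linarith [norm_nonneg z]) (by rw [hu]; linarith [norm_nonneg z])
  have h3 := hx (1 + (‖z‖ + 4)) (by linarith [norm_nonneg z]) (by rw [hu]; linarith [norm_nonneg z])
  have h4 : ‖completedRiemannZeta₀ z‖ ≤ 2 * K * Real.exp E := by linarith
  have hE1 : 1 ≤ Real.exp E := Real.one_le_exp (by positivity)
  have h5 : ‖xi z‖ ≤ (2 * K + 1) * u ^ 2 * Real.exp E := by
    calc ‖xi z‖ ≤ ‖z‖ * ‖z - 1‖ * ‖completedRiemannZeta₀ z‖ + 1 := by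
          unfold xi
          refine (norm_add_le _ _).trans ?_
          simp
      _ ≤ u * u * (2 * K * Real.exp E) + 1 := by
          have := norm_sub_le z 1
          simp only [norm_one] at this
          gcongr <;> linarith
      _ ≤ _ := by nlinarith [one_le_pow₀ hu1 (n := 2), mul_nonneg (sq_nonneg u) (by linarith : 0 ≤ Real.exp E - 1)]
  refine h5.trans ?_
  have h6 : 2 * K + 1 ≤ Real.exp (2 * K + 1) := by linarith [Real.add_one_le_exp (2 * K + 1)]
  have h7 : u ^ 2 ≤ Real.exp (2 * u) := by
    rw [two_mul, Real.exp_add, pow_two]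
    have := Real.add_one_le_exp u
    have h0 : 0 ≤ u := by linarith
    have h9 : u ≤ Real.exp u := by linarith
    exact mul_le_mul h9 h9 h0 (h0.trans h9)
  calc _ ≤ Real.exp (2 * K + 1) * Real.exp (2 * u) * Real.exp E := by gcongr
    _ = Real.exp ((2 * K + 1) + 2 * u + E) := by
      rw [Real.exp_add ((2 * K + 1) + 2 * u), Real.exp_add (2 * K + 1)]
    _ ≤ _ := by
      apply Real.exp_le_exp.2
      have h8 : u ≤ u ^ (5/4 : ℝ) := by
        conv_lhs => rw [← Real.rpow_one u]
        exact Real.rpow_le_rpow_of_exponent_le hu1 (by norm_num)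
      rw [hE, Real.mul_rpow (by norm_num) (by linarith)]
      have h9 : 2 * K + 1 ≤ (2 * K + 1) * u ^ (5/4 : ℝ) :=
        le_mul_of_one_le_right (by positivity) (hu1.trans h8)
      linarith

end PC

open Filter Topology MeasureTheory Set
namespace PC
open ComplexConjugate

lemma xi_eq {s : ℂ} (hs : 0 < s.re) (h1 : s ≠ 1) :
    xi s = s * (s - 1) * Complex.Gammaℝ s * riemannZeta s := by
  have h0 : s ≠ 0 := by rintro rfl; simp at hs
  rw [riemannZeta_def_of_ne_zero h0, completedRiemannZeta_eq, xi]
  have := Complex.Gammaℝ_ne_zero_of_re_pos hs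
  have h2 : s - 1 ≠ 0 := sub_ne_zero.2 h1
  have h3 : 1 - s ≠ 0 := sub_ne_zero.2 h1.symm
  field_simp
  ring

lemma xi_one_sub (s : ℂ) : xi (1 - s) = xi s := by
  rw [xi, xi, completedRiemannZeta₀_one_sub]; ring

lemma xi_one : xi 1 = 1 := by simp [xi]

lemma xi_ne_zero_of_one_le {s : ℂ} (hs : 1 ≤ s.re) : xi s ≠ 0 := by
  by_cases h1 : s = 1
  · rw [h1, xi_one]; exact one_ne_zero
  · rw [xi_eq (by linarith) h1]
    have h0 : s ≠ 0 := by rintro rfl; simp at hs; linarith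
    exact mul_ne_zero (mul_ne_zero (mul_ne_zero h0 (sub_ne_zero.2 h1))
      (Complex.Gammaℝ_ne_zero_of_re_pos (by linarith))) (riemannZeta_ne_zero_of_one_le_re hs)

lemma xi_zero_strip {s : ℂ} (h : xi s = 0) : 0 < s.re ∧ s.re < 1 := by
  constructor
  · by_contra hs
    push Not at hs
    rw [← xi_one_sub] at h
    exact xi_ne_zero_of_one_le (by simp; linarith) h
  · by_contra hs
    push Not at hs
    exact xi_ne_zero_of_one_le hs h

lemma ne_one_of_lt {s : ℂ} (h : s.re < 1) : s ≠ 1 := by rintro rfl; simp at h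

lemma nontrivial_iff (s : ℂ) : IsNontrivialZero s ↔ xi s = 0 := by
  constructor
  · rintro ⟨h, h0, h1⟩
    rw [xi_eq h0 (ne_one_of_lt h1), h, mul_zero]
  · intro h
    obtain ⟨h0, h1⟩ := xi_zero_strip h
    refine ⟨?_, h0, h1⟩
    rw [xi_eq h0 (ne_one_of_lt h1)] at h
    have hs0 : s ≠ 0 := by rintro rfl; simp at h0
    refine (mul_eq_zero.1 h).resolve_left ?_
    exact mul_ne_zero (mul_ne_zero hs0 (sub_ne_zero.2 (ne_one_of_lt h1)))
      (Complex.Gammaℝ_ne_zero_of_re_pos h0)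

lemma analyticAt_Gammaℝ {s : ℂ} (hs : 0 < s.re) : AnalyticAt ℂ Complex.Gammaℝ s := by
  have h1 : AnalyticAt ℂ (fun s => ((Complex.Gammaℝ s)⁻¹)⁻¹) s :=
    (Complex.differentiable_Gammaℝ_inv.analyticAt s).inv (inv_ne_zero (Complex.Gammaℝ_ne_zero_of_re_pos hs))
  simpa using h1

lemma analyticAt_zeta {s : ℂ} (hs : s ≠ 1) : AnalyticAt ℂ riemannZeta s := by
  rw [Complex.analyticAt_iff_eventually_differentiableAt]
  filter_upwards [isOpen_ne.mem_nhds hs] with z hz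
  exact differentiableAt_riemannZeta hz

lemma order_xi {s : ℂ} (h0 : 0 < s.re) (h1 : s.re < 1) :
    analyticOrderAt xi s = analyticOrderAt riemannZeta s := by
  have hev : xi =ᶠ[𝓝 s] (fun s => s * (s - 1) * Complex.Gammaℝ s) * riemannZeta := by
    have o1 : {z : ℂ | 0 < z.re} ∈ 𝓝 s := (isOpen_lt continuous_const Complex.continuous_re).mem_nhds h0
    filter_upwards [o1, isOpen_ne.mem_nhds (ne_one_of_lt h1)] with z hz hz1
    simp [xi_eq hz hz1]
  have hG := analyticAt_Gammaℝ h0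
  have ha : AnalyticAt ℂ (fun s => s * (s - 1) * Complex.Gammaℝ s) s := by fun_prop
  rw [analyticOrderAt_congr hev, analyticOrderAt_mul ha (analyticAt_zeta (ne_one_of_lt h1))]
  have : analyticOrderAt (fun s => s * (s - 1) * Complex.Gammaℝ s) s = 0 := by
    rw [ha.analyticOrderAt_eq_zero]
    have hs0 : s ≠ 0 := by rintro rfl; simp at h0
    exact mul_ne_zero (mul_ne_zero hs0 (sub_ne_zero.2 (ne_one_of_lt h1)))
      (Complex.Gammaℝ_ne_zero_of_re_pos h0)
  rw [this, zero_add]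

noncomputable abbrev mu (ρ : ℂ) : ℕ := analyticOrderNatAt xi ρ

lemma zetaMult_eq {s : ℂ} (h0 : 0 < s.re) (h1 : s.re < 1) : zetaMult s = mu s := by
  have hz := analyticAt_zeta (ne_one_of_lt h1)
  have ho := order_xi h0 h1
  have hn : (mu s : ℕ∞) = analyticOrderAt riemannZeta s := by
    rw [← ho]; exact Nat.cast_analyticOrderNatAt (order_ne_top xi_diff xi_zero s)
  have hle := (natCast_le_analyticOrderAt_iff_iteratedDeriv_eq_zero (n := mu s) hz).1 hn.le
  have hnot : iteratedDeriv (mu s) riemannZeta s ≠ 0 := by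
    intro h
    have := (natCast_le_analyticOrderAt_iff_iteratedDeriv_eq_zero (n := mu s + 1) hz).2 (by
      intro i hi
      rcases Nat.lt_succ_iff_lt_or_eq.1 hi with h' | rfl
      · exact hle i h'
      · exact h)
    rw [← hn] at this
    have := Nat.cast_le.1 this
    omega
  apply le_antisymm
  · exact Nat.sInf_le hnot
  · refine le_csInf ⟨_, hnot⟩ fun n hn => ?_
    by_contra hlt
    exact hn (hle n (by omega))

lemma xi_conj (s : ℂ) : xi (conj s) = conj (xi s) := by
  have key : ∀ s : ℂ, 0 < s.re → xi (conj s) = conj (xi s) := by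
    intro s hs
    by_cases h1 : s = 1
    · simp [h1, xi_one]
    · have h2 : conj s ≠ 1 := fun h => h1 (by have := congrArg conj h; simpa using this)
      rw [xi_eq (by simpa using hs) h2, xi_eq hs h1, riemannZeta_conj, Complex.Gammaℝ_def,
        Complex.Gammaℝ_def]
      have e1 : Complex.Gamma (conj s / 2) = conj (Complex.Gamma (s / 2)) := by
        rw [← Complex.Gamma_conj, map_div₀, Complex.conj_ofNat]
      have e2 : (Real.pi : ℂ) ^ (-(conj s) / 2) = conj ((Real.pi : ℂ) ^ (-s / 2)) := by
        have := Complex.cpow_conj (Real.pi : ℂ) (-s / 2) (by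
          rw [Complex.arg_ofReal_of_nonneg Real.pi_pos.le]; exact Real.pi_pos.ne)
        simp only [map_div₀, map_neg, Complex.conj_ofReal, Complex.conj_ofNat] at this
        exact this
      rw [e1, e2]
      simp
  rcases lt_or_ge 0 s.re with h | h
  · exact key s h
  · rw [← xi_one_sub (conj s), ← xi_one_sub s, ← key (1 - s) (by simp; linarith)]
    simp

lemma xi_refl (s : ℂ) : xi s = conj (xi (1 - conj s)) := by
  rw [xi_one_sub, xi_conj, Complex.conj_conj]

lemma mu_refl (ρ : ℂ) : mu (1 - conj ρ) = mu ρ := by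
  obtain ⟨g, hg, hf, hne⟩ := factor_one xi_diff ρ (order_ne_top xi_diff xi_zero ρ)
  have hord := order_ne_top xi_diff xi_zero (1 - conj ρ)
  refine ((xi_diff.analyticAt _).analyticOrderNatAt_eq_iff hord).2 ?_
  refine ⟨fun z => (-1) ^ mu ρ * conj (g (conj (1 - z))), ?_, ?_, ?_⟩
  · have h1 : Differentiable ℂ (fun z => conj (g (conj z))) := fun z => by
      have := (hg (conj z)).conj_conj
      simpa [Function.comp_def] using this
    have h2 : Differentiable ℂ fun z => (-1) ^ mu ρ * conj (g (conj (1 - z))) :=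
      (h1.comp (by fun_prop : Differentiable ℂ fun z : ℂ => 1 - z)).const_mul _
    exact h2.analyticAt _
  · simp [hne]
  · refine Eventually.of_forall fun z => ?_
    rw [xi_refl z, hf]
    simp only [map_mul, map_pow, smul_eq_mul, map_sub, map_one, Complex.conj_conj]
    rw [← mul_assoc, ← mul_pow]
    congr 2
    ring

lemma xi_refl_zero {ρ : ℂ} (h : xi ρ = 0) : xi (1 - conj ρ) = 0 := by
  have := xi_refl ρ
  rw [h] at this
  simpa using this.symm

lemma logDeriv_xi {s : ℂ} (hs : 1 < s.re) :
    logDeriv xi s = 1 / s + 1 / (s - 1) - (Real.log Real.pi : ℂ) / 2 +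
      Complex.digamma (s / 2) / 2 + logDeriv riemannZeta s := by
  have h0 : s ≠ 0 := by rintro rfl; simp at hs; linarith
  have h1 : s ≠ 1 := by rintro rfl; simp at hs
  have h1' : s - 1 ≠ 0 := sub_ne_zero.2 h1
  have hev : xi =ᶠ[𝓝 s] fun s => s * (s - 1) * ((Real.pi : ℂ) ^ (-s / 2) * Complex.Gamma (s / 2)) * riemannZeta s := by
    have o1 : {z : ℂ | 0 < z.re} ∈ 𝓝 s :=
      (isOpen_lt continuous_const Complex.continuous_re).mem_nhds (show (0:ℝ) < s.re by linarith)
    filter_upwards [o1, isOpen_ne.mem_nhds h1] with z hz hz1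
    rw [xi_eq hz hz1, Complex.Gammaℝ_def]
  have hpi : (Real.pi : ℂ) ≠ 0 := by exact_mod_cast Real.pi_ne_zero
  have hne : ∀ m : ℕ, s / 2 ≠ -m := by
    intro m h
    have := congrArg Complex.re h
    simp at this
    have : (0:ℝ) ≤ m := by positivity
    linarith
  have hGd : DifferentiableAt ℂ Complex.Gamma (s / 2) := Complex.differentiableAt_Gamma _ hne
  have hGn : Complex.Gamma (s / 2) ≠ 0 := Complex.Gamma_ne_zero hne
  have hGd' : DifferentiableAt ℂ (fun s => Complex.Gamma (s / 2)) s :=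
    DifferentiableAt.comp s hGd (by fun_prop)
  have hp : HasDerivAt (fun s : ℂ => (Real.pi : ℂ) ^ (-s / 2))
      ((Real.pi : ℂ) ^ (-s / 2) * Complex.log Real.pi * (-1 / 2)) s := by
    have : HasDerivAt (fun s : ℂ => -s / 2) (-1 / 2) s := by
      simpa using ((hasDerivAt_id s).neg).div_const 2
    exact this.const_cpow (Or.inl hpi)
  have hpn : (Real.pi : ℂ) ^ (-s / 2) ≠ 0 := by simp [hpi]
  have hz := differentiableAt_riemannZeta h1
  have hzn := riemannZeta_ne_zero_of_one_le_re hs.le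
  have hl : logDeriv xi s = logDeriv (fun s => s * (s - 1) * ((Real.pi : ℂ) ^ (-s / 2) * Complex.Gamma (s / 2)) * riemannZeta s) s := by
    rw [logDeriv_apply, logDeriv_apply, hev.deriv_eq, hev.self_of_nhds]
  rw [hl, logDeriv_mul s (f := fun s => s * (s - 1) * ((Real.pi : ℂ) ^ (-s / 2) * Complex.Gamma (s / 2)))
      (mul_ne_zero (mul_ne_zero h0 h1') (mul_ne_zero hpn hGn)) hzn
      ((by fun_prop : DifferentiableAt ℂ (fun s : ℂ => s * (s-1)) s).mul (hp.differentiableAt.mul hGd')) hz,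
    logDeriv_mul s (f := fun s => s * (s - 1)) (g := fun s => (Real.pi : ℂ) ^ (-s / 2) * Complex.Gamma (s / 2)) (mul_ne_zero h0 h1') (mul_ne_zero hpn hGn) (by fun_prop)
      (hp.differentiableAt.mul hGd'),
    logDeriv_mul s (f := fun s : ℂ => s) (g := fun s : ℂ => s - 1) h0 h1' (by fun_prop) (by fun_prop),
    logDeriv_mul s (f := fun s : ℂ => (Real.pi : ℂ) ^ (-s / 2)) (g := fun s : ℂ => Complex.Gamma (s / 2)) hpn hGn hp.differentiableAt hGd']
  congr 1
  have e1 : logDeriv (fun s : ℂ => s) s = 1 / s := by simp [logDeriv_apply]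
  have e2 : logDeriv (fun s : ℂ => s - 1) s = 1 / (s - 1) := by simp [logDeriv_apply]
  have e3 : logDeriv (fun s : ℂ => (Real.pi : ℂ) ^ (-s / 2)) s = -(Real.log Real.pi : ℂ) / 2 := by
    rw [logDeriv_apply, hp.deriv, Complex.ofReal_log Real.pi_pos.le]
    field_simp
  have e4 : logDeriv (fun s => Complex.Gamma (s / 2)) s = Complex.digamma (s / 2) / 2 := by
    have : HasDerivAt (fun s : ℂ => s / 2) (1 / 2) s := (hasDerivAt_id s).div_const 2
    have h3 := hGd.hasDerivAt.comp s this
    have h4 : deriv (fun s => Complex.Gamma (s / 2)) s = _ := h3.deriv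
    rw [logDeriv_apply, h4, Complex.digamma_def, logDeriv_apply]
    field_simp
  rw [e1, e2, e3, e4]
  ring

end PC

open Filter Topology MeasureTheory Set
namespace PC

lemma digamma_ofReal {x : ℝ} (hx : 0 < x) :
    Complex.digamma (x : ℂ) = ((deriv (Real.log ∘ Real.Gamma) x : ℝ) : ℂ) := by
  have hne : ∀ m : ℕ, x ≠ -m := fun m h => by
    have : (0:ℝ) ≤ m := by positivity
    linarith
  have hne' : ∀ m : ℕ, (x : ℂ) ≠ -m := fun m h => hne m (by exact_mod_cast h)
  have h1 := (Real.differentiableAt_Gamma hne).hasDerivAt.ofReal_comp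
  have h2 := (Complex.differentiableAt_Gamma _ hne').hasDerivAt.comp_ofReal
  have h3 : (fun y : ℝ => ((Real.Gamma y : ℝ) : ℂ)) = fun y : ℝ => Complex.Gamma (y : ℂ) := by
    funext y; exact (Complex.Gamma_ofReal y).symm
  rw [h3] at h1
  have h4 := h2.unique h1
  rw [Complex.digamma_def, logDeriv_apply, h4, Complex.Gamma_ofReal, Function.comp_def,
    deriv.log (Real.differentiableAt_Gamma hne) (Real.Gamma_pos_of_pos hx).ne']
  push_cast
  rfl

lemma digamma_rec {x : ℝ} (hx : 0 < x) :
    deriv (Real.log ∘ Real.Gamma) (x + 1) = deriv (Real.log ∘ Real.Gamma) x + x⁻¹ := by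
  have h := Complex.digamma_apply_add_one (x : ℂ) (fun m h => by
    have : x = -m := by exact_mod_cast h
    have : (0:ℝ) ≤ m := by positivity
    linarith)
  have h2 := digamma_ofReal (x := x + 1) (by linarith)
  push_cast at h2
  rw [h2, digamma_ofReal hx] at h
  exact_mod_cast h

lemma digamma_rec_sum {x : ℝ} (hx : 0 < x) (n : ℕ) :
    deriv (Real.log ∘ Real.Gamma) (x + n) = deriv (Real.log ∘ Real.Gamma) x +
      ∑ k ∈ Finset.range n, (x + k)⁻¹ := by
  induction n with
  | zero => simp
  | succ n ih =>
    rw [Finset.sum_range_succ, ← add_assoc, ← ih]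
    have := digamma_rec (x := x + n) (by positivity)
    rw [← this]; push_cast; ring_nf

lemma digamma_mono : MonotoneOn (deriv (Real.log ∘ Real.Gamma)) (Ioi 0) := by
  refine Real.convexOn_log_Gamma.monotoneOn_deriv fun x hx => ?_
  have hx : 0 < x := hx
  refine ((Real.differentiableAt_Gamma ?_).log (Real.Gamma_ne_zero ?_)) <;>
    exact fun m => ne_of_gt (by have : (0:ℝ) ≤ m := by positivity
                                linarith)

lemma digamma_real_tendsto {x : ℝ} (hx : 0 < x) (hx1 : x < 1) :
    Tendsto (fun n : ℕ => ∑ k ∈ Finset.range n, (1 / ((k:ℝ) + 1) - 1 / (x + k))) atTop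
      (𝓝 (deriv (Real.log ∘ Real.Gamma) x - deriv (Real.log ∘ Real.Gamma) 1)) := by
  set ψ := deriv (Real.log ∘ Real.Gamma) with hψ
  have key : ∀ n : ℕ, ∑ k ∈ Finset.range n, (1 / ((k:ℝ) + 1) - 1 / (x + k)) =
      (ψ (1 + n) - ψ (x + n)) + (ψ x - ψ 1) := by
    intro n
    rw [hψ, digamma_rec_sum hx, digamma_rec_sum one_pos, Finset.sum_sub_distrib]
    simp only [one_div, add_comm (1:ℝ)]
    ring
  simp only [key]
  have : Tendsto (fun n : ℕ => ψ (1 + n) - ψ (x + n)) atTop (𝓝 0) := by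
    refine squeeze_zero' (g := fun n : ℕ => (1:ℝ) / n) ?_ ?_ tendsto_one_div_atTop_nhds_zero_nat
    · filter_upwards with n
      have := digamma_mono (show x + n ∈ Ioi 0 by simp; positivity)
        (show (1:ℝ) + n ∈ Ioi 0 by simp; positivity) (by linarith)
      linarith
    · filter_upwards [eventually_gt_atTop 0] with n hn
      have hn : (0:ℝ) < n := by exact_mod_cast hn
      have h1 := digamma_mono (show (n:ℝ) ∈ Ioi 0 from hn)
        (show x + (n:ℝ) ∈ Ioi 0 by simp; positivity) (by linarith)
      have h2 := digamma_rec hn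
      rw [add_comm (1:ℝ), hψ, h2, one_div]
      linarith
  simpa using this.add_const (ψ x - ψ 1)

lemma norm_digterm {s : ℂ} (hs : 0 < s.re) {k : ℕ} (hk : 1 ≤ k) :
    ‖1 / ((k:ℂ) + 1) - 1 / (s + k)‖ ≤ (‖s‖ + 1) / (k:ℝ)^2 := by
  have hk' : (1:ℝ) ≤ k := by exact_mod_cast hk
  have hn : (k:ℝ) ≤ ‖s + k‖ := by
    refine le_trans ?_ (Complex.re_le_norm _)
    simp; exact hs.le
  have h0 : s + k ≠ 0 := norm_pos_iff.mp (by linarith)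
  have h1 : (k:ℂ) + 1 ≠ 0 := by exact_mod_cast Nat.succ_ne_zero k
  have h2 : ‖(k:ℂ) + 1‖ = k + 1 := by
    have : (k:ℂ) + 1 = ((k + 1 : ℝ) : ℂ) := by push_cast; rfl
    rw [this, Complex.norm_of_nonneg (by positivity)]
  rw [div_sub_div _ _ h1 h0, norm_div, norm_mul, h2]
  have h3 : ‖1 * (s + k) - (k + 1) * 1‖ ≤ ‖s‖ + 1 := by
    have : 1 * (s + k) - ((k:ℂ) + 1) * 1 = s - 1 := by ring
    rw [this]; simpa using norm_sub_le s 1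
  refine div_le_div₀ (by positivity) h3 (by positivity) ?_
  nlinarith

lemma summable_digterm {s : ℂ} (hs : 0 < s.re) :
    Summable fun k : ℕ => 1 / ((k:ℂ) + 1) - 1 / (s + k) := by
  rw [← summable_nat_add_iff 1]
  refine Summable.of_norm_bounded (g := fun k : ℕ => (‖s‖ + 1) * (1 / ((k + 1 : ℕ):ℝ)^2)) ?_ ?_
  · exact ((summable_nat_add_iff 1).mpr
      (Real.summable_one_div_nat_pow.mpr one_lt_two)).mul_left _
  · intro k
    refine (norm_digterm hs (k := k + 1) (by omega)).trans (le_of_eq ?_)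
    ring

lemma digamma_hasSum {s : ℂ} (hs : 0 < s.re) :
    HasSum (fun k : ℕ => 1 / ((k:ℂ) + 1) - 1 / (s + k)) (Complex.digamma s - Complex.digamma 1) := by
  have hS := (summable_digterm hs).hasSum
  have hU : IsOpen ({z : ℂ | 0 < z.re} ∩ Metric.ball 0 (‖s‖ + 1)) :=
    (isOpen_lt continuous_const Complex.continuous_re).inter Metric.isOpen_ball
  have hden : ∀ z : ℂ, 0 < z.re → ∀ k : ℕ, z + k ≠ 0 := fun z hz k h => by
    have := congrArg Complex.re h
    simp at this
    have : (0:ℝ) ≤ k := by positivity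
    linarith
  have hd : DifferentiableOn ℂ (fun z => ∑' k : ℕ, (1 / (((k+1:ℕ):ℂ) + 1) - 1 / (z + (k+1:ℕ))))
      ({z : ℂ | 0 < z.re} ∩ Metric.ball 0 (‖s‖ + 1)) := by
    refine Complex.differentiableOn_tsum_of_summable_norm
      (u := fun k : ℕ => (‖s‖ + 2) * (1 / ((k + 1 : ℕ):ℝ)^2)) ?_ ?_ hU ?_
    · exact ((summable_nat_add_iff 1).mpr
        (Real.summable_one_div_nat_pow.mpr one_lt_two)).mul_left _
    · intro k z hz
      refine DifferentiableAt.differentiableWithinAt ?_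
      have := hden z hz.1 (k+1)
      fun_prop (disch := assumption)
    · intro k z hz
      have hz2 : ‖z‖ < ‖s‖ + 1 := by simpa using hz.2
      refine (norm_digterm hz.1 (k := k + 1) (by omega)).trans ?_
      rw [div_eq_mul_one_div]
      exact mul_le_mul_of_nonneg_right (by linarith) (by positivity)
  have hd2 : DifferentiableOn ℂ (fun z => ∑' k : ℕ, (1 / ((k:ℂ) + 1) - 1 / (z + k)))
      ({z : ℂ | 0 < z.re} ∩ Metric.ball 0 (‖s‖ + 1)) := by
    refine DifferentiableOn.congr (f := fun z => (1 - 1 / z) + ∑' k : ℕ, (1 / (((k+1:ℕ):ℂ) + 1) - 1 / (z + (k+1:ℕ)))) ?_ ?_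
    · refine DifferentiableOn.add ?_ hd
      intro z hz
      have : z ≠ 0 := by simpa using hden z hz.1 0
      refine DifferentiableAt.differentiableWithinAt ?_
      fun_prop (disch := assumption)
    · intro z hz
      rw [(summable_digterm hz.1).tsum_eq_zero_add]
      simp
  have hG : DifferentiableOn ℂ (fun z => Complex.digamma z - Complex.digamma 1)
      ({z : ℂ | 0 < z.re} ∩ Metric.ball 0 (‖s‖ + 1)) := by
    have hg : DifferentiableOn ℂ Complex.Gamma ({z : ℂ | 0 < z.re} ∩ Metric.ball 0 (‖s‖ + 1)) := by
      intro z hz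
      refine (Complex.differentiableAt_Gamma z fun m h => ?_).differentiableWithinAt
      exact hden z hz.1 m (by rw [h]; ring)
    refine DifferentiableOn.sub_const ?_ _
    rw [Complex.digamma_def]
    refine DifferentiableOn.div (hg.deriv hU) hg fun z hz => ?_
    exact Complex.Gamma_ne_zero_of_re_pos hz.1
  have hconv : Convex ℝ ({z : ℂ | 0 < z.re} ∩ Metric.ball 0 (‖s‖ + 1)) :=
    (convex_halfSpace_re_gt 0).inter (convex_ball _ _)
  have hEq := (hd2.analyticOnNhd hU).eqOn_of_preconnected_of_frequently_eq (hG.analyticOnNhd hU)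
    hconv.isPreconnected (z₀ := ((1/2 : ℝ) : ℂ)) ⟨by simp, by
      simp
      have := norm_nonneg s; linarith⟩ ?_
  · have := hEq ⟨hs, by simp⟩
    simp only at this
    rw [← this]; exact hS
  · have ht : Tendsto (fun n : ℕ => ((1/2 + 1/((n:ℝ)+3) : ℝ) : ℂ)) atTop (𝓝[≠] ((1/2 : ℝ) : ℂ)) := by
      refine tendsto_nhdsWithin_iff.mpr ⟨?_, ?_⟩
      · refine (Complex.continuous_ofReal.tendsto _).comp ?_
        have h := tendsto_one_div_add_atTop_nhds_zero_nat (𝕜 := ℝ)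
        have h2 := (tendsto_add_atTop_iff_nat (f := fun n : ℕ => 1 / ((n:ℝ)+1)) 2).mpr h
        have h3 := h2.const_add (1/2 : ℝ)
        simp only [add_zero] at h3
        refine h3.congr fun n => ?_
        push_cast; ring_nf
      · filter_upwards with n
        simp only [mem_compl_iff, mem_singleton_iff, Complex.ofReal_inj]
        have : 0 < 1/((n:ℝ)+3) := by positivity
        linarith
    refine ht.frequently (Eventually.of_forall fun n => ?_).frequently
    set x : ℝ := 1/2 + 1/((n:ℝ)+3) with hx
    have hx0 : 0 < x := by positivity
    have hx1 : x < 1 := by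
      have : 1/((n:ℝ)+3) ≤ 1/3 := by gcongr; have : (0:ℝ) ≤ n := by positivity
                                     linarith
      linarith
    have h1 := (summable_digterm (s := (x:ℂ)) (by simpa using hx0)).hasSum.tendsto_sum_nat
    have h2 := (Complex.continuous_ofReal.tendsto _).comp (digamma_real_tendsto hx0 hx1)
    have h3 := tendsto_nhds_unique h1 (h2.congr fun n => by simp)
    rw [h3, digamma_ofReal hx0]
    have := digamma_ofReal one_pos
    rw [Complex.ofReal_one] at this
    rw [this]; push_cast; rfl

end PC

open Filter Topology MeasureTheory Set
namespace PC

lemma ft_inv {F : ℝ → ℂ} (hc : Continuous F) (hi : Integrable F)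
    (hJ : Integrable fun τ : ℝ => ∫ v : ℝ, F v * Complex.exp (v * (Complex.I * τ))) (u : ℝ) :
    ∫ τ : ℝ, (∫ v : ℝ, F v * Complex.exp (v * (Complex.I * τ))) * Complex.exp (-(u * (Complex.I * τ)))
      = 2 * Real.pi * F u := by
  have hpi : (-(2 * Real.pi) : ℝ) ≠ 0 := by have := Real.pi_pos; simp [this.ne']
  have h1 : ∀ ξ : ℝ, FourierTransform.fourier F ξ =
      ∫ v : ℝ, F v * Complex.exp (v * (Complex.I * ((-(2 * Real.pi) * ξ : ℝ) : ℂ))) := by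
    intro ξ
    rw [Real.fourier_real_eq_integral_exp_smul]
    congr 1; funext v
    rw [smul_eq_mul, mul_comm]
    congr 2; push_cast; ring
  have h2 : Integrable (FourierTransform.fourier F) := by
    have := hJ.comp_mul_left' hpi
    refine this.congr (Eventually.of_forall fun ξ => ?_)
    simp only
    rw [h1]
  have h3 := congrFun (hc.fourierInv_fourier_eq hi h2) u
  rw [Real.fourierInv_eq'] at h3
  rw [← h3]
  have h4 := Measure.integral_comp_mul_left (fun τ : ℝ => (∫ v : ℝ, F v * Complex.exp (v * (Complex.I * τ))) * Complex.exp (-(u * (Complex.I * τ)))) (-(2 * Real.pi))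
  have h5 : ∫ v : ℝ, Complex.exp (((2 * Real.pi * inner ℝ v u : ℝ) : ℂ) * Complex.I) • FourierTransform.fourier F v = ∫ x : ℝ, (fun τ : ℝ => (∫ v : ℝ, F v * Complex.exp (v * (Complex.I * τ))) * Complex.exp (-(u * (Complex.I * τ)))) (-(2 * Real.pi) * x) := by
    congr 1; funext ξ
    simp only
    rw [h1, smul_eq_mul, mul_comm]
    congr 2
    simp only [RCLike.inner_apply, conj_trivial]
    push_cast; ring
  rw [h5, h4, abs_inv, abs_neg, abs_of_pos (by positivity), Complex.real_smul]
  have : (Real.pi : ℂ) ≠ 0 := by exact_mod_cast Real.pi_ne_zero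
  rw [← mul_assoc]
  have e : (2 * Real.pi : ℂ) * (((2 * Real.pi)⁻¹ : ℝ) : ℂ) = 1 := by push_cast; field_simp
  rw [e, one_mul]

lemma planch {F H : ℝ → ℂ} (hc : Continuous F) (hi : Integrable F)
    (hJ : Integrable fun τ : ℝ => ∫ v : ℝ, F v * Complex.exp (v * (Complex.I * τ)))
    (hH : Integrable H) :
    ∫ τ : ℝ, (∫ v : ℝ, F v * Complex.exp (v * (Complex.I * τ))) *
      (∫ v : ℝ, H v * Complex.exp (-(v * (Complex.I * τ)))) = 2 * Real.pi * ∫ v : ℝ, H v * F v := by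
  set J := fun τ : ℝ => ∫ v : ℝ, F v * Complex.exp (v * (Complex.I * τ)) with hJdef
  have hint : Integrable (Function.uncurry fun (τ v : ℝ) => J τ * (H v * Complex.exp (-(v * (Complex.I * τ)))))
      (volume.prod volume) := by
    have h1 : Integrable (fun z : ℝ × ℝ => J z.1 * H z.2) (volume.prod volume) := hJ.mul_prod hH
    have h2 := h1.mul_bdd (c := 1) (g := fun z : ℝ × ℝ => Complex.exp (-(z.2 * (Complex.I * z.1))))
      (Continuous.aestronglyMeasurable (by fun_prop)) (Eventually.of_forall fun z => by
        rw [Complex.norm_exp]; simp)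
    refine h2.congr (Eventually.of_forall fun z => ?_)
    simp only [Function.uncurry]
    ring
  calc ∫ τ : ℝ, J τ * (∫ v : ℝ, H v * Complex.exp (-(v * (Complex.I * τ))))
      = ∫ τ : ℝ, ∫ v : ℝ, J τ * (H v * Complex.exp (-(v * (Complex.I * τ)))) := by
        congr 1; funext τ; rw [integral_const_mul]
    _ = ∫ v : ℝ, ∫ τ : ℝ, J τ * (H v * Complex.exp (-(v * (Complex.I * τ)))) :=
        integral_integral_swap hint
    _ = ∫ v : ℝ, H v * (2 * Real.pi * F v) := by
        congr 1; funext v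
        rw [← ft_inv hc hi hJ v, ← integral_const_mul]
        congr 1; funext τ
        ring
    _ = 2 * Real.pi * ∫ v : ℝ, H v * F v := by
        rw [← integral_const_mul]; congr 1; funext v; ring

noncomputable def gk (M v : ℝ) : ℝ := (1 - v / M) * (1 + v / (4 * M))
noncomputable def gt (M v : ℝ) : ℝ := max 0 (1 - |v| / M) * (1 + |v| / (4 * M))
noncomputable def Q (M : ℝ) (w : ℂ) : ℂ := ∫ v in (0:ℝ)..M, (gk M v : ℂ) * Complex.exp (v * w)

lemma gk_cont (M : ℝ) : Continuous (gk M) := by unfold gk; fun_prop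
lemma gt_cont (M : ℝ) : Continuous (gt M) := by unfold gt; fun_prop
lemma gt_neg (M v : ℝ) : gt M (-v) = gt M v := by simp [gt]
lemma gt_zero (M : ℝ) : gt M 0 = 1 := by simp [gt]

lemma gt_eq {M v : ℝ} (hM : 0 < M) (h0 : 0 ≤ v) (h : v ≤ M) : gt M v = gk M v := by
  have : v / M ≤ 1 := (div_le_one hM).mpr h
  rw [gt, gk, abs_of_nonneg h0, max_eq_right (by linarith)]

lemma gt_eq_zero {M v : ℝ} (hM : 0 < M) (h : M ≤ |v|) : gt M v = 0 := by
  have : 1 ≤ |v| / M := (one_le_div hM).mpr h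
  rw [gt, max_eq_left (by linarith), zero_mul]

lemma gk_nonneg {M v : ℝ} (hM : 0 < M) (h0 : 0 ≤ v) (h : v ≤ M) : 0 ≤ gk M v := by
  have : v / M ≤ 1 := (div_le_one hM).mpr h
  have h1 : 0 ≤ v / (4 * M) := by positivity
  unfold gk
  exact mul_nonneg (by linarith) (by linarith)

lemma gk_le_one {M v : ℝ} (hM : 0 < M) (h0 : 0 ≤ v) : gk M v ≤ 1 := by
  have h1 : v / (4 * M) = (v / M) / 4 := by field_simp
  have h2 : 0 ≤ v / M := by positivity
  unfold gk
  rw [h1]; nlinarith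

lemma gt_compact (M : ℝ) (hM : 0 < M) : HasCompactSupport (gt M) := by
  refine HasCompactSupport.intro (isCompact_Icc (a := -M) (b := M)) fun v hv => ?_
  refine gt_eq_zero hM ?_
  by_contra h
  push Not at h
  exact hv ⟨by linarith [(abs_lt.mp h).1], by linarith [(abs_lt.mp h).2]⟩

lemma gt_mul_integrable {M : ℝ} (hM : 0 < M) {h : ℝ → ℂ} (hh : Continuous h) :
    Integrable fun v => (gt M v : ℂ) * h v := by
  refine Continuous.integrable_of_hasCompactSupport ?_ ?_
  · have := gt_cont M; fun_prop
  · refine HasCompactSupport.mul_right ?_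
    exact (gt_compact M hM).comp_left (g := fun x : ℝ => (x : ℂ)) (by simp)

lemma gt_integral {M : ℝ} (hM : 0 < M) {h : ℝ → ℂ} (hh : Continuous h) :
    ∫ v : ℝ, (gt M v : ℂ) * h v = ∫ v in (0:ℝ)..M, (gk M v : ℂ) * (h v + h (-v)) := by
  have hg := gt_cont M
  have hg2 := gk_cont M
  have h1 : ∫ v : ℝ, (gt M v : ℂ) * h v = ∫ v in (-M)..M, (gt M v : ℂ) * h v := by
    rw [intervalIntegral.integral_eq_integral_of_support_subset]
    intro v hv
    have : gt M v ≠ 0 := fun h => hv (by simp [h])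
    have h2 : ¬ M ≤ |v| := fun h => this (gt_eq_zero hM h)
    push Not at h2
    exact ⟨(abs_lt.mp h2).1, (abs_lt.mp h2).2.le⟩
  have hcont : Continuous fun v : ℝ => (gt M v : ℂ) * h v := by fun_prop
  rw [h1, ← intervalIntegral.integral_add_adjacent_intervals (b := 0)
    (hcont.intervalIntegrable _ _) (hcont.intervalIntegrable _ _)]
  have h3 : ∫ v in (-M)..0, (gt M v : ℂ) * h v = ∫ v in (0:ℝ)..M, (gt M v : ℂ) * h (-v) := by
    have := intervalIntegral.integral_comp_neg (a := 0) (b := M) (fun v => (gt M v : ℂ) * h v)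
    simp only [neg_zero, gt_neg] at this
    rw [this]
  rw [h3, ← intervalIntegral.integral_add (Continuous.intervalIntegrable (by fun_prop) _ _)
    (hcont.intervalIntegrable _ _)]
  refine intervalIntegral.integral_congr fun v hv => ?_
  rw [uIcc_of_le hM.le] at hv
  rw [gt_eq hM hv.1 hv.2]; ring

lemma gt_exp_integral {M : ℝ} (hM : 0 < M) (w : ℂ) :
    ∫ v : ℝ, (gt M v : ℂ) * Complex.exp (v * w) = Q M w + Q M (-w) := by
  have hg2 := gk_cont M
  rw [gt_integral hM (by fun_prop), Q, Q, ← intervalIntegral.integral_add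
    (Continuous.intervalIntegrable (by fun_prop) _ _) (Continuous.intervalIntegrable (by fun_prop) _ _)]
  congr 1; funext v
  rw [mul_add]
  congr 3
  push_cast; ring

lemma Q_closed {M : ℝ} (hM : 0 < M) {w : ℂ} (hw : w ≠ 0) :
    Q M w = -1 / w + (5 / (4 * M) * Complex.exp (M * w) - 3 / (4 * M)) / w ^ 2
      - (Complex.exp (M * w) - 1) / (2 * M ^ 2 * w ^ 3) := by
  have hM' : (M : ℂ) ≠ 0 := by exact_mod_cast hM.ne'
  have hd : ∀ v : ℝ, HasDerivAt (fun v : ℝ => ((gk M v : ℂ) / w - (-3 / (4 * M) - v / (2 * M ^ 2)) / w ^ 2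
      + (-1 / (2 * M ^ 2)) / w ^ 3) * Complex.exp (v * w)) ((gk M v : ℂ) * Complex.exp (v * w)) v := by
    intro v
    have hv : HasDerivAt (fun v : ℝ => (v : ℂ)) 1 v := Complex.ofRealCLM.hasDerivAt
    have hgk : HasDerivAt (fun v : ℝ => (gk M v : ℂ)) (-3 / (4 * M) - v / (2 * M ^ 2)) v := by
      have e : (fun v : ℝ => (gk M v : ℂ)) = fun v : ℝ => (1 - (v:ℂ) / M) * (1 + v / (4 * M)) := by
        funext v; simp [gk]
      rw [e]
      have := ((hv.div_const (M:ℂ)).const_sub 1).mul ((hv.div_const (4 * M : ℂ)).const_add 1)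
      refine this.congr_deriv ?_
      field_simp; ring
    have he : HasDerivAt (fun v : ℝ => Complex.exp (v * w)) (Complex.exp (v * w) * (1 * w)) v :=
      (hv.mul_const w).cexp
    have h2 : HasDerivAt (fun v : ℝ => (-3 / (4 * M) - (v:ℂ) / (2 * M ^ 2)) / w ^ 2)
      ((-(1 / (2 * M ^ 2))) / w ^ 2) v := (((hv.div_const (2 * M ^ 2 : ℂ)).const_sub _).div_const _)
    have := (((hgk.div_const w).sub h2).add_const ((-1 / (2 * M ^ 2)) / w ^ 3)).mul he
    refine this.congr_deriv ?_
    simp only [Pi.sub_apply]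
    field_simp; ring
  have hg2 := gk_cont M
  rw [Q, intervalIntegral.integral_eq_sub_of_hasDerivAt (fun v _ => hd v)
    (Continuous.intervalIntegrable (by fun_prop) _ _)]
  simp only [gk]
  push_cast
  simp only [zero_mul, Complex.exp_zero]
  field_simp
  ring

lemma Q_asym {M : ℝ} (hM : 0 < M) {w : ℂ} (hw : 1 ≤ M * ‖w‖) :
    ‖Q M w + 1 / w‖ ≤ (7 / 4 * Real.exp (M * w.re) + 5 / 4) / (M * ‖w‖ ^ 2) := by
  have hw0 : w ≠ 0 := fun h => by simp [h] at hw; linarith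
  have hn : 0 < ‖w‖ := norm_pos_iff.mpr hw0
  rw [Q_closed hM hw0]
  have e1 : -1 / w + (5 / (4 * M) * Complex.exp (M * w) - 3 / (4 * M)) / w ^ 2
      - (Complex.exp (M * w) - 1) / (2 * M ^ 2 * w ^ 3) + 1 / w =
      (5 / (4 * M) * Complex.exp (M * w) - 3 / (4 * M)) / w ^ 2
      - (Complex.exp (M * w) - 1) / (2 * M ^ 2 * w ^ 3) := by ring
  have hE : ‖Complex.exp (M * w)‖ = Real.exp (M * w.re) := by rw [Complex.norm_exp]; simp
  set E := Real.exp (M * w.re) with hEdef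
  have hE0 : 0 < E := Real.exp_pos _
  rw [e1]
  have n1 : ‖(5 / (4 * M) * Complex.exp (M * w) - 3 / (4 * M)) / w ^ 2‖ ≤ (5 / 4 * E + 3 / 4) / (M * ‖w‖ ^ 2) := by
    rw [norm_div, norm_pow]
    have : ‖(5 / (4 * M) * Complex.exp (M * w) - 3 / (4 * M) : ℂ)‖ ≤ (5 / 4 * E + 3 / 4) / M := by
      refine (norm_sub_le _ _).trans ?_
      rw [norm_mul, norm_div, norm_div, norm_mul, hE, Complex.norm_of_nonneg hM.le]
      simp only [Complex.norm_ofNat]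
      apply le_of_eq; field_simp
    calc _ ≤ ((5 / 4 * E + 3 / 4) / M) / ‖w‖ ^ 2 := by gcongr
      _ = _ := by field_simp
  have n2 : ‖(Complex.exp (M * w) - 1) / (2 * M ^ 2 * w ^ 3)‖ ≤ (1 / 2 * E + 1 / 2) / (M * ‖w‖ ^ 2) := by
    rw [norm_div, norm_mul, norm_mul, norm_pow, norm_pow, Complex.norm_of_nonneg hM.le]
    have : ‖Complex.exp (M * w) - 1‖ ≤ E + 1 := by
      refine (norm_sub_le _ _).trans ?_
      rw [hE]; simp
    simp only [Complex.norm_ofNat]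
    calc _ ≤ (E + 1) / (2 * M ^ 2 * ‖w‖ ^ 3) := by gcongr
      _ ≤ (E + 1) / (2 * (M * ‖w‖ ^ 2)) := by
        refine div_le_div_of_nonneg_left (by positivity) (by positivity) ?_
        have : 2 * M ^ 2 * ‖w‖ ^ 3 = 2 * (M * ‖w‖ ^ 2) * (M * ‖w‖) := by ring
        rw [this]
        exact le_mul_of_one_le_right (by positivity) hw
      _ = _ := by field_simp
  refine (norm_sub_le _ _).trans ((add_le_add n1 n2).trans (le_of_eq ?_))
  field_simp; ring

lemma Q_triv {M : ℝ} (hM : 0 < M) (w : ℂ) : ‖Q M w‖ ≤ M * Real.exp (M * |w.re|) := by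
  have := intervalIntegral.norm_integral_le_of_norm_le_const (a := 0) (b := M)
    (f := fun v : ℝ => (gk M v : ℂ) * Complex.exp (v * w)) (C := Real.exp (M * |w.re|)) ?_
  · rw [sub_zero, abs_of_pos hM, mul_comm] at this
    exact this
  · intro v hv
    rw [uIoc_of_le hM.le] at hv
    rw [norm_mul, Complex.norm_exp, Complex.norm_of_nonneg (gk_nonneg hM hv.1.le hv.2)]
    have h1 : ((v:ℂ) * w).re ≤ M * |w.re| := by
      simp
      calc v * w.re ≤ v * |w.re| := mul_le_mul_of_nonneg_left (le_abs_self _) hv.1.le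
        _ ≤ _ := mul_le_mul_of_nonneg_right hv.2 (abs_nonneg _)
    calc _ ≤ 1 * Real.exp (M * |w.re|) :=
          mul_le_mul (gk_le_one hM hv.1.le) (Real.exp_le_exp.mpr h1) (Real.exp_pos _).le one_pos.le
      _ = _ := one_mul _

lemma QQ_bound {M : ℝ} (hM : 0 < M) {w : ℂ} (hw : 1 ≤ M * ‖w‖) :
    ‖Q M w + Q M (-w)‖ ≤ 6 * Real.exp (M * |w.re|) / (M * ‖w‖ ^ 2) := by
  have h1 := Q_asym hM hw
  have h2 := Q_asym hM (w := -w) (by rwa [norm_neg])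
  rw [norm_neg] at h2
  have e : Q M w + Q M (-w) = (Q M w + 1 / w) + (Q M (-w) + 1 / (-w)) := by
    rw [div_neg]; ring
  rw [e]
  have hn : 0 < ‖w‖ := by
    by_contra h
    have : ‖w‖ = 0 := le_antisymm (not_lt.mp h) (norm_nonneg _)
    rw [this] at hw; linarith
  refine (norm_add_le _ _).trans ((add_le_add h1 h2).trans ?_)
  rw [← add_div]
  gcongr
  have a1 : Real.exp (M * w.re) ≤ Real.exp (M * |w.re|) := by gcongr; exact le_abs_self _
  have a2 : Real.exp (M * (-w).re) ≤ Real.exp (M * |w.re|) := by gcongr; exact neg_le_abs _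
  have a3 : 1 ≤ Real.exp (M * |w.re|) := Real.one_le_exp (by positivity)
  linarith

end PC

open Filter Topology MeasureTheory Set
namespace PC

lemma Q_cont {M : ℝ} : Continuous (Q M) := by
  unfold Q
  have := gk_cont M
  refine intervalIntegral.continuous_parametric_intervalIntegral_of_continuous' ?_ _ _
  simp only [Function.uncurry_def]
  fun_prop

/-- the line `s = 2 + iτ` -/
noncomputable def sl (τ : ℝ) : ℂ := 2 + Complex.I * τ
noncomputable def Jf (M t τ : ℝ) : ℂ :=
  Q M (3/2 - Complex.I * t + Complex.I * τ) + Q M (-(3/2 - Complex.I * t + Complex.I * τ))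
noncomputable def Ff (M t v : ℝ) : ℂ := (gt M v : ℂ) * Complex.exp (v * (3/2 - Complex.I * t))

lemma Ff_ft {M : ℝ} (hM : 0 < M) (t τ : ℝ) :
    ∫ v : ℝ, Ff M t v * Complex.exp (v * (Complex.I * τ)) = Jf M t τ := by
  rw [Jf, ← gt_exp_integral hM]
  congr 1; funext v
  rw [Ff, mul_assoc, ← Complex.exp_add, mul_add (v:ℂ)]

lemma Ff_cont (M t : ℝ) : Continuous (Ff M t) := by
  unfold Ff; have := gt_cont M; fun_prop

lemma Ff_int {M : ℝ} (hM : 0 < M) (t : ℝ) : Integrable (Ff M t) :=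
  gt_mul_integrable hM (by fun_prop)

lemma Jf_cont (M t : ℝ) : Continuous (Jf M t) := by
  unfold Jf; have := Q_cont (M := M); fun_prop

lemma Jf_bound {M : ℝ} (hM : 1 ≤ M) (t : ℝ) :
    ∃ C, 0 < C ∧ ∀ τ, ‖Jf M t τ‖ ≤ C / (1 + |τ|) ^ 2 := by
  refine ⟨6 * Real.exp (M * (3/2)) * (2 * (1 + |t|) ^ 2), by positivity, fun τ => ?_⟩
  set w : ℂ := 3/2 - Complex.I * t + Complex.I * τ with hw
  have hre : w.re = 3/2 := by simp [hw]
  have him : w.im = τ - t := by simp [hw]; ring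
  have hn2 : ‖w‖ ^ 2 = 9/4 + (τ - t) ^ 2 := by
    rw [Complex.sq_norm, Complex.normSq_apply, hre, him]; ring
  have hn1 : 1 ≤ ‖w‖ := by
    have := Complex.re_le_norm w; rw [hre] at this; linarith
  have h := QQ_bound (by linarith : 0 < M) (w := w) (by nlinarith)
  rw [hre, abs_of_pos (by norm_num : (0:ℝ) < 3/2)] at h
  refine h.trans ?_
  rw [div_le_div_iff₀ (by positivity) (by positivity)]
  have h1 : (1 + |τ|) ≤ (1 + |t|) * (1 + |τ - t|) := by
    have : |τ| ≤ |τ - t| + |t| := by simpa using abs_add_le (τ - t) t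
    nlinarith [abs_nonneg t, abs_nonneg (τ - t)]
  have h2 : (1 + |τ - t|) ^ 2 ≤ 2 * ‖w‖ ^ 2 := by
    rw [hn2]; nlinarith [sq_abs (τ - t), sq_nonneg (1 - |τ - t|)]
  have h3 : (1 + |τ|) ^ 2 ≤ (1 + |t|) ^ 2 * (2 * ‖w‖ ^ 2) := by
    calc (1 + |τ|) ^ 2 ≤ ((1 + |t|) * (1 + |τ - t|)) ^ 2 := by gcongr
      _ = (1 + |t|) ^ 2 * (1 + |τ - t|) ^ 2 := by ring
      _ ≤ _ := by gcongr
  have hE : 0 < Real.exp (M * (3/2)) := Real.exp_pos _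
  calc 6 * Real.exp (M * (3/2)) * (1 + |τ|) ^ 2
      ≤ 6 * Real.exp (M * (3/2)) * ((1 + |t|) ^ 2 * (2 * ‖w‖ ^ 2)) := by gcongr
    _ = 6 * Real.exp (M * (3/2)) * (2 * (1 + |t|) ^ 2) * (1 * ‖w‖ ^ 2) := by ring
    _ ≤ _ := by gcongr

lemma int32 : Integrable fun x : ℝ => (1 + |x|) ^ (-(3/2) : ℝ) := by
  have := integrable_one_add_norm (E := ℝ) (μ := volume) (r := 3/2) (by simp; norm_num)
  simpa using this

lemma Jf_int {M : ℝ} (hM : 1 ≤ M) (t : ℝ) : Integrable (Jf M t) := by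
  obtain ⟨C, hC, h⟩ := Jf_bound hM t
  refine (int32.const_mul C).mono' (Jf_cont M t).aestronglyMeasurable (Eventually.of_forall fun τ => (h τ).trans ?_)
  rw [div_eq_mul_inv]
  gcongr
  rw [← Real.rpow_natCast, ← Real.rpow_neg (by positivity)]
  exact Real.rpow_le_rpow_of_exponent_le (by linarith [abs_nonneg τ]) (by norm_num)

lemma I_exp {M : ℝ} (hM : 1 ≤ M) (t u : ℝ) :
    ∫ τ : ℝ, Jf M t τ * Complex.exp (-(u * (Complex.I * τ))) = 2 * Real.pi * Ff M t u := by
  have hM0 : 0 < M := by linarith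
  have h := ft_inv (Ff_cont M t) (Ff_int hM0 t) (by simpa only [Ff_ft hM0] using Jf_int hM t) u
  simpa only [Ff_ft hM0] using h

lemma I_one {M : ℝ} (hM : 1 ≤ M) (t : ℝ) : ∫ τ : ℝ, Jf M t τ = 2 * Real.pi := by
  have := I_exp hM t 0
  simpa [Ff, gt_zero] using this

lemma I_lap {M : ℝ} (hM : 1 ≤ M) (t : ℝ) {z : ℂ} (hz : z.re < 2) :
    ∫ τ : ℝ, Jf M t τ * (1 / (sl τ - z)) = 2 * Real.pi * Q M (z - 1/2 - Complex.I * t) := by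
  have hM0 : 0 < M := by linarith
  set H : ℝ → ℂ := (Ioi (0:ℝ)).indicator fun v => Complex.exp ((z - 2) * v) with hH
  have hHi : Integrable H := by
    rw [hH, integrable_indicator_iff measurableSet_Ioi]
    exact integrableOn_exp_mul_complex_Ioi (by simpa using hz) 0
  have h := planch (Ff_cont M t) (Ff_int hM0 t) (by simpa only [Ff_ft hM0] using Jf_int hM t) hHi
  simp only [Ff_ft hM0] at h
  have e1 : ∀ τ : ℝ, ∫ v : ℝ, H v * Complex.exp (-(v * (Complex.I * τ))) = 1 / (sl τ - z) := by
    intro τ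
    have : (fun v : ℝ => H v * Complex.exp (-(v * (Complex.I * τ)))) =
        (Ioi (0:ℝ)).indicator fun v : ℝ => Complex.exp ((z - sl τ) * v) := by
      funext v
      by_cases hv : v ∈ Ioi (0:ℝ)
      · rw [hH, indicator_of_mem hv, indicator_of_mem hv, ← Complex.exp_add]
        congr 1; rw [sl]; ring
      · rw [hH, indicator_of_notMem hv, indicator_of_notMem hv, zero_mul]
    rw [this, integral_indicator measurableSet_Ioi, integral_exp_mul_complex_Ioi (by simpa [sl] using hz)]
    simp
    rw [← neg_sub (sl τ) z, neg_div_neg_eq, one_div]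
  simp only [e1] at h
  rw [h]
  congr 1
  have e2 : (fun v : ℝ => H v * Ff M t v) = (Ioi (0:ℝ)).indicator fun v : ℝ =>
      (gt M v : ℂ) * Complex.exp (v * (z - 1/2 - Complex.I * t)) := by
    funext v
    by_cases hv : v ∈ Ioi (0:ℝ)
    · rw [hH, indicator_of_mem hv, indicator_of_mem hv, Ff, mul_left_comm, ← Complex.exp_add]
      congr 2; ring
    · rw [hH, indicator_of_notMem hv, indicator_of_notMem hv, zero_mul]
  rw [e2, integral_indicator measurableSet_Ioi, Q, intervalIntegral.integral_of_le hM0.le]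
  rw [setIntegral_eq_of_subset_of_forall_sdiff_eq_zero measurableSet_Ioi Ioc_subset_Ioi_self]
  · refine setIntegral_congr_fun measurableSet_Ioc fun v hv => ?_
    simp only [gt_eq hM0 hv.1.le hv.2]
  · intro v hv
    have h0 : 0 < v := hv.1
    have : M < v := by
      by_contra hc
      exact hv.2 ⟨h0, not_lt.mp hc⟩
    rw [gt_eq_zero hM0 (by rw [abs_of_pos h0]; exact this.le)]
    simp

lemma ab_ineq {A B r : ℝ} (hA : 0 < A) (hB : 0 < B) (hr : 0 < r) (h : r / 4 ≤ max A B) :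
    1 / (A * B) ≤ 2 * r ^ (-(1/2) : ℝ) * (A ^ (-(3/2) : ℝ) + B ^ (-(3/2) : ℝ)) := by
  wlog hAB : A ≤ B generalizing A B
  · have := this hB hA (by rwa [max_comm]) (by linarith)
    rwa [mul_comm A, add_comm (A ^ _)]
  rw [max_eq_right hAB] at h
  have h1 : 1 / (A * B) = A ^ (-1 : ℝ) * (B ^ (-(1/2) : ℝ) * B ^ (-(1/2) : ℝ)) := by
    rw [← Real.rpow_add hB]; norm_num
    rw [Real.rpow_neg_one, Real.rpow_neg_one]; ring
  have h2 : B ^ (-(1/2) : ℝ) ≤ A ^ (-(1/2) : ℝ) :=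
    Real.rpow_le_rpow_of_nonpos hA hAB (by norm_num)
  have h3 : B ^ (-(1/2) : ℝ) ≤ 2 * r ^ (-(1/2) : ℝ) := by
    have := Real.rpow_le_rpow_of_nonpos (by positivity : 0 < r / 4) h (by norm_num : (-(1/2):ℝ) ≤ 0)
    refine this.trans (le_of_eq ?_)
    rw [Real.div_rpow hr.le (by norm_num), Real.rpow_neg (by norm_num : (0:ℝ) ≤ 4),
      ← Real.sqrt_eq_rpow, show (4:ℝ) = 2 ^ 2 by norm_num, Real.sqrt_sq (by norm_num)]
    field_simp
  have h4 : A ^ (-(3/2) : ℝ) = A ^ (-1 : ℝ) * A ^ (-(1/2) : ℝ) := by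
    rw [← Real.rpow_add hA]; norm_num
  have hA1 : 0 ≤ A ^ (-1 : ℝ) := by positivity
  have hB2 : 0 ≤ B ^ (-(3/2) : ℝ) := by positivity
  calc 1 / (A * B) = A ^ (-1 : ℝ) * (B ^ (-(1/2) : ℝ) * B ^ (-(1/2) : ℝ)) := h1
    _ ≤ A ^ (-1 : ℝ) * (A ^ (-(1/2) : ℝ) * (2 * r ^ (-(1/2) : ℝ))) := by gcongr
    _ = 2 * r ^ (-(1/2) : ℝ) * A ^ (-(3/2) : ℝ) := by rw [h4]; ring
    _ ≤ _ := by
      have : 0 ≤ 2 * r ^ (-(1/2) : ℝ) := by positivity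
      nlinarith [mul_nonneg this hB2]

lemma zterm_bound {M : ℝ} (hM : 1 ≤ M) (t : ℝ) :
    ∃ C, 0 < C ∧ ∀ ρ : ℂ, ρ ≠ 0 → ρ.re ≤ 1 →
      Integrable (fun τ => Jf M t τ * (1 / (sl τ - ρ) + 1 / ρ)) ∧
      ∫ τ, ‖Jf M t τ * (1 / (sl τ - ρ) + 1 / ρ)‖ ≤ C * ‖ρ‖ ^ (-(3/2) : ℝ) := by
  obtain ⟨C, hC, h⟩ := Jf_bound hM t
  set K := ∫ x : ℝ, (1 + |x|) ^ (-(3/2) : ℝ) with hK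
  have hK0 : 0 ≤ K := integral_nonneg fun x => by positivity
  refine ⟨2 * C * 2 * (K + 4 * K) + 1, by positivity, fun ρ hρ hre => ?_⟩
  have hn : 0 < ‖ρ‖ := norm_pos_iff.mpr hρ
  have hs1 : ∀ τ : ℝ, 1 ≤ ‖sl τ - ρ‖ := fun τ => by
    refine le_trans ?_ (Complex.re_le_norm _)
    simp [sl]; linarith
  have hs2 : ∀ τ : ℝ, (1 + |τ - ρ.im|) / 2 ≤ ‖sl τ - ρ‖ := fun τ => by
    have := Complex.abs_im_le_norm (sl τ - ρ)
    have e : (sl τ - ρ).im = τ - ρ.im := by simp [sl]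
    rw [e] at this
    linarith [hs1 τ]
  have hs3 : ∀ τ : ℝ, ‖sl τ‖ ≤ 2 * (1 + |τ|) := fun τ => by
    refine (norm_add_le _ _).trans ?_
    simp; linarith [abs_nonneg τ]
  have hsne : ∀ τ : ℝ, sl τ - ρ ≠ 0 := fun τ => norm_pos_iff.mp (by linarith [hs1 τ])
  have hpt : ∀ τ : ℝ, ‖Jf M t τ * (1 / (sl τ - ρ) + 1 / ρ)‖ ≤
      2 * C * 2 * ‖ρ‖ ^ (-(3/2) : ℝ) * ((1 + |τ|) ^ (-(3/2) : ℝ) + 4 * (1 + |τ - ρ.im|) ^ (-(3/2) : ℝ)) := by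
    intro τ
    have e : 1 / (sl τ - ρ) + 1 / ρ = sl τ / (ρ * (sl τ - ρ)) := by
      have := hsne τ
      field_simp; ring
    set A := 1 + |τ| with hA
    set B := ‖sl τ - ρ‖ with hB
    have hA0 : 0 < A := by positivity
    have hB0 : 0 < B := by linarith [hs1 τ]
    rw [norm_mul, e, norm_div, norm_mul]
    have h1 : ‖Jf M t τ‖ * (‖sl τ‖ / (‖ρ‖ * B)) ≤ C / A ^ 2 * ((2 * A) / (‖ρ‖ * B)) := by
      gcongr
      · exact h τ
      · exact hs3 τ
    have h2 : C / A ^ 2 * ((2 * A) / (‖ρ‖ * B)) = 2 * C * ‖ρ‖⁻¹ * (1 / (A * B)) := by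
      field_simp
    have h3 := ab_ineq hA0 hB0 hn (by
      have : ‖ρ‖ ≤ ‖sl τ‖ + B := by
        have := norm_sub_le (sl τ) (sl τ - ρ)
        simpa using this
      have h4 := hs3 τ
      rcases le_total A B with h | h
      · rw [max_eq_right h]; linarith
      · rw [max_eq_left h]; linarith)
    have h4 : B ^ (-(3/2) : ℝ) ≤ 4 * (1 + |τ - ρ.im|) ^ (-(3/2) : ℝ) := by
      have h5 := Real.rpow_le_rpow_of_nonpos (by positivity) (hs2 τ) (by norm_num : (-(3/2):ℝ) ≤ 0)
      refine h5.trans ?_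
      rw [Real.div_rpow (by positivity) (by norm_num), Real.rpow_neg (by norm_num : (0:ℝ) ≤ 2), div_inv_eq_mul, mul_comm]
      gcongr
      calc (2:ℝ) ^ (3/2 : ℝ) ≤ 2 ^ (2:ℝ) := Real.rpow_le_rpow_of_exponent_le (by norm_num) (by norm_num)
        _ = 4 := by norm_num
    have h5 : ‖ρ‖ ^ (-(3/2) : ℝ) = ‖ρ‖⁻¹ * ‖ρ‖ ^ (-(1/2) : ℝ) := by
      rw [← Real.rpow_neg_one, ← Real.rpow_add hn]; norm_num
    calc _ ≤ _ := h1
      _ = _ := h2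
      _ ≤ 2 * C * ‖ρ‖⁻¹ * (2 * ‖ρ‖ ^ (-(1/2) : ℝ) * (A ^ (-(3/2) : ℝ) + 4 * (1 + |τ - ρ.im|) ^ (-(3/2) : ℝ))) := by
        gcongr
        refine h3.trans ?_
        gcongr
      _ = _ := by rw [h5]; ring
  have hint2 : Integrable fun τ : ℝ => (1 + |τ - ρ.im|) ^ (-(3/2) : ℝ) := int32.comp_sub_right ρ.im
  have hbi := (int32.add (hint2.const_mul 4)).const_mul (2 * C * 2 * ‖ρ‖ ^ (-(3/2) : ℝ))
  have hmeas : Continuous fun τ => Jf M t τ * (1 / (sl τ - ρ) + 1 / ρ) := by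
    have h1 := Jf_cont M t
    have h2 : Continuous sl := by unfold sl; fun_prop
    exact h1.mul ((continuous_const.div (h2.sub continuous_const) hsne).add continuous_const)
  have hi : Integrable (fun τ => Jf M t τ * (1 / (sl τ - ρ) + 1 / ρ)) :=
    hbi.mono' hmeas.aestronglyMeasurable (Eventually.of_forall hpt)
  refine ⟨hi, ?_⟩
  refine (integral_mono hi.norm hbi hpt).trans ?_
  have e : ∫ τ : ℝ, (1 + |τ - ρ.im|) ^ (-(3/2) : ℝ) = K :=
    integral_sub_right_eq_self (fun x : ℝ => (1 + |x|) ^ (-(3/2) : ℝ)) ρ.im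
  simp only [Pi.add_apply]
  rw [integral_const_mul, integral_add int32 (hint2.const_mul 4), integral_const_mul, e]
  have : 0 < ‖ρ‖ ^ (-(3/2) : ℝ) := by positivity
  nlinarith

lemma I_zterm {M : ℝ} (hM : 1 ≤ M) (t : ℝ) {ρ : ℂ} (h0 : ρ ≠ 0) (hρ : ρ.re ≤ 1) :
    ∫ τ, Jf M t τ * (1 / (sl τ - ρ) + 1 / ρ) =
      2 * Real.pi * (Q M (ρ - 1/2 - Complex.I * t) + 1 / ρ) := by
  obtain ⟨C, hC, h⟩ := zterm_bound hM t
  have hJ := Jf_int hM t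
  have hi := (h ρ h0 hρ).1
  have h2 : Integrable fun τ => Jf M t τ * (1 / (sl τ - ρ)) := by
    refine (hi.sub (hJ.mul_const (1 / ρ))).congr (Eventually.of_forall fun τ => ?_)
    simp only [Pi.sub_apply]; ring
  simp only [mul_add (Jf M t _)]
  rw [integral_add h2 (hJ.mul_const _), I_lap hM t (by linarith), integral_mul_const, I_one hM t]
  ring

end PC

open Filter Topology MeasureTheory Set
namespace PC
open ArithmeticFunction (vonMangoldt)

abbrev Z := {ρ : ℂ // xi ρ = 0}

lemma xi0 : xi 0 ≠ 0 := by rw [xi_zero]; exact one_ne_zero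

instance : Countable Z := by
  rw [← Set.countable_univ_iff]
  have : (univ : Set Z) = ⋃ n : ℕ, {ρ : Z | ‖(ρ:ℂ)‖ ≤ n} := by
    ext ρ
    simp only [mem_univ, mem_iUnion, true_iff]
    exact exists_nat_ge ‖(ρ:ℂ)‖
  rw [this]
  exact countable_iUnion fun n => (finite_zeros_sub xi_diff xi_zero n).countable

lemma Z_ne (ρ : Z) : (ρ:ℂ) ≠ 0 := fun h => xi0 (by have := ρ.2; rwa [h] at this)
lemma Z_re (ρ : Z) : 0 < (ρ:ℂ).re ∧ (ρ:ℂ).re < 1 := xi_zero_strip ρ.2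

lemma summable_Z : Summable fun ρ : Z => (mu ρ : ℝ) * (1 + ‖(ρ:ℂ)‖) ^ (-(3/2) : ℝ) := by
  obtain ⟨C, hC, h⟩ := xi_growth
  exact summable_weight xi_diff xi_zero hC h

lemma Z_norm_lb : ∃ δ, 0 < δ ∧ ∀ ρ : Z, δ * (1 + ‖(ρ:ℂ)‖) ≤ ‖(ρ:ℂ)‖ := by
  have h1 : ∀ᶠ z in 𝓝 (0:ℂ), xi z ≠ 0 := xi_diff.continuous.continuousAt.eventually_ne xi0
  obtain ⟨ε, hε, h⟩ := Metric.eventually_nhds_iff.mp h1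
  refine ⟨ε / (1 + ε), by positivity, fun ρ => ?_⟩
  have h2 : ε ≤ ‖(ρ:ℂ)‖ := by
    by_contra hc
    exact h (y := (ρ:ℂ)) (by simpa using hc) ρ.2
  rw [div_mul_eq_mul_div, div_le_iff₀ (by positivity)]
  nlinarith

lemma summable_Z' : Summable fun ρ : Z => (mu ρ : ℝ) * ‖(ρ:ℂ)‖ ^ (-(3/2) : ℝ) := by
  obtain ⟨δ, hδ, h⟩ := Z_norm_lb
  refine Summable.of_nonneg_of_le (fun ρ => by positivity) (fun ρ => ?_) (summable_Z.mul_left (δ ^ (-(3/2) : ℝ)))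
  have := Real.rpow_le_rpow_of_nonpos (by positivity) (h ρ) (by norm_num : (-(3/2):ℝ) ≤ 0)
  rw [Real.mul_rpow hδ.le (by positivity)] at this
  calc _ ≤ (mu ρ : ℝ) * (δ ^ (-(3/2) : ℝ) * (1 + ‖(ρ:ℂ)‖) ^ (-(3/2) : ℝ)) := by gcongr
    _ = _ := by ring

/-- partial fractions for zeta on the line Re s = 2 -/
lemma zeta_pf (s : ℂ) (hs : s.re = 2) :
    HasSum (Sum.elim (Sum.elim (fun ρ : Z => (mu ρ : ℂ) * (1 / (s - ρ) + 1 / ρ))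
      (fun k : ℕ => 1 / (s - (-(2 * k + 2))) + 1 / (-(2 * (k:ℂ) + 2))))
      (fun n : ℕ => LSeries.term (fun n => (vonMangoldt n : ℂ)) s n))
      (1 / (s - 1) + (Complex.digamma 1 / 2 - (Real.log Real.pi : ℂ) / 2 - logDeriv xi 0)) := by
  obtain ⟨C, hC, hg⟩ := xi_growth
  have hxs : xi s ≠ 0 := xi_ne_zero_of_one_le (by linarith)
  have hs0 : s ≠ 0 := fun h => by simp [h] at hs
  have h1 := hadamard_hasSum xi_diff xi_zero hC hg s hxs
  have h2 := digamma_hasSum (s := s / 2 + 1) (by simp; linarith)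
  rw [Complex.digamma_apply_add_one _ (fun m h => by
    have := congrArg Complex.re h
    simp [hs] at this
    have : (0:ℝ) ≤ m := by positivity
    linarith)] at h2
  have h2' : HasSum (fun k : ℕ => 1 / (s - (-(2 * k + 2))) + 1 / (-(2 * (k:ℂ) + 2)))
      (-(1/2) * (Complex.digamma (s / 2) + (s / 2)⁻¹ - Complex.digamma 1)) := by
    suffices e : (fun k : ℕ => 1 / (s - (-(2 * k + 2))) + 1 / (-(2 * (k:ℂ) + 2))) =
        fun k : ℕ => (-(1/2) : ℂ) * (1 / ((k:ℂ) + 1) - 1 / (s / 2 + 1 + k)) by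
      rw [e]; exact h2.mul_left _
    funext k
    have a1 : (k:ℂ) + 1 ≠ 0 := by exact_mod_cast Nat.succ_ne_zero k
    have a2 : s / 2 + 1 + k ≠ 0 := fun h => by
      have := congrArg Complex.re h
      simp [hs] at this
      have : (0:ℝ) ≤ k := by positivity
      linarith
    have e1 : s - (-(2 * k + 2)) = 2 * (s / 2 + 1 + k) := by ring
    have e2 : -(2 * (k:ℂ) + 2) = 2 * -(k + 1) := by ring
    rw [e1, e2]
    have a3 : -((k:ℂ) + 1) ≠ 0 := neg_ne_zero.mpr a1
    field_simp
    ring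
  have h3 := (ArithmeticFunction.LSeriesSummable_vonMangoldt (s := s) (by linarith)).hasSum
  have h3' : ∑' n, LSeries.term (fun n => (vonMangoldt n : ℂ)) s n = - logDeriv riemannZeta s := by
    have := ArithmeticFunction.LSeries_vonMangoldt_eq_deriv_riemannZeta_div (s := s) (by linarith)
    rw [LSeries] at this
    rw [this, logDeriv_apply]; ring
  rw [h3'] at h3
  have := (HasSum.sum (f := Sum.elim (fun ρ : Z => (mu ρ : ℂ) * (1 / (s - ρ) + 1 / ρ))
      (fun k : ℕ => 1 / (s - (-(2 * k + 2))) + 1 / (-(2 * (k:ℂ) + 2)))) h1 h2')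
  have := HasSum.sum (f := Sum.elim (Sum.elim (fun ρ : Z => (mu ρ : ℂ) * (1 / (s - ρ) + 1 / ρ))
      (fun k : ℕ => 1 / (s - (-(2 * k + 2))) + 1 / (-(2 * (k:ℂ) + 2))))
      (fun n : ℕ => LSeries.term (fun n => (vonMangoldt n : ℂ)) s n)) this h3
  convert this using 1
  rw [logDeriv_xi (s := s) (by linarith)]
  have : (s / 2)⁻¹ = 2 * (1 / s) := by field_simp
  rw [this]
  ring

noncomputable def ptm (M t : ℝ) (n : ℕ) : ℂ :=
  (vonMangoldt n : ℂ) * (gt M (Real.log n) : ℂ) * Complex.exp (-(Real.log n * (1/2 + Complex.I * t)))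

lemma Iterm {M : ℝ} (hM : 1 ≤ M) (t : ℝ) (n : ℕ) :
    ∫ τ, Jf M t τ * LSeries.term (fun n => (vonMangoldt n : ℂ)) (sl τ) n = 2 * Real.pi * ptm M t n := by
  rcases Nat.eq_zero_or_pos n with rfl | hn
  · simp [ptm]
  have hn0 : (n:ℂ) ≠ 0 := by exact_mod_cast hn.ne'
  have e : ∀ τ : ℝ, Jf M t τ * LSeries.term (fun n => (vonMangoldt n : ℂ)) (sl τ) n =
      ((vonMangoldt n : ℂ) * Complex.exp (-(Real.log n * 2))) *
        (Jf M t τ * Complex.exp (-((Real.log n : ℝ) * (Complex.I * τ)))) := by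
    intro τ
    rw [LSeries.term_of_ne_zero hn.ne', Complex.cpow_def_of_ne_zero hn0, div_eq_mul_inv, ← Complex.exp_neg,
      ← Complex.natCast_log, sl]
    rw [mul_add, neg_add, Complex.exp_add]
    ring
  simp only [e]
  rw [integral_const_mul, I_exp hM, Ff, ptm]
  have : Complex.exp (-(Real.log n * (1/2 + Complex.I * t))) =
      Complex.exp (-(Real.log n * 2)) * Complex.exp ((Real.log n : ℝ) * (3/2 - Complex.I * t)) := by
    rw [← Complex.exp_add]; congr 1; ring
  rw [this]; ring

lemma Iterm_norm {M : ℝ} (hM : 1 ≤ M) (t : ℝ) (n : ℕ) :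
    Integrable (fun τ => Jf M t τ * LSeries.term (fun n => (vonMangoldt n : ℂ)) (sl τ) n) ∧
    ∫ τ, ‖Jf M t τ * LSeries.term (fun n => (vonMangoldt n : ℂ)) (sl τ) n‖ =
      (∫ τ, ‖Jf M t τ‖) * ‖LSeries.term (fun n => (vonMangoldt n : ℂ)) 2 n‖ := by
  have hsl : Continuous sl := by unfold sl; fun_prop
  have hn : ∀ τ, ‖LSeries.term (fun n => (vonMangoldt n : ℂ)) (sl τ) n‖ =
      ‖LSeries.term (fun n => (vonMangoldt n : ℂ)) 2 n‖ := fun τ => by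
    rw [LSeries.norm_term_eq, LSeries.norm_term_eq]
    simp [sl]
  constructor
  · refine (Jf_int hM t).mul_bdd (c := ‖LSeries.term (fun n => (vonMangoldt n : ℂ)) 2 n‖) ?_ (Eventually.of_forall fun τ => (hn τ).le)
    refine Continuous.aestronglyMeasurable ?_
    rcases Nat.eq_zero_or_pos n with rfl | hn
    · simp; fun_prop
    · have hn0 : (n:ℂ) ≠ 0 := by exact_mod_cast hn.ne'
      simp only [LSeries.term_of_ne_zero hn.ne', div_eq_mul_inv, ← Complex.cpow_neg]
      exact continuous_const.mul ((hsl.neg).const_cpow (Or.inl hn0))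
  · simp only [norm_mul, hn]
    rw [integral_mul_const]

set_option maxHeartbeats 2000000 in
lemma explicit : ∃ c0 : ℂ, ∀ M : ℝ, 1 ≤ M → ∀ t : ℝ,
    Summable (fun ρ : Z => (mu ρ : ℂ) * (Q M (ρ - 1/2 - Complex.I * t) + 1 / ρ)) ∧
    Summable (fun k : ℕ => Q M (-(2 * (k:ℂ) + 2) - 1/2 - Complex.I * t) + 1 / (-(2 * (k:ℂ) + 2))) ∧
    (∑' ρ : Z, (mu ρ : ℂ) * (Q M (ρ - 1/2 - Complex.I * t) + 1 / ρ)) +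
    (∑' k : ℕ, (Q M (-(2 * (k:ℂ) + 2) - 1/2 - Complex.I * t) + 1 / (-(2 * (k:ℂ) + 2)))) +
    ∑' n : ℕ, ptm M t n = Q M (1/2 - Complex.I * t) + c0 := by
  refine ⟨Complex.digamma 1 / 2 - (Real.log Real.pi : ℂ) / 2 - logDeriv xi 0, fun M hM t => ?_⟩
  set c0 := Complex.digamma 1 / 2 - (Real.log Real.pi : ℂ) / 2 - logDeriv xi 0
  obtain ⟨C, hC, hb⟩ := zterm_bound hM t
  have hpi : (2 * Real.pi : ℂ) ≠ 0 := by
    have : (Real.pi : ℂ) ≠ 0 := by exact_mod_cast Real.pi_ne_zero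
    simp [this]
  have hk0 : ∀ k : ℕ, -(2 * (k:ℂ) + 2) ≠ 0 := fun k => by
    rw [neg_ne_zero]; exact_mod_cast (by omega : 2 * k + 2 ≠ 0)
  have hkn : ∀ k : ℕ, ‖-(2 * (k:ℂ) + 2)‖ = 2 * k + 2 := fun k => by
    rw [norm_neg]
    have : 2 * (k:ℂ) + 2 = ((2 * k + 2 : ℝ) : ℂ) := by push_cast; ring
    rw [this, Complex.norm_of_nonneg (by positivity)]
  have hkre : ∀ k : ℕ, (-(2 * (k:ℂ) + 2)).re ≤ 1 := fun k => by
    simp; have : (0:ℝ) ≤ k := by positivity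
    linarith
  let Φ : (Z ⊕ ℕ) ⊕ ℕ → ℝ → ℂ := fun i τ => Jf M t τ * (Sum.elim (Sum.elim (fun ρ : Z => (mu ρ : ℂ) * (1 / (sl τ - ρ) + 1 / ρ))
      (fun k : ℕ => 1 / (sl τ - (-(2 * k + 2))) + 1 / (-(2 * (k:ℂ) + 2))))
      (fun n : ℕ => LSeries.term (fun n => (vonMangoldt n : ℂ)) (sl τ) n)) i
  have hz : ∀ ρ : Z, (fun τ => Φ (Sum.inl (Sum.inl ρ)) τ) = fun τ => (mu ρ : ℂ) * (Jf M t τ * (1 / (sl τ - ρ) + 1 / ρ)) := by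
    intro ρ; funext τ; simp only [Φ, Sum.elim_inl]; ring
  have hk : ∀ k : ℕ, (fun τ => Φ (Sum.inl (Sum.inr k)) τ) = fun τ => (Jf M t τ * (1 / (sl τ - (-(2 * k + 2))) + 1 / (-(2 * (k:ℂ) + 2)))) := by
    intro k; funext τ; simp only [Φ, Sum.elim_inl, Sum.elim_inr]
  have hn : ∀ n : ℕ, (fun τ => Φ (Sum.inr n) τ) = fun τ => Jf M t τ * LSeries.term (fun n => (vonMangoldt n : ℂ)) (sl τ) n := by
    intro n; funext τ; simp only [Φ, Sum.elim_inr]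
  have hint : ∀ i, Integrable (Φ i) := by
    rintro ((ρ | k) | n)
    · have := (hb ρ (Z_ne ρ) (Z_re ρ).2.le).1.const_mul (mu ρ : ℂ)
      rw [← hz ρ] at this; exact this
    · have := (hb _ (hk0 k) (hkre k)).1
      rw [← hk k] at this; exact this
    · have := (Iterm_norm hM t n).1
      rw [← hn n] at this; exact this
  have hS1 : Summable fun ρ : Z => ∫ τ, ‖Φ (Sum.inl (Sum.inl ρ)) τ‖ := by
    refine Summable.of_nonneg_of_le (fun ρ => integral_nonneg fun _ => norm_nonneg _) (fun ρ => ?_) (summable_Z'.mul_left C)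
    have h1 := (hb ρ (Z_ne ρ) (Z_re ρ).2.le).2
    have h2 : ∀ τ, ‖Φ (Sum.inl (Sum.inl ρ)) τ‖ = (mu ρ : ℝ) * ‖Jf M t τ * (1 / (sl τ - ρ) + 1 / ρ)‖ := fun τ => by
      rw [show Φ (Sum.inl (Sum.inl ρ)) τ = _ from congrFun (hz ρ) τ, norm_mul, Complex.norm_natCast]
    simp only [h2]
    rw [integral_const_mul, mul_left_comm]
    gcongr
  have hS2 : Summable fun k : ℕ => ∫ τ, ‖Φ (Sum.inl (Sum.inr k)) τ‖ := by
    have hs : Summable fun k : ℕ => C * ((k+1:ℕ):ℝ) ^ (-(3/2):ℝ) :=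
      ((summable_nat_add_iff 1).mpr (Real.summable_nat_rpow.mpr (by norm_num))).mul_left C
    refine Summable.of_nonneg_of_le (fun k => integral_nonneg fun _ => norm_nonneg _) (fun k => ?_) hs
    have h1 := (hb _ (hk0 k) (hkre k)).2
    rw [hkn] at h1
    refine le_trans (le_of_eq ?_) (h1.trans ?_)
    · congr 1
    · gcongr ?_ * ?_
      refine Real.rpow_le_rpow_of_nonpos (by positivity) ?_ (by norm_num)
      push_cast; have : (0:ℝ) ≤ k := by positivity
      linarith
  have hS3 : Summable fun n : ℕ => ∫ τ, ‖Φ (Sum.inr n) τ‖ := by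
    have h1 := (ArithmeticFunction.LSeriesSummable_vonMangoldt (s := 2) (by simp)).norm.mul_left (∫ τ, ‖Jf M t τ‖)
    refine h1.congr fun n => ?_
    exact (Iterm_norm hM t n).2.symm
  have hS : Summable fun i => ∫ τ, ‖Φ i τ‖ := Summable.sum _ (Summable.sum _ hS1 hS2) hS3
  have hH := hasSum_integral_of_summable_integral_norm hint hS
  have hpt : ∀ τ, ∑' i, Φ i τ = Jf M t τ * (1 / (sl τ - 1)) + Jf M t τ * c0 := fun τ => by
    have := (zeta_pf (sl τ) (by simp [sl])).mul_left (Jf M t τ)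
    rw [mul_add] at this
    exact this.tsum_eq
  have hJ := Jf_int hM t
  have hl1 : Integrable fun τ => Jf M t τ * (1 / (sl τ - 1)) := by
    have := (hb 1 one_ne_zero (by simp)).1
    refine (this.sub hJ).congr (Eventually.of_forall fun τ => ?_)
    simp only [Pi.sub_apply]; ring
  have hRHS : ∫ τ, ∑' i, Φ i τ = 2 * Real.pi * (Q M (1/2 - Complex.I * t) + c0) := by
    simp only [hpt]
    rw [integral_add hl1 (hJ.mul_const c0), I_lap hM t (by simp), integral_mul_const, I_one hM]
    rw [show (1:ℂ) - 1/2 = 1/2 by norm_num]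
    ring
  rw [hRHS] at hH
  have hH2 := hH.mul_left (2 * Real.pi : ℂ)⁻¹
  rw [inv_mul_cancel_left₀ hpi] at hH2
  have ez : ∀ ρ : Z, (2 * Real.pi : ℂ)⁻¹ * ∫ τ, Φ (Sum.inl (Sum.inl ρ)) τ = (mu ρ : ℂ) * (Q M (ρ - 1/2 - Complex.I * t) + 1 / ρ) := by
    intro ρ
    have := I_zterm hM t (Z_ne ρ) (Z_re ρ).2.le
    rw [hz, integral_const_mul, this]
    field_simp
  have ek : ∀ k : ℕ, (2 * Real.pi : ℂ)⁻¹ * ∫ τ, Φ (Sum.inl (Sum.inr k)) τ = Q M (-(2 * (k:ℂ) + 2) - 1/2 - Complex.I * t) + 1 / (-(2 * (k:ℂ) + 2)) := by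
    intro k
    have := I_zterm hM t (hk0 k) (hkre k)
    rw [hk, this, inv_mul_cancel_left₀ hpi]
  have en : ∀ n : ℕ, (2 * Real.pi : ℂ)⁻¹ * ∫ τ, Φ (Sum.inr n) τ = ptm M t n := by
    intro n
    rw [hn, Iterm hM, inv_mul_cancel_left₀ hpi]
  have s1 : Summable (fun ρ : Z => (mu ρ : ℂ) * (Q M (ρ - 1/2 - Complex.I * t) + 1 / ρ)) := by
    simp only [← ez]
    exact hH2.summable.comp_injective (i := fun ρ : Z => (Sum.inl (Sum.inl ρ) : (Z ⊕ ℕ) ⊕ ℕ))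
      (Sum.inl_injective.comp Sum.inl_injective)
  have s2 : Summable (fun k : ℕ => Q M (-(2 * (k:ℂ) + 2) - 1/2 - Complex.I * t) + 1 / (-(2 * (k:ℂ) + 2))) := by
    simp only [← ek]
    exact hH2.summable.comp_injective (i := fun k : ℕ => (Sum.inl (Sum.inr k) : (Z ⊕ ℕ) ⊕ ℕ))
      (Sum.inl_injective.comp Sum.inr_injective)
  have s3 : Summable (fun n => ptm M t n) := by
    simp only [← en]
    exact hH2.summable.comp_injective (i := fun n : ℕ => (Sum.inr n : (Z ⊕ ℕ) ⊕ ℕ)) Sum.inr_injective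
  refine ⟨s1, s2, ?_⟩
  rw [← hH2.tsum_eq]
  simp only [← ez, ← ek, ← en] at s1 s2 s3 ⊢
  have q1 := Summable.tsum_sum (f := fun i : Z ⊕ ℕ => (2 * Real.pi : ℂ)⁻¹ * ∫ τ, Φ (Sum.inl i) τ) s1 s2
  have q2 := Summable.tsum_sum (f := fun i => (2 * Real.pi : ℂ)⁻¹ * ∫ τ, Φ i τ) (Summable.sum (fun i : Z ⊕ ℕ => (2 * Real.pi : ℂ)⁻¹ * ∫ τ, Φ (Sum.inl i) τ) s1 s2) s3
  exact (congrArg (· + _) q1).symm.trans q2.symm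

end PC

open Filter Topology MeasureTheory Set
namespace PC
open ArithmeticFunction (vonMangoldt)

noncomputable def kr (M : ℝ) (ρ : ℂ) (t : ℝ) : ℝ := 2 * (Q M (ρ - 1/2 - Complex.I * t)).re

/-- auxiliary -/
noncomputable def hh (t x : ℝ) : ℝ := t^2 / (x * (x^2 + t^2))
noncomputable def HH (t x : ℝ) : ℝ := Real.log (x^2 + t^2) / 2 - Real.log x

lemma HH_deriv {t x : ℝ} (hx : 0 < x) : HasDerivAt (HH t) (-hh t x) x := by
  have h1 : HasDerivAt (fun x : ℝ => x^2 + t^2) (2 * x) x := by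
    simpa using (hasDerivAt_pow 2 x).add_const (t^2)
  have h2 := ((h1.log (by positivity)).div_const 2).sub (Real.hasDerivAt_log hx.ne')
  refine h2.congr_deriv ?_
  unfold hh
  field_simp
  ring

lemma hh_anti {t x y : ℝ} (hx : 0 < x) (h : x ≤ y) : hh t y ≤ hh t x := by
  have hy : 0 < y := hx.trans_le h
  unfold hh
  apply div_le_div_of_nonneg_left (by positivity) (by positivity)
  gcongr

lemma HH_step {t x : ℝ} (hx : 0 < x) : 2 * hh t (x+2) ≤ HH t x - HH t (x+2) ∧ HH t x - HH t (x+2) ≤ 2 * hh t x := by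
  obtain ⟨c, hc, h⟩ := exists_hasDerivAt_eq_slope (HH t) (fun x => -hh t x) (by linarith : x < x + 2)
    (fun y hy => (HH_deriv (by linarith [hy.1])).continuousAt.continuousWithinAt)
    (fun y hy => HH_deriv (by linarith [hy.1]))
  have e : HH t x - HH t (x+2) = 2 * hh t c := by
    field_simp at h
    ring_nf at h ⊢
    linarith
  rw [e]
  have h1 := hh_anti (t := t) (by linarith [hc.1] : 0 < c) hc.2.le
  have h2 := hh_anti (t := t) hx hc.1.le
  constructor <;> linarith

lemma hh_sum {t : ℝ} (ht : 1 ≤ t) : Summable (fun k : ℕ => hh t (2 * k + 5/2)) ∧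
    |∑' k : ℕ, hh t (2 * k + 5/2) - Real.log t / 2| ≤ 2 := by
  have h0 : ∀ k : ℕ, 0 ≤ hh t (2 * k + 5/2) := fun k => by unfold hh; positivity
  have l2 : Real.log 2 ≤ 1 := by linarith [Real.log_two_lt_d9]
  have hH0 : ∀ x, 0 < x → 0 ≤ HH t x := fun x hx => by
    unfold HH
    have := Real.log_le_log (by positivity : 0 < x^2) (by nlinarith [sq_nonneg t] : x^2 ≤ x^2 + t^2)
    rw [Real.log_pow] at this; push_cast at this; linarith
  have hup : ∀ n, ∑ k ∈ Finset.range n, hh t (2 * k + 5/2) ≤ HH t (1/2) / 2 := fun n => by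
    have h1 : ∀ k ∈ Finset.range n, hh t (2 * k + 5/2) ≤ (HH t (2 * k + 1/2) - HH t (2 * (k+1:ℕ) + 1/2)) / 2 := fun k _ => by
      have := (HH_step (t := t) (x := 2 * k + 1/2) (by positivity)).1
      push_cast
      rw [show (2 * (k:ℝ) + 1/2 + 2) = 2 * k + 5/2 by ring] at this
      rw [show (2 * ((k:ℝ) + 1) + 1/2) = 2 * k + 5/2 by ring]
      linarith
    refine (Finset.sum_le_sum h1).trans ?_
    rw [← Finset.sum_div, Finset.sum_range_sub' (fun k : ℕ => HH t (2 * k + 1/2))]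
    have := hH0 (2 * n + 1/2) (by positivity)
    simp; linarith
  have hs : Summable (fun k : ℕ => hh t (2 * k + 5/2)) := summable_of_sum_range_le h0 hup
  refine ⟨hs, abs_le.mpr ⟨?_, ?_⟩⟩
  · obtain ⟨n, hn⟩ := exists_nat_ge t
    have h1 : ∀ k ∈ Finset.range n, (HH t (2 * k + 5/2) - HH t (2 * (k+1:ℕ) + 5/2)) / 2 ≤ hh t (2 * k + 5/2) := fun k _ => by
      have := (HH_step (t := t) (x := 2 * k + 5/2) (by positivity)).2
      push_cast
      rw [show (2 * ((k:ℝ) + 1) + 5/2) = 2 * k + 5/2 + 2 by ring]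
      linarith
    have h2 := (Finset.sum_le_sum h1).trans (hs.sum_le_tsum _ fun k _ => h0 k)
    rw [← Finset.sum_div, Finset.sum_range_sub' (fun k : ℕ => HH t (2 * k + 5/2))] at h2
    have h3 : HH t (2 * n + 5/2) ≤ 1/2 := by
      unfold HH
      have : Real.log ((2 * n + 5/2)^2 + t^2) ≤ Real.log (2 * (2 * n + 5/2)^2) := by
        apply Real.log_le_log (by positivity); nlinarith
      rw [Real.log_mul (by norm_num) (by positivity), Real.log_pow] at this
      push_cast at this; linarith
    have h4 : Real.log t - 2 ≤ HH t (5/2) := by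
      unfold HH
      have a1 : Real.log (t^2) ≤ Real.log ((5/2)^2 + t^2) := Real.log_le_log (by positivity) (by norm_num)
      have a2 : Real.log (5/2) ≤ Real.log (2*2) := Real.log_le_log (by norm_num) (by norm_num)
      rw [Real.log_mul (by norm_num) (by norm_num)] at a2
      rw [Real.log_pow] at a1; push_cast at a1; linarith
    simp only [Nat.cast_zero, mul_zero, zero_add] at h2
    linarith
  · have h1 := Real.tsum_le_of_sum_range_le h0 hup
    have h2 : HH t (1/2) ≤ Real.log t + 3 := by
      unfold HH
      have a1 : Real.log ((1/2)^2 + t^2) ≤ Real.log (2 * t^2) := Real.log_le_log (by positivity) (by nlinarith)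
      rw [Real.log_mul (by norm_num) (by positivity), Real.log_pow] at a1
      have a2 : Real.log (1/2) = - Real.log 2 := by rw [one_div, Real.log_inv]
      push_cast at a1; rw [a2]; linarith
    linarith

lemma triv_sum : ∃ C, ∀ M : ℝ, 1 ≤ M → ∀ t : ℝ, 1 ≤ t →
    |(∑' k : ℕ, (Q M (-(2 * (k:ℂ) + 2) - 1/2 - Complex.I * t) + 1 / (-(2 * (k:ℂ) + 2)))).re + Real.log t / 2| ≤ C := by
  have hs2 : Summable fun k : ℕ => (4:ℝ) / ((k+1:ℕ):ℝ)^2 := by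
    have := (summable_nat_add_iff 1).mpr (Real.summable_one_div_nat_pow.mpr (by norm_num : 1 < 2))
    simpa [div_eq_mul_inv] using this.mul_left 4
  obtain ⟨B, hB⟩ := hs2
  refine ⟨2 + B, fun M hM t ht => ?_⟩
  obtain ⟨_, hx⟩ := explicit
  have hsum := (hx M hM t).2.1
  rw [Complex.re_tsum hsum]
  have hsr : Summable fun k : ℕ => ((Q M (-(2 * (k:ℂ) + 2) - 1/2 - Complex.I * t) + 1 / (-(2 * (k:ℂ) + 2)))).re :=
    (Complex.hasSum_re hsum.hasSum).summable
  obtain ⟨hS, hb⟩ := hh_sum ht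
  have key : ∀ k : ℕ, |((Q M (-(2 * (k:ℂ) + 2) - 1/2 - Complex.I * t) + 1 / (-(2 * (k:ℂ) + 2)))).re + hh t (2 * k + 5/2)| ≤ 4 / ((k+1:ℕ):ℝ)^2 := fun k => by
    set w : ℂ := -(2 * (k:ℂ) + 2) - 1/2 - Complex.I * t with hw
    have hwre : w.re = -(2 * k + 5/2) := by rw [hw]; simp; ring
    have hwim : w.im = -t := by rw [hw]; simp
    have hk0 : (0:ℝ) ≤ k := by positivity
    have hn : 2 * k + 5/2 ≤ ‖w‖ := by
      have := Complex.abs_re_le_norm w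
      rw [hwre, abs_neg, abs_of_nonneg (by positivity)] at this; exact this
    have h1 := Q_asym (M := M) (by linarith) (w := w) (by nlinarith)
    have h2 : (7/4*Real.exp (M * w.re) + 5/4) / (M * ‖w‖^2) ≤ 3 / ((k+1:ℕ):ℝ)^2 := by
      have : Real.exp (M * w.re) ≤ 1 := by
        rw [Real.exp_le_one_iff, hwre]; nlinarith
      have h5 : ((k+1:ℕ):ℝ)^2 ≤ M * ‖w‖^2 := by
        push_cast
        nlinarith [sq_nonneg ‖w‖, pow_le_pow_left₀ (by positivity : (0:ℝ) ≤ k+1) (by linarith : (k:ℝ)+1 ≤ ‖w‖) 2]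
      apply div_le_div₀ (by norm_num) (by linarith) (by positivity) h5
    have h3 : (1/w).re = -((2 * k + 5/2) / ((2*k+5/2)^2 + t^2)) := by
      rw [one_div, Complex.inv_re, Complex.normSq_apply, hwre, hwim, neg_div]
      congr 2; ring
    have h4 : ((1 / (-(2 * (k:ℂ) + 2))) : ℂ).re = -(1 / (2*k+2)) := by
      have : (1 / (-(2 * (k:ℂ) + 2)) : ℂ) = ((-(1 / (2*k+2)) : ℝ) : ℂ) := by
        push_cast; rw [div_neg]
      rw [this, Complex.ofReal_re]
    have h5 := (Complex.abs_re_le_norm (Q M w + 1/w)).trans (h1.trans h2)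
    rw [Complex.add_re, h3] at h5
    rw [Complex.add_re, h4]
    have h6 : hh t (2 * k + 5/2) = 1 / (2*k+2) - (2 * k + 5/2) / ((2*k+5/2)^2 + t^2) - (1/2) / ((2*k+2) * (2*k+5/2)) := by
      unfold hh; field_simp; ring
    have h7 : (1/2) / ((2*(k:ℝ)+2) * (2*k+5/2)) ≤ 1 / ((k+1:ℕ):ℝ)^2 := by
      push_cast
      apply div_le_div₀ (by norm_num) (by norm_num) (by positivity); nlinarith
    have h8 : (0:ℝ) ≤ (1/2) / ((2*(k:ℝ)+2) * (2*k+5/2)) := by positivity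
    have h9 : (4:ℝ) / ((k+1:ℕ):ℝ)^2 = 3 / ((k+1:ℕ):ℝ)^2 + 1 / ((k+1:ℕ):ℝ)^2 := by ring
    rw [h6, h9]
    rw [abs_le] at h5 ⊢
    constructor <;> linarith [h5.1, h5.2]
  have hd := tsum_of_norm_bounded hB (fun k => by rw [Real.norm_eq_abs]; exact key k)
  rw [hsr.tsum_add hS, Real.norm_eq_abs] at hd
  rw [abs_le] at hd hb ⊢
  constructor <;> linarith [hd.1, hd.2, hb.1, hb.2]

lemma summable_re : Summable fun ρ : Z => (mu ρ : ℝ) * (1 / (ρ:ℂ)).re := by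
  obtain ⟨δ, hδ, h⟩ := Z_norm_lb
  have hS : Summable fun ρ : Z => δ ^ (-(1/2) : ℝ) * ((mu ρ : ℝ) * ‖(ρ:ℂ)‖ ^ (-(3/2) : ℝ)) := summable_Z'.mul_left _
  refine Summable.of_nonneg_of_le (f := fun ρ : Z => δ ^ (-(1/2) : ℝ) * ((mu ρ : ℝ) * ‖(ρ:ℂ)‖ ^ (-(3/2) : ℝ))) (fun ρ => ?_) (fun ρ => ?_) hS
  · rw [one_div, Complex.inv_re]
    have := (Z_re ρ).1
    have := Complex.normSq_nonneg (ρ:ℂ)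
    positivity
  · have h0 : 0 < ‖(ρ:ℂ)‖ := norm_pos_iff.mpr (Z_ne ρ)
    have h1 : δ ≤ ‖(ρ:ℂ)‖ := by nlinarith [h ρ]
    have h2 := Real.rpow_le_rpow_of_nonpos hδ h1 (by norm_num : (-(1/2):ℝ) ≤ 0)
    have h3 : (1 / (ρ:ℂ)).re ≤ ‖(ρ:ℂ)‖ ^ (-(1/2):ℝ) * ‖(ρ:ℂ)‖ ^ (-(3/2):ℝ) := by
      rw [← Real.rpow_add h0, one_div, Complex.inv_re, Complex.normSq_eq_norm_sq]
      rw [show (-(1/2):ℝ) + -(3/2) = -2 by norm_num, Real.rpow_neg h0.le, Real.rpow_two, div_eq_mul_inv]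
      have := (Z_re ρ).2
      have : 0 ≤ (‖(ρ:ℂ)‖^2)⁻¹ := by positivity
      nlinarith
    calc _ ≤ (mu ρ : ℝ) * (δ ^ (-(1/2):ℝ) * ‖(ρ:ℂ)‖ ^ (-(3/2):ℝ)) := by
          gcongr; exact h3.trans (by gcongr)
      _ = _ := by ring

lemma f_formula : ∃ C, 0 ≤ C ∧ ∀ M : ℝ, 1 ≤ M → ∀ t : ℝ, Summable (fun ρ : Z => (mu ρ : ℝ) * kr M ρ t) ∧
    (1 ≤ t → Real.exp (M/2) ≤ t → 
    |∑' ρ : Z, (mu ρ : ℝ) * kr M ρ t - (Real.log t - 2 * (∑' n : ℕ, ptm M t n).re)| ≤ C) := by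
  obtain ⟨c0, hx⟩ := explicit
  obtain ⟨C1, hC1⟩ := triv_sum
  set c1 := ∑' ρ : Z, (mu ρ : ℝ) * (1 / (ρ:ℂ)).re
  have hsm : ∀ M : ℝ, 1 ≤ M → ∀ t : ℝ, Summable (fun ρ : Z => (mu ρ : ℝ) * (Q M (ρ - 1/2 - Complex.I * t)).re) ∧
      (∑' ρ : Z, (mu ρ : ℂ) * (Q M (ρ - 1/2 - Complex.I * t) + 1 / ρ)).re = 
      ∑' ρ : Z, (mu ρ : ℝ) * (Q M (ρ - 1/2 - Complex.I * t)).re + c1 := fun M hM t => by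
    have h1 := (hx M hM t).1
    have h2 : Summable fun ρ : Z => ((mu ρ : ℂ) * (Q M (ρ - 1/2 - Complex.I * t) + 1 / ρ)).re := (Complex.hasSum_re h1.hasSum).summable
    have e : ∀ ρ : Z, ((mu ρ : ℂ) * (Q M (ρ - 1/2 - Complex.I * t) + 1 / ρ)).re =
        (mu ρ : ℝ) * (Q M (ρ - 1/2 - Complex.I * t)).re + (mu ρ : ℝ) * (1 / (ρ:ℂ)).re := fun ρ => by
      rw [← Complex.ofReal_natCast, Complex.re_ofReal_mul, Complex.add_re]; ring
    simp only [e] at h2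
    have h3 : Summable (fun ρ : Z => (mu ρ : ℝ) * (Q M (ρ - 1/2 - Complex.I * t)).re) := by
      simpa using h2.sub summable_re
    refine ⟨h3, ?_⟩
    rw [Complex.re_tsum h1]
    simp only [e]
    exact h3.tsum_add summable_re
  have hC1' : 0 ≤ C1 := (abs_nonneg _).trans (hC1 1 le_rfl 1 le_rfl)
  refine ⟨2 * (4 + |c0.re| + |c1| + C1), by positivity, fun M hM t => ?_⟩
  have ek : ∀ ρ : Z, (mu ρ : ℝ) * kr M ρ t = 2 * ((mu ρ : ℝ) * (Q M (ρ - 1/2 - Complex.I * t)).re) := fun ρ => by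
    unfold kr; ring
  obtain ⟨h1, h2⟩ := hsm M hM t
  simp only [ek]
  have h1' : Summable fun ρ : Z => 2 * ((mu ρ : ℝ) * (Q M (ρ - 1/2 - Complex.I * t)).re) := h1.mul_left 2
  refine ⟨h1', fun ht he => ?_⟩
  rw [tsum_mul_left]
  have h3 := congrArg Complex.re (hx M hM t).2.2
  simp only [Complex.add_re] at h3
  rw [h2] at h3
  have h4 := hC1 M hM t ht
  have h5 : |(Q M (1/2 - Complex.I * t)).re| ≤ 4 := by
    set w : ℂ := 1/2 - Complex.I * t with hw
    have hwre : w.re = 1/2 := by rw [hw]; simp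
    have hwim : w.im = -t := by rw [hw]; simp
    have hn : t ≤ ‖w‖ := by
      have := Complex.abs_im_le_norm w
      rw [hwim, abs_neg, abs_of_nonneg (by positivity)] at this; exact this
    have h1 := Q_asym (M := M) (by linarith) (w := w) (by nlinarith)
    have h2 : (7/4*Real.exp (M * w.re) + 5/4) / (M * ‖w‖^2) ≤ 3 := by
      have hw0 : 0 < ‖w‖ := by linarith
      have hM0 : 0 < M := by linarith
      rw [hwre, div_le_iff₀ (by positivity)]
      rw [show M * (1/2) = M/2 by ring]
      have b1 : t ≤ ‖w‖^2 := by nlinarith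
      have b2 : ‖w‖^2 ≤ M * ‖w‖^2 := le_mul_of_one_le_left (by positivity) hM
      linarith
    have h3 : ‖1/w‖ ≤ 1 := by
      rw [norm_div, norm_one]; exact (div_le_one (by linarith)).mpr (by linarith)
    refine (Complex.abs_re_le_norm _).trans ?_
    have := norm_sub_le (Q M w + 1/w) (1/w)
    rw [add_sub_cancel_right] at this
    linarith
  rw [abs_le] at h4 h5 ⊢
  have a1 := le_abs_self c0.re
  have a2 := neg_abs_le c0.re
  have a3 := le_abs_self c1
  have a4 := neg_abs_le c1
  constructor <;> linarith [h4.1, h4.2, h5.1, h5.2]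

end PC

open Filter Topology MeasureTheory Set
namespace PC
open ArithmeticFunction (vonMangoldt)

lemma density : ∃ C, 0 < C ∧ ∀ t : ℝ, 2 ≤ t → Summable (fun ρ : Z => (mu ρ : ℝ) / (1 + (t - (ρ:ℂ).im)^2)) ∧
    ∑' ρ : Z, (mu ρ : ℝ) / (1 + (t - (ρ:ℂ).im)^2) ≤ C * Real.log t := by
  have hP : Summable fun k : ℕ => (1:ℝ) / ((k+1:ℕ):ℝ)^2 := by
    have := (summable_nat_add_iff 1).mpr (Real.summable_one_div_nat_pow.mpr (by norm_num : 1 < 2))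
    exact this
  obtain ⟨P, hP⟩ := hP
  have hP0 : 0 ≤ P := hP.nonneg fun k => by positivity
  set c := (Complex.digamma 1 / 2 - (Real.log Real.pi : ℂ) / 2 - logDeriv xi 0) with hc
  set V := ∑' n, ‖LSeries.term (fun n => (vonMangoldt n : ℂ)) 2 n‖ with hV
  have hV0 : 0 ≤ V := tsum_nonneg fun _ => norm_nonneg _
  set R := ∑' ρ : Z, (mu ρ : ℝ) * (1 / (ρ:ℂ)).re with hR
  refine ⟨4 * (1 + 2 * (P + 3 + |c.re| + V + |R|)), by positivity, fun t ht => ?_⟩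
  set s : ℂ := 2 + Complex.I * t with hs
  have hsre : s.re = 2 := by simp [hs]
  have hsim : s.im = t := by simp [hs]
  have h := Complex.hasSum_re (zeta_pf s hsre)
  set F : (Z ⊕ ℕ) ⊕ ℕ → ℝ := fun i => ((Sum.elim (Sum.elim (fun ρ : Z => (mu ρ : ℂ) * (1 / (s - ρ) + 1 / ρ))
      (fun k : ℕ => 1 / (s - (-(2 * k + 2))) + 1 / (-(2 * (k:ℂ) + 2))))
      (fun n : ℕ => LSeries.term (fun n => (vonMangoldt n : ℂ)) s n)) i).re with hF
  have s1 : Summable (fun ρ : Z => F (Sum.inl (Sum.inl ρ))) :=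
    h.summable.comp_injective (i := fun ρ : Z => (Sum.inl (Sum.inl ρ) : (Z ⊕ ℕ) ⊕ ℕ))
      (Sum.inl_injective.comp Sum.inl_injective)
  have s2 : Summable (fun k : ℕ => F (Sum.inl (Sum.inr k))) :=
    h.summable.comp_injective (i := fun k : ℕ => (Sum.inl (Sum.inr k) : (Z ⊕ ℕ) ⊕ ℕ))
      (Sum.inl_injective.comp Sum.inr_injective)
  have s3 : Summable (fun n : ℕ => F (Sum.inr n)) :=
    h.summable.comp_injective (i := fun n : ℕ => (Sum.inr n : (Z ⊕ ℕ) ⊕ ℕ)) Sum.inr_injective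
  have q1 := Summable.tsum_sum (f := fun i : Z ⊕ ℕ => F (Sum.inl i)) s1 s2
  have q2 := Summable.tsum_sum (f := F) (Summable.sum (fun i : Z ⊕ ℕ => F (Sum.inl i)) s1 s2) s3
  have q3 := h.tsum_eq
  have e1 : ∀ ρ : Z, F (Sum.inl (Sum.inl ρ)) = (mu ρ : ℝ) * (1 / (s - (ρ:ℂ))).re + (mu ρ : ℝ) * (1 / (ρ:ℂ)).re := fun ρ => by
    simp only [hF, Sum.elim_inl]
    rw [← Complex.ofReal_natCast, Complex.re_ofReal_mul, Complex.add_re]; ring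
  simp only [e1] at s1 q1
  have s4 : Summable (fun ρ : Z => (mu ρ : ℝ) * (1 / (s - (ρ:ℂ))).re) := by
    simpa using s1.sub summable_re
  rw [s4.tsum_add summable_re] at q1
  -- lower bound terms
  have hlow : ∀ ρ : Z, (mu ρ : ℝ) / (1 + (t - (ρ:ℂ).im)^2) ≤ 4 * ((mu ρ : ℝ) * (1 / (s - (ρ:ℂ))).re) := fun ρ => by
    have h1 := (Z_re ρ).1
    have h2 := (Z_re ρ).2
    rw [one_div, Complex.inv_re, Complex.normSq_apply, Complex.sub_re, Complex.sub_im, hsre, hsim]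
    have : 1 / (1 + (t - (ρ:ℂ).im)^2) ≤ 4 * ((2 - (ρ:ℂ).re) / ((2 - (ρ:ℂ).re) * (2 - (ρ:ℂ).re) + (t - (ρ:ℂ).im) * (t - (ρ:ℂ).im))) := by
      set x := t - (ρ:ℂ).im
      set u := 2 - (ρ:ℂ).re with hu
      have hu1 : 1 < u := by linarith
      have hu2 : u < 2 := by linarith
      have hu0 : 0 < u * u + x * x := by nlinarith [mul_self_nonneg x]
      rw [← mul_div_assoc, div_le_div_iff₀ (by positivity) hu0]
      nlinarith [sq_nonneg x, mul_nonneg (by linarith : 0 ≤ u - 1) (sq_nonneg x)]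
    calc _ = (mu ρ : ℝ) * (1 / (1 + (t - (ρ:ℂ).im)^2)) := by ring
      _ ≤ (mu ρ : ℝ) * _ := mul_le_mul_of_nonneg_left this (by positivity)
      _ = _ := by ring
  have hsum : Summable (fun ρ : Z => (mu ρ : ℝ) / (1 + (t - (ρ:ℂ).im)^2)) :=
    Summable.of_nonneg_of_le (fun ρ => by positivity) hlow (s4.mul_left 4)
  refine ⟨hsum, ?_⟩
  have hle := hsum.tsum_le_tsum hlow (s4.mul_left 4)
  rw [tsum_mul_left] at hle
  -- k terms
  obtain ⟨hS, hb⟩ := hh_sum (t := t) (by linarith)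
  have e2 : ∀ k : ℕ, -(hh t (2 * k + 5/2) + 1 / ((k+1:ℕ):ℝ)^2) ≤ F (Sum.inl (Sum.inr k)) := fun k => by
    simp only [hF, Sum.elim_inl, Sum.elim_inr]
    have h4 : ((1 / (-(2 * (k:ℂ) + 2))) : ℂ).re = -(1 / (2*k+2)) := by
      have : (1 / (-(2 * (k:ℂ) + 2)) : ℂ) = ((-(1 / (2*k+2)) : ℝ) : ℂ) := by
        push_cast; rw [div_neg]
      rw [this, Complex.ofReal_re]
    have h3 : (1 / (s - (-(2 * (k:ℂ) + 2)))).re = (2*k+4) / ((2*k+4)^2 + t^2) := by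
      have a1 : (s - (-(2 * (k:ℂ) + 2))).re = 2*k+4 := by simp [hs]; ring
      have a2 : (s - (-(2 * (k:ℂ) + 2))).im = t := by simp [hs]
      rw [one_div, Complex.inv_re, Complex.normSq_apply, a1, a2]
      congr 1; ring
    rw [Complex.add_re, h4, h3]
    have h5 := hh_anti (t := t) (x := 2 * k + 5/2) (y := 2*k+4) (by positivity) (by linarith)
    have h6 : hh t (2 * k + 4) = 1 / (2*k+4) - (2 * k + 4) / ((2*k+4)^2 + t^2) := by
      unfold hh; field_simp; ring
    have h7 : 1 / (2*(k:ℝ)+2) - 1 / (2*k+4) ≤ 1 / ((k+1:ℕ):ℝ)^2 := by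
      push_cast
      rw [div_sub_div _ _ (by positivity) (by positivity)]
      have hk : (0:ℝ) ≤ k := by positivity
      rw [div_le_div_iff₀ (by positivity) (by positivity)]
      nlinarith
    linarith
  have hk := (hS.add hP.summable).neg.tsum_le_tsum e2 s2
  rw [tsum_neg, hS.tsum_add hP.summable, hP.tsum_eq] at hk
  -- n terms
  have hv2 := (ArithmeticFunction.LSeriesSummable_vonMangoldt (s := 2) (by simp)).norm
  have e3 : ∀ n : ℕ, ‖F (Sum.inr n)‖ ≤ ‖LSeries.term (fun n => (vonMangoldt n : ℂ)) 2 n‖ := fun n => by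
    simp only [hF, Sum.elim_inr]
    refine (Complex.abs_re_le_norm _).trans (le_of_eq ?_)
    rw [LSeries.norm_term_eq, LSeries.norm_term_eq, hsre]
    simp
  have hn := tsum_of_norm_bounded hv2.hasSum e3
  rw [Real.norm_eq_abs] at hn
  have h7 : (1 / (s - 1)).re ≤ 1 := by
    refine (Complex.re_le_norm _).trans ?_
    have : 1 ≤ ‖s - 1‖ := by
      have := Complex.re_le_norm (s - 1)
      rw [Complex.sub_re, hsre] at this; norm_num at this; exact this
    rw [norm_div, norm_one]; exact (div_le_one (by linarith)).mpr this
  rw [Complex.add_re] at q3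
  have a1 := le_abs_self c.re
  have a4 := neg_abs_le R
  have hl : 1 ≤ 2 * Real.log t := by
    have := Real.log_le_log (by norm_num) ht
    linarith [Real.log_two_gt_d9]
  have hlast : ∑' ρ : Z, (mu ρ : ℝ) * (1 / (s - (ρ:ℂ))).re ≤ Real.log t / 2 + (P + 3 + |c.re| + V + |R|) := by
    have := (abs_le.mp hb).2
    have := (abs_le.mp hn).1
    linarith
  nlinarith [mul_nonneg (by positivity : 0 ≤ P + 3 + |c.re| + V + |R|) (by linarith : 0 ≤ 2 * Real.log t - 1)]

end PC

open Filter Topology MeasureTheory Set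
namespace PC
open ArithmeticFunction (vonMangoldt)

lemma kr_eq {M : ℝ} (ρ : ℂ) (t : ℝ) :
    kr M ρ t = 2 * ∫ v in (0:ℝ)..M, gk M v * Real.exp (v * (ρ.re - 1/2)) * Real.cos (v * (ρ.im - t)) := by
  have hg := gk_cont M
  unfold kr Q
  rw [← Complex.reCLM_apply, ← ContinuousLinearMap.intervalIntegral_comp_comm _ (Continuous.intervalIntegrable (by fun_prop) _ _)]
  congr 2; funext v
  rw [Complex.reCLM_apply, Complex.re_ofReal_mul, Complex.exp_re]
  simp
  ring

lemma kr_cont {M : ℝ} (ρ : ℂ) : Continuous (kr M ρ) := by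
  unfold kr
  have := Q_cont (M := M)
  fun_prop

noncomputable def Gy (M y γ v : ℝ) : ℂ := (gt M v : ℂ) * (Complex.exp (|v| * y) * Complex.exp (v * (Complex.I * γ)))

lemma Gy_cont (M y γ : ℝ) : Continuous (Gy M y γ) := by
  have := gt_cont M
  unfold Gy; fun_prop

lemma Gy_int {M : ℝ} (hM : 0 < M) (y γ : ℝ) : Integrable (Gy M y γ) :=
  gt_mul_integrable hM (h := fun v => Complex.exp (|v| * y) * Complex.exp (v * (Complex.I * γ))) (by fun_prop)

lemma kr_ft {M : ℝ} (hM : 0 < M) (ρ : ℂ) (t x : ℝ) (hx : x = ρ.im - t ∨ x = t - ρ.im) :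
    ∫ v : ℝ, Gy M (ρ.re - 1/2) x v = (kr M ρ t : ℂ) := by
  have hg := gk_cont M
  unfold Gy
  rw [gt_integral hM (h := fun v => Complex.exp (|v| * ((ρ.re - 1/2 : ℝ))) * Complex.exp (v * (Complex.I * x))) (by fun_prop), kr_eq]
  rw [← intervalIntegral.integral_const_mul, ← intervalIntegral.integral_ofReal]
  refine intervalIntegral.integral_congr fun v hv => ?_
  rw [uIcc_of_le hM.le] at hv
  have hc : Real.cos (v * (ρ.im - t)) = Real.cos (v * x) := by
    rcases hx with rfl | rfl
    · rfl
    · rw [← Real.cos_neg]; congr 1; ring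
  rw [hc, abs_neg, abs_of_nonneg hv.1, ← mul_add]
  have : Complex.exp (v * (Complex.I * x)) + Complex.exp ((-v : ℝ) * (Complex.I * x)) = 2 * (Real.cos (v * x) : ℝ) := by
    rw [Complex.ofReal_cos, Complex.two_cos]
    congr 2 <;> push_cast <;> ring
  rw [this]
  push_cast
  ring

lemma kr_far {M : ℝ} (hM : 1 ≤ M) (ρ : ℂ) (t : ℝ) (hx : 1 ≤ |ρ.im - t|) :
    |kr M ρ t| ≤ (2 * |ρ.re - 1/2| + 6 * Real.exp (M * |ρ.re - 1/2|) / M) / (ρ.im - t)^2 := by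
  set w : ℂ := ρ - 1/2 - Complex.I * t with hw
  have hwre : w.re = ρ.re - 1/2 := by rw [hw]; simp
  have hwim : w.im = ρ.im - t := by rw [hw]; simp
  set x := ρ.im - t
  set y := ρ.re - 1/2
  have hn : |x| ≤ ‖w‖ := by rw [← hwim]; exact Complex.abs_im_le_norm w
  have hn2 : x^2 ≤ ‖w‖^2 := by rw [← sq_abs x]; exact pow_le_pow_left₀ (abs_nonneg _) hn 2
  have hx0 : 0 < x^2 := by rw [← sq_abs x]; positivity
  have h1 := Q_asym (M := M) (by linarith) (w := w) (by nlinarith)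
  have h2 : (7/4*Real.exp (M * w.re) + 5/4) / (M * ‖w‖^2) ≤ 3 * Real.exp (M * |y|) / M / x^2 := by
    rw [div_div, hwre]
    have a1 : Real.exp (M * y) ≤ Real.exp (M * |y|) := Real.exp_le_exp.mpr (by gcongr; exact le_abs_self y)
    have a2 : 1 ≤ Real.exp (M * |y|) := Real.one_le_exp (by positivity)
    apply div_le_div₀ (by positivity) (by linarith) (by positivity)
    gcongr
  have h3 : |(1/w).re| ≤ |y| / x^2 := by
    rw [one_div, Complex.inv_re, Complex.normSq_eq_norm_sq, hwre, abs_div, abs_of_nonneg (sq_nonneg ‖w‖)]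
    gcongr
  have h4 := (Complex.abs_re_le_norm _).trans (h1.trans h2)
  rw [Complex.add_re] at h4
  unfold kr
  rw [← hw, abs_mul, abs_of_pos (by norm_num : (0:ℝ) < 2)]
  have h5 := abs_sub ((Q M w).re + (1/w).re) ((1/w).re)
  rw [add_sub_cancel_right] at h5
  have : (2 * |y| + 6 * Real.exp (M * |y|) / M) / x^2 = 2 * (|y| / x^2 + 3 * Real.exp (M * |y|) / M / x^2) := by ring
  rw [this]; linarith

lemma kr_far' {M : ℝ} (hM : 1 ≤ M) (ρ : Z) (t : ℝ) (hx : 1 ≤ |(ρ:ℂ).im - t|) :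
    |kr M ρ t| ≤ 7 * Real.exp (M / 2) / ((ρ:ℂ).im - t)^2 := by
  refine (kr_far hM ρ t hx).trans ?_
  have hy : |(ρ:ℂ).re - 1/2| ≤ 1/2 := abs_le.mpr ⟨by linarith [(Z_re ρ).1], by linarith [(Z_re ρ).2]⟩
  gcongr
  have h1 : Real.exp (M * |(ρ:ℂ).re - 1/2|) ≤ Real.exp (M/2) := Real.exp_le_exp.mpr (by nlinarith)
  have h2 : 1 ≤ Real.exp (M/2) := Real.one_le_exp (by positivity)
  have h3 : 6 * Real.exp (M * |(ρ:ℂ).re - 1/2|) / M ≤ 6 * Real.exp (M * |(ρ:ℂ).re - 1/2|) := div_le_self (by positivity) hM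
  linarith

lemma kr_box {M : ℝ} (hM : 1 ≤ M) (ρ : ℂ) (t : ℝ) (hy : M * |ρ.re - 1/2| ≤ 1) (hx : 1 ≤ |ρ.im - t|) :
    |kr M ρ t| ≤ 40 / M / (1 + (t - ρ.im)^2) := by
  refine (kr_far hM ρ t hx).trans ?_
  have hM0 : 0 < M := by linarith
  have h1 : Real.exp (M * |ρ.re - 1/2|) ≤ 3 := (Real.exp_le_exp.mpr hy).trans (by linarith [Real.exp_one_lt_d9])
  have h2 : 2 * |ρ.re - 1/2| + 6 * Real.exp (M * |ρ.re - 1/2|) / M ≤ 20 / M := by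
    rw [le_div_iff₀ hM0, add_mul, div_mul_cancel₀ _ hM0.ne']
    linarith
  have h3 : 1 ≤ (ρ.im - t)^2 := by rw [← sq_abs]; nlinarith
  have h4 : (t - ρ.im)^2 = (ρ.im - t)^2 := by ring
  rw [h4, div_le_div_iff₀ (by positivity) (by positivity)]
  have h5 : 0 ≤ 20 / M := by positivity
  have h6 : 40 / M = 2 * (20 / M) := by ring
  rw [h6]
  nlinarith

lemma kr_box' {M : ℝ} (hM : 1 ≤ M) (ρ : ℂ) (t : ℝ) (hy : M * |ρ.re - 1/2| ≤ 1) :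
    |kr M ρ t| ≤ 40 * M / (1 + (t - ρ.im)^2) := by
  rcases le_total 1 |ρ.im - t| with h | h
  · refine (kr_box hM ρ t hy h).trans ?_
    gcongr
    rw [div_le_iff₀ (by linarith)]; nlinarith
  · have h1 := Q_triv (M := M) (by linarith) (ρ - 1/2 - Complex.I * t)
    have hwre : (ρ - 1/2 - Complex.I * t).re = ρ.re - 1/2 := by simp
    rw [hwre] at h1
    have h2 : Real.exp (M * |ρ.re - 1/2|) ≤ 3 := (Real.exp_le_exp.mpr hy).trans (by linarith [Real.exp_one_lt_d9])
    have h3 := Complex.abs_re_le_norm (Q M (ρ - 1/2 - Complex.I * t))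
    unfold kr
    rw [abs_mul, abs_of_pos (by norm_num : (0:ℝ) < 2), le_div_iff₀ (by positivity)]
    have h4 : (t - ρ.im)^2 ≤ 1 := by rw [← sq_abs, abs_sub_comm]; nlinarith [abs_nonneg (ρ.im - t)]
    have h5 : |(Q M (ρ - 1/2 - Complex.I * t)).re| ≤ M * 3 := h3.trans (h1.trans (by gcongr))
    nlinarith [abs_nonneg (Q M (ρ - 1/2 - Complex.I * t)).re]

lemma lor_int (γ : ℝ) : Integrable (fun t : ℝ => (1 + (t - γ)^2)⁻¹) := integrable_inv_one_add_sq.comp_sub_right γ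

lemma kr_int {M : ℝ} (hM : 1 ≤ M) (ρ : ℂ) (hy : M * |ρ.re - 1/2| ≤ 1) : Integrable (kr M ρ) := by
  refine ((lor_int ρ.im).const_mul (40 * M)).mono' (kr_cont ρ).aestronglyMeasurable (Eventually.of_forall fun t => ?_)
  rw [← div_eq_mul_inv]; exact kr_box' hM ρ t hy

lemma Gy_mul {M : ℝ} (y γ v : ℝ) (x : ℝ) : Gy M y γ v * Complex.exp (v * (Complex.I * x)) = Gy M y (x + γ) v := by
  unfold Gy
  rw [mul_assoc, mul_assoc, ← Complex.exp_add]
  congr 3; push_cast; ring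

lemma kr_integral {M : ℝ} (hM : 1 ≤ M) (ρ : ℂ) (hy : M * |ρ.re - 1/2| ≤ 1) : ∫ t, kr M ρ t = 2 * Real.pi := by
  have hM0 : 0 < M := by linarith
  have e : ∀ τ : ℝ, ∫ v : ℝ, Gy M (ρ.re - 1/2) (-ρ.im) v * Complex.exp (v * (Complex.I * τ)) = (kr M ρ τ : ℂ) := fun τ => by
    simp only [Gy_mul]
    exact kr_ft hM0 ρ τ _ (Or.inr (by ring))
  have := ft_inv (Gy_cont M (ρ.re - 1/2) (-ρ.im)) (Gy_int hM0 _ _) (by simp only [e]; exact (kr_int hM ρ hy).ofReal) 0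
  simp only [e] at this
  simp only [Gy, gt_zero] at this
  simp at this
  exact_mod_cast this

lemma kr_pair {M : ℝ} (hM : 1 ≤ M) (ρ ρ' : ℂ) (hy : M * |ρ.re - 1/2| ≤ 1) :
    ∫ t, kr M ρ t * kr M ρ' t = 4 * Real.pi * ∫ v in (0:ℝ)..M, gk M v ^ 2 * 
      Real.exp (v * (ρ.re - 1/2 + (ρ'.re - 1/2))) * Real.cos (v * (ρ.im - ρ'.im)) := by
  have hM0 : 0 < M := by linarith
  have hg := gk_cont M
  have hgt := gt_cont M
  have e : ∀ τ : ℝ, ∫ v : ℝ, Gy M (ρ.re - 1/2) (-ρ.im) v * Complex.exp (v * (Complex.I * τ)) = (kr M ρ τ : ℂ) := fun τ => by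
    simp only [Gy_mul]
    exact kr_ft hM0 ρ τ _ (Or.inr (by ring))
  have e' : ∀ τ : ℝ, ∫ v : ℝ, Gy M (ρ'.re - 1/2) (ρ'.im) v * Complex.exp (-(v * (Complex.I * τ))) = (kr M ρ' τ : ℂ) := fun τ => by
    have : ∀ v : ℝ, Complex.exp (-(v * (Complex.I * τ))) = Complex.exp (v * (Complex.I * ((-τ : ℝ) : ℂ))) := fun v => by
      congr 1; push_cast; ring
    simp only [this, Gy_mul]
    exact kr_ft hM0 ρ' τ _ (Or.inl (by ring))
  have := planch (Gy_cont M (ρ.re - 1/2) (-ρ.im)) (Gy_int hM0 _ _) (by simp only [e]; exact (kr_int hM ρ hy).ofReal)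
    (Gy_int hM0 (ρ'.re - 1/2) ρ'.im)
  simp only [e, e'] at this
  have h2 : ∀ v : ℝ, Gy M (ρ'.re - 1/2) ρ'.im v * Gy M (ρ.re - 1/2) (-ρ.im) v =
      (gt M v : ℂ) * ((gt M v : ℂ) * (Complex.exp (|v| * ((ρ.re - 1/2 + (ρ'.re - 1/2) : ℝ) : ℂ)) * Complex.exp (v * (Complex.I * ((ρ'.im - ρ.im : ℝ) : ℂ))))) := fun v => by
    unfold Gy
    rw [mul_mul_mul_comm, mul_mul_mul_comm (Complex.exp _), ← Complex.exp_add, ← Complex.exp_add, mul_assoc]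
    congr 4 <;> push_cast <;> ring
  simp only [h2] at this
  rw [gt_integral hM0 (h := fun v => ((gt M v : ℂ) * (Complex.exp (|v| * ((ρ.re - 1/2 + (ρ'.re - 1/2) : ℝ) : ℂ)) * Complex.exp (v * (Complex.I * ((ρ'.im - ρ.im : ℝ) : ℂ)))))) (by fun_prop)] at this
  have h3 : ∫ v in (0:ℝ)..M, (gk M v : ℂ) * (((gt M v : ℂ) * (Complex.exp (|v| * ((ρ.re - 1/2 + (ρ'.re - 1/2) : ℝ) : ℂ)) * Complex.exp (v * (Complex.I * ((ρ'.im - ρ.im : ℝ) : ℂ))))) + 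
      ((gt M (-v) : ℂ) * (Complex.exp (|(-v)| * ((ρ.re - 1/2 + (ρ'.re - 1/2) : ℝ) : ℂ)) * Complex.exp ((-v : ℝ) * (Complex.I * ((ρ'.im - ρ.im : ℝ) : ℂ)))))) =
      ∫ v in (0:ℝ)..M, ((2 * (gk M v ^ 2 * Real.exp (v * (ρ.re - 1/2 + (ρ'.re - 1/2))) * Real.cos (v * (ρ.im - ρ'.im))) : ℝ) : ℂ) := by
    refine intervalIntegral.integral_congr fun v hv => ?_
    rw [uIcc_of_le hM0.le] at hv
    rw [gt_neg, gt_eq hM0 hv.1 hv.2, abs_neg, abs_of_nonneg hv.1, ← mul_add, ← mul_add]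
    have : Complex.exp (v * (Complex.I * ((ρ'.im - ρ.im : ℝ) : ℂ))) + Complex.exp ((-v : ℝ) * (Complex.I * ((ρ'.im - ρ.im : ℝ) : ℂ))) = 2 * (Real.cos (v * (ρ.im - ρ'.im)) : ℝ) := by
      rw [Complex.ofReal_cos, Complex.two_cos, add_comm]
      congr 2 <;> push_cast <;> ring
    rw [this]
    push_cast
    ring
  rw [h3, intervalIntegral.integral_ofReal, intervalIntegral.integral_const_mul] at this
  have h4 : ((∫ t, kr M ρ t * kr M ρ' t : ℝ) : ℂ) = ∫ t, (kr M ρ t : ℂ) * (kr M ρ' t : ℂ) := by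
    rw [← integral_complex_ofReal]; simp
  rw [← h4] at this
  have h5 := Complex.ofReal_injective (a₁ := ∫ t, kr M ρ t * kr M ρ' t) (a₂ := 2 * Real.pi * (2 * ∫ v in (0:ℝ)..M, gk M v ^ 2 * 
      Real.exp (v * (ρ.re - 1/2 + (ρ'.re - 1/2))) * Real.cos (v * (ρ.im - ρ'.im)))) (by rw [this]; push_cast; ring)
  rw [h5]; ring

end PC

open Filter Topology MeasureTheory Set
namespace PC

lemma gk_sq_int {M : ℝ} (hM : 0 < M) : ∫ v in (0:ℝ)..M, gk M v ^ 2 = M * (181/480) := by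
  have hg := gk_cont M
  have hd : ∀ v : ℝ, HasDerivAt (fun v : ℝ => v - 3/(4*M) * v^2 + 1/(48*M^2) * v^3 + 3/(32*M^3) * v^4 + 1/(80*M^4) * v^5) (gk M v ^ 2) v := fun v => by
    have := ((((hasDerivAt_id v).sub ((hasDerivAt_pow 2 v).const_mul (3/(4*M)))).add ((hasDerivAt_pow 3 v).const_mul (1/(48*M^2)))).add ((hasDerivAt_pow 4 v).const_mul (3/(32*M^3)))).add ((hasDerivAt_pow 5 v).const_mul (1/(80*M^4)))
    refine this.congr_deriv ?_
    unfold gk; push_cast; field_simp; ring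
  rw [intervalIntegral.integral_eq_sub_of_hasDerivAt (fun v _ => hd v) (Continuous.intervalIntegrable (by fun_prop) _ _)]
  field_simp; ring

lemma pol0 {M c : ℝ} (hM : 0 < M) : M * (181/480) ≤ ∫ v in (0:ℝ)..M, gk M v ^ 2 * Real.cosh (v * c) := by
  have hg := gk_cont M
  rw [← gk_sq_int hM]
  refine intervalIntegral.integral_mono_on hM.le (Continuous.intervalIntegrable (by fun_prop) _ _) (Continuous.intervalIntegrable (by fun_prop) _ _) fun v _ => ?_
  nlinarith [Real.one_le_cosh (v * c), sq_nonneg (gk M v)]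

lemma sinh_bd {u : ℝ} (hu : |u| ≤ 1) : |Real.sinh u| ≤ 2 * |u| := by
  have h1 := Real.abs_exp_sub_one_le hu
  have h2 := Real.abs_exp_sub_one_le (x := -u) (by rwa [abs_neg])
  rw [abs_neg] at h2
  rw [Real.sinh_eq, show (Real.exp u - Real.exp (-u)) / 2 = ((Real.exp u - 1) - (Real.exp (-u) - 1)) / 2 by ring, abs_div, abs_two]
  have := abs_sub (Real.exp u - 1) (Real.exp (-u) - 1)
  linarith

lemma pa1 {a : ℝ} (h : 0 ≤ a) : 0.125 + 2.25 * a ≤ 2 * ((3/4+a/2)^2 - (1 - 3/4*a - a^2/4)/2) := by norm_num; nlinarith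
lemma pa2 {a : ℝ} (ha0 : 0 ≤ a) (ha1 : a ≤ 1) : (1 - 3/4*a - a^2/4) * (3/4 + a/2) ≤ 1 := by nlinarith [mul_nonneg ha0 ha0]
lemma pa3 {d : ℝ} (h0 : 0 ≤ d) (hc : d ≤ 0.31) : d^2 ≤ 0.1 := by norm_num at hc ⊢; nlinarith

set_option maxHeartbeats 1000000 in
lemma pol {M c : ℝ} (hM : 0 < M) (hc : M * |c| ≤ 0.31) (x : ℝ) :
    0 ≤ ∫ v in (0:ℝ)..M, gk M v ^ 2 * Real.cosh (v * c) * Real.cos (v * x) := by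
  have hg := gk_cont M
  rcases eq_or_ne x 0 with rfl | hx
  · refine intervalIntegral.integral_nonneg hM.le fun v _ => ?_
    simp only [mul_zero, Real.cos_zero, mul_one]
    have := Real.cosh_pos (v * c)
    positivity
  set g1 : ℝ → ℝ := fun v => -(3/(4*M)) - v/(2*M^2) with hg1
  have dg : ∀ v, HasDerivAt (gk M) (g1 v) v := fun v => by
    have h1 := ((hasDerivAt_id v).div_const M).const_sub 1
    have h2 := ((hasDerivAt_id v).div_const (4*M)).const_add 1
    refine (h1.mul h2).congr_deriv ?_
    simp [hg1]; field_simp; ring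
  have dg1 : ∀ v, HasDerivAt g1 (-(1/(2*M^2))) v := fun v => by
    refine (((hasDerivAt_id v).div_const (2*M^2)).const_sub (-(3/(4*M)))).congr_deriv ?_
    ring
  have dl : ∀ a v : ℝ, HasDerivAt (fun v : ℝ => v * a) a v := fun a v => by
    simpa using (hasDerivAt_id v).mul_const a
  have dch : ∀ v, HasDerivAt (fun v => Real.cosh (v * c)) (Real.sinh (v*c) * c) v := fun v => (dl c v).cosh
  have dsh : ∀ v, HasDerivAt (fun v => Real.sinh (v * c)) (Real.cosh (v*c) * c) v := fun v => (dl c v).sinh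
  have dco : ∀ v, HasDerivAt (fun v => Real.cos (v * x)) (-Real.sin (v*x) * x) v := fun v => (dl x v).cos
  have dsi : ∀ v, HasDerivAt (fun v => Real.sin (v * x)) (Real.cos (v*x) * x) v := fun v => (dl x v).sin
  set p0 : ℝ → ℝ := fun v => gk M v ^ 2 * Real.cosh (v * c) with hp0
  set p1 : ℝ → ℝ := fun v => 2 * (gk M v * g1 v) * Real.cosh (v*c) + gk M v ^ 2 * (Real.sinh (v*c) * c) with hp1
  set p2 : ℝ → ℝ := fun v => 2 * (g1 v ^ 2 - gk M v * (1/(2*M^2))) * Real.cosh (v*c) + 4 * (gk M v * g1 v) * (Real.sinh (v*c) * c)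
    + gk M v ^ 2 * (Real.cosh (v*c) * c^2) with hp2
  have d0 : ∀ v, HasDerivAt p0 (p1 v) v := fun v => by
    refine (((dg v).pow 2).mul (dch v)).congr_deriv ?_
    simp only [hp1, Pi.pow_apply]; push_cast; ring
  have d1 : ∀ v, HasDerivAt p1 (p2 v) v := fun v => by
    have h1 := (((dg v).mul (dg1 v)).const_mul 2).mul (dch v)
    have h2 := ((dg v).pow 2).mul ((dsh v).mul_const c)
    refine (h1.add h2).congr_deriv ?_
    simp [hp2]; ring
  have dΨ : ∀ v, HasDerivAt (fun v => p0 v * Real.sin (v*x) / x - p1 v * (1 - Real.cos (v*x)) / x^2)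
      (p0 v * Real.cos (v*x) - p2 v * (1 - Real.cos (v*x)) / x^2) v := fun v => by
    have h1 := ((d0 v).mul (dsi v)).div_const x
    have h2 := ((d1 v).mul ((dco v).const_sub 1)).div_const (x^2)
    refine (h1.sub h2).congr_deriv ?_
    field_simp; ring
  have cg1 : Continuous g1 := by simp only [hg1]; fun_prop
  have cp0 : Continuous p0 := by simp only [hp0]; have := Real.continuous_cosh; fun_prop
  have cp2 : Continuous p2 := by simp only [hp2]; have := Real.continuous_cosh; have := Real.continuous_sinh; fun_prop
  have hgM : gk M M = 0 := by simp [gk, hM.ne']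
  have hI := intervalIntegral.integral_eq_sub_of_hasDerivAt (a := 0) (b := M) (fun v _ => dΨ v) (Continuous.intervalIntegrable (by fun_prop) _ _)
  rw [intervalIntegral.integral_sub (Continuous.intervalIntegrable (by fun_prop) _ _) (Continuous.intervalIntegrable (by fun_prop) _ _)] at hI
  have e0 : p0 M = 0 := by simp [hp0, hgM]
  have e1 : p1 M = 0 := by simp [hp1, hgM]
  simp only [e0, e1, zero_mul, Real.sin_zero, Real.cos_zero, mul_zero, sub_self, zero_div] at hI
  have hpos : 0 ≤ ∫ v in (0:ℝ)..M, p2 v * (1 - Real.cos (v*x)) / x^2 := by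
    refine intervalIntegral.integral_nonneg hM.le fun v hv => ?_
    have hcos : 0 ≤ 1 - Real.cos (v*x) := by linarith [Real.cos_le_one (v*x)]
    suffices 0 ≤ p2 v by positivity
    obtain ⟨a, rfl⟩ : ∃ a, v = a * M := ⟨v / M, by field_simp⟩
    have ha0 : 0 ≤ a := by have := hv.1; by_contra h; nlinarith
    have ha1 : a ≤ 1 := by have := hv.2; by_contra h; nlinarith
    set d := M * |c| with hd
    have hd0 : 0 ≤ d := by positivity
    have hu : |a * M * c| = a * d := by rw [abs_mul, abs_of_nonneg hv.1, hd]; ring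
    have hsb := sinh_bd (u := a * M * c) (by rw [hu]; norm_num at hc; nlinarith)
    rw [hu] at hsb
    have hG : gk M (a*M) = 1 - 3/4*a - a^2/4 := by unfold gk; field_simp; ring
    have hG1 : g1 (a*M) = -(3/4 + a/2) / M := by simp only [hg1]; field_simp; ring
    have hch := Real.one_le_cosh (a * M * c)
    have hG0 : 0 ≤ 1 - 3/4*a - a^2/4 := by nlinarith
    have key : -(2 * a * d^2) ≤ M * (Real.sinh (a*M*c) * c) := by
      have : |M * (Real.sinh (a*M*c) * c)| ≤ 2 * a * d^2 := by
        rw [abs_mul, abs_mul, abs_of_pos hM]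
        calc M * (|Real.sinh (a*M*c)| * |c|) ≤ M * (2 * (a * d) * |c|) := by gcongr
          _ = 2 * a * d * (M * |c|) := by ring
          _ = _ := by rw [← hd]; ring
      exact (abs_le.mp this).1
    have key2 : M * (Real.sinh (a*M*c) * c) ≤ 2 * a * d^2 := by
      have : |M * (Real.sinh (a*M*c) * c)| ≤ 2 * a * d^2 := by
        rw [abs_mul, abs_mul, abs_of_pos hM]
        calc M * (|Real.sinh (a*M*c)| * |c|) ≤ M * (2 * (a * d) * |c|) := by gcongr
          _ = 2 * a * d * (M * |c|) := by ring
          _ = _ := by rw [← hd]; ring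
      exact (abs_le.mp this).2
    have hfin : p2 (a*M) * M^2 = 2 * ((3/4+a/2)^2 - (1 - 3/4*a - a^2/4)/2) * Real.cosh (a*M*c)
        - 4 * ((1 - 3/4*a - a^2/4) * (3/4 + a/2)) * (M * (Real.sinh (a*M*c) * c))
        + (1 - 3/4*a - a^2/4)^2 * (Real.cosh (a*M*c) * (c*M)^2) := by
      simp only [hp2]; rw [hG, hG1]; field_simp; ring
    have h1 : (0.125 + 2.25 * a) ≤ 2 * ((3/4+a/2)^2 - (1 - 3/4*a - a^2/4)/2) * Real.cosh (a*M*c) := by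
      have b1 : 0.125 + 2.25 * a ≤ 2 * ((3/4+a/2)^2 - (1 - 3/4*a - a^2/4)/2) := pa1 ha0
      exact b1.trans (le_mul_of_one_le_right (by norm_num at b1 ⊢; linarith) hch)
    have h2 : 4 * ((1 - 3/4*a - a^2/4) * (3/4 + a/2)) * (M * (Real.sinh (a*M*c) * c)) ≤ 4 * (2 * a * d^2) := by
      have b1 : 0 ≤ (1 - 3/4*a - a^2/4) * (3/4 + a/2) := by positivity
      have b2 := pa2 ha0 ha1
      have b3 : 0 ≤ 2 * a * d^2 := by positivity
      have b4 := mul_le_mul_of_nonneg_left key2 b1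
      have b5 := mul_le_mul_of_nonneg_right b2 b3
      linarith
    have h3 : d^2 ≤ 0.1 := pa3 hd0 hc
    have h4 : 0 ≤ (1 - 3/4*a - a^2/4)^2 * (Real.cosh (a*M*c) * (c*M)^2) := by positivity
    have h6 : a * d^2 ≤ a * 0.1 := by gcongr
    have h5 : 0 ≤ p2 (a*M) * M^2 := by rw [hfin]; norm_num at h1 h6; linarith
    exact nonneg_of_mul_nonneg_left h5 (by positivity)
  linarith

end PC

open Filter Topology MeasureTheory Set
open ArithmeticFunction (vonMangoldt)
namespace PC

lemma mertensN (N : ℕ) (hN : 1 ≤ N) :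
    |∑ n ∈ Finset.Ioc 0 N, vonMangoldt n / n - Real.log N| ≤ 6 := by
  have hN0 : (0:ℝ) < N := by exact_mod_cast hN
  have h1 : ∑ n ∈ Finset.Ioc 0 N, vonMangoldt n * ((N / n : ℕ):ℝ) = Real.log N.factorial := by
    have h := ArithmeticFunction.sum_Ioc_mul_eq_sum_sum vonMangoldt (ArithmeticFunction.zeta : ArithmeticFunction ℝ) N
    rw [ArithmeticFunction.vonMangoldt_mul_zeta] at h
    have e : ∀ K : ℕ, ∑ m ∈ Finset.Ioc 0 K, (ArithmeticFunction.zeta : ArithmeticFunction ℝ) m = K := by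
      intro K
      have := ArithmeticFunction.sum_Ioc_zeta K
      simp only [ArithmeticFunction.natCoe_apply]
      exact_mod_cast this
    simp only [e] at h
    rw [← h]
    rw [← Finset.prod_Ico_id_eq_factorial, Nat.cast_prod, Real.log_prod]
    · exact Finset.sum_congr (by ext i; simp; lia) fun i _ => rfl
    · intro i hi
      have := (Finset.mem_Ico.1 hi).1
      positivity
  have h2 : Real.log N.factorial ≤ N * Real.log N := by
    rw [← Real.log_pow]
    exact Real.log_le_log (by positivity) (by exact_mod_cast Nat.factorial_le_pow N)
  have h3 := Stirling.le_log_factorial_stirling (n := N) (by lia)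
  have h3' : 0 ≤ Real.log N := Real.log_nonneg (by exact_mod_cast hN)
  have h3'' : 0 ≤ Real.log (2 * Real.pi) := Real.log_nonneg (by linarith [Real.pi_gt_three])
  have h4 := Chebyshev.psi_le_const_mul_self hN0.le
  have h5 : Real.log 4 ≤ 2 := by
    rw [show (4:ℝ) = 2^2 by norm_num, Real.log_pow]; push_cast; linarith [Real.log_two_lt_d9]
  rw [Chebyshev.psi, Nat.floor_natCast] at h4
  have h6 : ∀ n ∈ Finset.Ioc 0 N, vonMangoldt n * ((N / n : ℕ):ℝ) ≤ N * (vonMangoldt n / n) ∧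
      N * (vonMangoldt n / n) ≤ vonMangoldt n * ((N / n : ℕ):ℝ) + vonMangoldt n := by
    intro n hn
    have hn0 := (Finset.mem_Ioc.1 hn).1
    have hL : 0 ≤ vonMangoldt n := ArithmeticFunction.vonMangoldt_nonneg
    have e : N * (vonMangoldt n / n) = vonMangoldt n * ((N:ℝ) / n) := by ring
    have a1 : ((N / n : ℕ):ℝ) ≤ (N:ℝ) / n := Nat.cast_div_le
    have a2 : (N:ℝ) / n ≤ ((N / n : ℕ):ℝ) + 1 := by
      rw [← Nat.floor_div_eq_div (K := ℝ)]
      exact (Nat.lt_floor_add_one _).le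
    rw [e]
    exact ⟨by gcongr, by nlinarith⟩
  have h7 := Finset.sum_le_sum fun n hn => (h6 n hn).1
  have h8 := Finset.sum_le_sum fun n hn => (h6 n hn).2
  rw [Finset.sum_add_distrib, h1, ← Finset.mul_sum] at h8
  rw [h1, ← Finset.mul_sum] at h7
  set S := ∑ n ∈ Finset.Ioc 0 N, vonMangoldt n / n
  rw [abs_le]
  constructor
  · have : N * (Real.log N - 1) ≤ N * S := by linarith
    linarith [le_of_mul_le_mul_left this hN0]
  · have : N * S ≤ N * (Real.log N + 6) := by nlinarith
    linarith [le_of_mul_le_mul_left this hN0]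

lemma mertens (x : ℝ) (hx : 1 ≤ x) :
    |∑ n ∈ Finset.Icc 0 ⌊x⌋₊, vonMangoldt n / n - Real.log x| ≤ 7 := by
  have h1 : 1 ≤ ⌊x⌋₊ := (Nat.one_le_floor_iff _).2 hx
  have h := mertensN _ h1
  have e : ∑ n ∈ Finset.Icc 0 ⌊x⌋₊, vonMangoldt n / n = ∑ n ∈ Finset.Ioc 0 ⌊x⌋₊, vonMangoldt n / n := by
    rw [← Finset.add_sum_Ioc_eq_sum_Icc (by lia)]; simp
  rw [e]
  have h1' : (1:ℝ) ≤ ⌊x⌋₊ := by exact_mod_cast h1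
  have a1 : Real.log ⌊x⌋₊ ≤ Real.log x := Real.log_le_log (by linarith) (Nat.floor_le (by linarith))
  have a2 : Real.log x ≤ Real.log 2 + Real.log ⌊x⌋₊ := by
    rw [← Real.log_mul (by norm_num) (by linarith)]
    exact Real.log_le_log (by linarith) (by linarith [Nat.lt_floor_add_one x])
  have a3 := Real.log_two_lt_d9
  rw [abs_le] at h ⊢
  constructor <;> linarith [h.1, h.2]

noncomputable def hv (M v : ℝ) : ℝ := v * gk M v ^ 2
noncomputable def hvd (M v : ℝ) : ℝ := gk M v ^ 2 + 2 * v * gk M v * (-(3/(4*M)) - v/(2*M^2))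

lemma gk_deriv {M : ℝ} (hM : 0 < M) (v : ℝ) : HasDerivAt (gk M) (-(3/(4*M)) - v/(2*M^2)) v := by
  unfold gk
  have h1 : HasDerivAt (fun v : ℝ => 1 - v / M) (-(1/M)) v := by
    simpa using ((hasDerivAt_id v).div_const M).const_sub 1
  have h2 : HasDerivAt (fun v : ℝ => 1 + v / (4*M)) (1/(4*M)) v := by
    simpa using ((hasDerivAt_id v).div_const (4*M)).const_add 1
  refine (h1.mul h2).congr_deriv ?_
  field_simp; ring

lemma hv_deriv {M : ℝ} (hM : 0 < M) (v : ℝ) : HasDerivAt (hv M) (hvd M v) v := by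
  unfold hv
  refine ((hasDerivAt_id v).mul ((gk_deriv hM v).pow 2)).congr_deriv ?_
  simp [hvd]; ring

lemma hvd_bd {M v : ℝ} (hM : 0 < M) (h0 : 0 ≤ v) (h1 : v ≤ M) : |hvd M v| ≤ 4 := by
  have g0 := gk_nonneg hM h0 h1
  have g1 := gk_le_one (v := v) hM h0
  have e : hvd M v = gk M v ^ 2 - gk M v * ((v/M) * (3/2 + v/M)) := by
    unfold hvd; field_simp; ring
  have a0 : 0 ≤ v/M := by positivity
  have a1 : v/M ≤ 1 := (div_le_one hM).2 h1
  generalize gk M v = g at *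
  generalize v/M = a at *
  have b0 : 0 ≤ a * (3/2+a) := by positivity
  have b1 : a * (3/2+a) ≤ 5/2 := by nlinarith
  have c0 : 0 ≤ g * (a * (3/2+a)) := by positivity
  have c1 : g * (a * (3/2+a)) ≤ 1 * (5/2) := mul_le_mul g1 b1 b0 (by norm_num)
  rw [e, abs_le]
  constructor <;> nlinarith

noncomputable def KK (M v : ℝ) : ℝ :=
  v * hv M v - M^2 * ((v/M)^2/2 - (v/M)^3/2 + (v/M)^4/64 + 3*(v/M)^5/40 + (v/M)^6/96)

lemma KK_deriv {M : ℝ} (hM : 0 < M) (v : ℝ) : HasDerivAt (KK M) (v * hvd M v) v := by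
  unfold KK
  have hd : HasDerivAt (fun v : ℝ => v/M) (1/M) v := (hasDerivAt_id v).div_const M
  refine (((hasDerivAt_id v).mul (hv_deriv hM v)).sub
    ((((((hd.pow 2).div_const 2).sub ((hd.pow 3).div_const 2)).add ((hd.pow 4).div_const 64)).add
      (((hd.pow 5).const_mul 3).div_const 40)).add ((hd.pow 6).div_const 96)|>.const_mul (M^2))).congr_deriv ?_
  simp [hv, gk]; field_simp; ring

lemma sum_d {M : ℝ} (hM : 1 ≤ M) :
    ∑ n ∈ Finset.Icc 0 ⌊Real.exp M⌋₊, vonMangoldt n / n * hv M (Real.log n) ≤ M^2 * (97/960) + 28 * M := by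
  have hM0 : 0 < M := by linarith
  set X := Real.exp M
  have hX : 1 ≤ X := Real.one_le_exp hM0.le
  have hlogX : Real.log X = M := Real.log_exp M
  set f : ℝ → ℝ := fun x => hv M (Real.log x)
  have hfd : ∀ t ∈ Icc 1 X, HasDerivAt f (hvd M (Real.log t) * t⁻¹) t := fun t ht =>
    (hv_deriv hM0 _).comp t (Real.hasDerivAt_log (by linarith [ht.1]))
  have hcl : ContinuousOn Real.log (Icc 1 X) := fun t ht =>
    (Real.continuousAt_log (by linarith [ht.1])).continuousWithinAt
  have hci : ContinuousOn (fun t : ℝ => t⁻¹) (Icc 1 X) :=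
    continuousOn_id.inv₀ (fun t ht => by simp only [id]; linarith [ht.1])
  have hvdc : Continuous (hvd M) := by
    have := gk_cont M
    unfold hvd; fun_prop
  have hcd : ContinuousOn (fun t => hvd M (Real.log t) * t⁻¹) (Icc 1 X) :=
    (hvdc.comp_continuousOn hcl).mul hci
  have hint : IntegrableOn (deriv f) (Icc 1 X) :=
    (hcd.integrableOn_compact isCompact_Icc).congr_fun (fun t ht => (hfd t ht).deriv.symm) measurableSet_Icc
  have habel := sum_mul_eq_sub_integral_mul₀ (fun n : ℕ => vonMangoldt n / n) (f := f) (by simp) X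
    (fun t ht => (hfd t ht).differentiableAt) hint
  have hfX : f X = 0 := by simp only [f, hlogX, hv, gk]; rw [div_self hM0.ne']; simp
  rw [hfX, zero_mul, zero_sub] at habel
  have e1 : ∑ n ∈ Finset.Icc 0 ⌊X⌋₊, vonMangoldt n / n * hv M (Real.log n)
      = ∑ k ∈ Finset.Icc 0 ⌊X⌋₊, f k * (vonMangoldt k / k) :=
    Finset.sum_congr rfl fun n _ => by ring
  rw [e1, habel]
  -- main term
  have hF : ∫ t in Ioc 1 X, hvd M (Real.log t) * t⁻¹ * Real.log t = - (M^2 * (97/960)) := by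
    rw [← intervalIntegral.integral_of_le hX]
    have : ∀ t ∈ uIcc 1 X, HasDerivAt (fun t => KK M (Real.log t)) (hvd M (Real.log t) * t⁻¹ * Real.log t) t := by
      intro t ht
      rw [uIcc_of_le hX] at ht
      refine ((KK_deriv hM0 _).comp t (Real.hasDerivAt_log (by linarith [ht.1]))).congr_deriv ?_
      ring
    rw [intervalIntegral.integral_eq_sub_of_hasDerivAt this]
    · rw [hlogX, Real.log_one]; unfold KK hv gk; field_simp; ring
    · apply ContinuousOn.intervalIntegrable
      rw [uIcc_of_le hX]
      exact hcd.mul hcl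
  have hi1 : IntegrableOn (fun t => hvd M (Real.log t) * t⁻¹ * Real.log t) (Ioc 1 X) :=
    ((hcd.mul hcl).integrableOn_compact isCompact_Icc).mono_set Ioc_subset_Icc_self
  have hi2 : IntegrableOn (fun t => deriv f t * ∑ k ∈ Finset.Icc 0 ⌊t⌋₊, vonMangoldt k / k) (Ioc 1 X) :=
    (integrableOn_mul_sum_Icc (m := 0) (fun n : ℕ => vonMangoldt n / n) zero_le_one hint).mono_set Ioc_subset_Icc_self
  have herr : ‖∫ t in Ioc 1 X, (deriv f t * ∑ k ∈ Finset.Icc 0 ⌊t⌋₊, vonMangoldt k / k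
      - hvd M (Real.log t) * t⁻¹ * Real.log t)‖ ≤ ∫ t in Ioc 1 X, 28 * t⁻¹ := by
    apply norm_integral_le_of_norm_le
    · exact ((hci.const_smul (28:ℝ)).integrableOn_compact isCompact_Icc).mono_set Ioc_subset_Icc_self
    · refine (ae_restrict_iff' measurableSet_Ioc).2 (ae_of_all _ fun t ht => ?_)
      have ht' : t ∈ Icc 1 X := Ioc_subset_Icc_self ht
      have ht0 : 0 < t := by linarith [ht.1]
      rw [(hfd t ht').deriv, ← mul_sub, Real.norm_eq_abs, abs_mul, abs_mul, abs_of_pos (inv_pos.2 ht0)]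
      have b1 := hvd_bd hM0 (Real.log_nonneg ht'.1) (by rw [← hlogX]; exact Real.log_le_log ht0 ht.2)
      have b2 := mertens t ht'.1
      calc _ ≤ 4 * t⁻¹ * 7 := by gcongr
        _ = _ := by ring
  have hlog : ∫ t in Ioc 1 X, 28 * t⁻¹ = 28 * M := by
    rw [integral_const_mul, ← intervalIntegral.integral_of_le hX, integral_inv_of_pos one_pos (by linarith), div_one, hlogX]
  rw [integral_sub hi2 hi1, hF, hlog, Real.norm_eq_abs, abs_le] at herr
  linarith [herr.1]

end PC

open Filter Topology MeasureTheory Set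
open ArithmeticFunction (vonMangoldt)
namespace PC

noncomputable def Dm (M t : ℝ) : ℝ := 2 * (∑' n, ptm M t n).re
noncomputable def am (M : ℝ) (n : ℕ) : ℝ := 2 * vonMangoldt n * gt M (Real.log n) * Real.exp (-(Real.log n / 2))
noncomputable abbrev NM (M : ℝ) : Finset ℕ := Finset.Icc 2 ⌊Real.exp M⌋₊

lemma Dm_eq {M : ℝ} (hM : 0 < M) (t : ℝ) : Dm M t = ∑ n ∈ NM M, am M n * Real.cos (t * Real.log n) := by
  have h : ∑' n, ptm M t n = ∑ n ∈ NM M, ptm M t n := by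
    apply tsum_eq_sum
    intro n hn
    rw [Finset.mem_Icc, not_and_or] at hn
    rcases hn with h | h
    · have : n = 0 ∨ n = 1 := by lia
      rcases this with rfl | rfl <;> simp [ptm]
    · have h1 : Real.exp M ≤ n := (Nat.lt_of_floor_lt (by lia)).le
      have h2 : M ≤ Real.log n := by rw [← Real.log_exp M]; exact Real.log_le_log (Real.exp_pos _) h1
      rw [ptm, gt_eq_zero hM (h2.trans (le_abs_self _))]; simp
  rw [Dm, h, Complex.re_sum, Finset.mul_sum]
  refine Finset.sum_congr rfl fun n _ => ?_
  rw [ptm, ← Complex.ofReal_mul, Complex.re_ofReal_mul, Complex.exp_re, am]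
  have e1 : (-((Real.log n : ℂ) * (1 / 2 + Complex.I * t))).re = -(Real.log n / 2) := by
    generalize Real.log n = l
    simp [div_eq_mul_inv]
  have e2 : (-((Real.log n : ℂ) * (1 / 2 + Complex.I * t))).im = -(t * Real.log n) := by
    generalize Real.log n = l
    simp [div_eq_mul_inv, mul_comm]
  rw [e1, e2, Real.cos_neg]; ring

lemma Dm_cont {M : ℝ} (hM : 0 < M) : Continuous (Dm M) := by
  rw [funext (Dm_eq hM)]
  fun_prop

lemma gt_bd {M : ℝ} (hM : 0 < M) (v : ℝ) : 0 ≤ gt M v ∧ gt M v ≤ 1 := by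
  wlog h : 0 ≤ v generalizing v
  · rw [← gt_neg]; exact this (-v) (by linarith)
  rcases le_total v M with h1 | h1
  · rw [gt_eq hM h h1]; exact ⟨gk_nonneg hM h h1, gk_le_one hM h⟩
  · rw [gt_eq_zero hM (h1.trans (le_abs_self _))]; norm_num

lemma am_nonneg {M : ℝ} (hM : 0 < M) (n : ℕ) : 0 ≤ am M n := by
  have := (gt_bd hM (Real.log n)).1
  have h2 : 0 ≤ vonMangoldt n := ArithmeticFunction.vonMangoldt_nonneg
  unfold am; positivity

lemma NM_log {M : ℝ} {n : ℕ} (hn : n ∈ NM M) : 0 < (n:ℝ) ∧ 1/2 ≤ Real.log n ∧ Real.log n ≤ M := by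
  rw [Finset.mem_Icc] at hn
  have h2 : (2:ℝ) ≤ n := by exact_mod_cast hn.1
  refine ⟨by linarith, ?_, ?_⟩
  · have := Real.log_le_log (by norm_num) h2
    linarith [Real.log_two_gt_d9]
  · rw [← Real.log_exp M]
    exact Real.log_le_log (by linarith) ((Nat.le_floor_iff (Real.exp_pos _).le).1 hn.2)

lemma exp_half_sq {n : ℕ} (h : 0 < (n:ℝ)) : Real.exp (-(Real.log n / 2)) = (√(n:ℝ))⁻¹ := by
  rw [Real.exp_neg, ← Real.log_sqrt h.le, Real.exp_log (Real.sqrt_pos.2 h)]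

lemma sum_sqrt (N : ℕ) : ∑ n ∈ Finset.Icc 1 N, (√(n:ℝ))⁻¹ ≤ 2 * √(N:ℝ) := by
  induction N with
  | zero => simp
  | succ N ih =>
    rw [Finset.sum_Icc_succ_top (by lia)]
    have h1 : 0 < √((N+1:ℕ):ℝ) := Real.sqrt_pos.2 (by positivity)
    have h2 : 0 ≤ √(N:ℝ) := Real.sqrt_nonneg _
    have e1 : √((N+1:ℕ):ℝ)^2 = N + 1 := by rw [Real.sq_sqrt (by positivity)]; push_cast; ring
    have e2 : √(N:ℝ)^2 = N := Real.sq_sqrt (by positivity)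
    have h3 : (√((N+1:ℕ):ℝ))⁻¹ ≤ 2 * √((N+1:ℕ):ℝ) - 2 * √(N:ℝ) := by
      rw [inv_le_iff_one_le_mul₀ h1]
      nlinarith [sq_nonneg (√((N+1:ℕ):ℝ) - √(N:ℝ))]
    linarith

lemma cos_int {l : ℝ} (hl : l ≠ 0) (A B : ℝ) : |∫ t in A..B, Real.cos (t * l)| ≤ 2 / |l| := by
  rw [intervalIntegral.integral_comp_mul_right _ hl, integral_cos, smul_eq_mul, abs_mul, abs_inv, div_eq_inv_mul]
  gcongr
  have := Real.abs_sin_le_one (B*l)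
  have := Real.abs_sin_le_one (A*l)
  have := abs_sub (Real.sin (B*l)) (Real.sin (A*l))
  linarith

lemma Dm_int {M : ℝ} (hM : 0 < M) (A B : ℝ) : |∫ t in A..B, Dm M t| ≤ 8 * Real.exp (M/2) := by
  simp only [Dm_eq hM]
  rw [intervalIntegral.integral_finsetSum (fun n _ => (by fun_prop : Continuous _).intervalIntegrable _ _)]
  refine (Finset.abs_sum_le_sum_abs _ _).trans ?_
  have h : ∀ n ∈ NM M, |∫ t in A..B, am M n * Real.cos (t * Real.log n)| ≤ 4 * (√(n:ℝ))⁻¹ := by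
    intro n hn
    obtain ⟨h0, h1, h2⟩ := NM_log hn
    have hg := gt_bd hM (Real.log n)
    have hL : vonMangoldt n ≤ Real.log n := ArithmeticFunction.vonMangoldt_le_log
    have hL0 : 0 ≤ vonMangoldt n := ArithmeticFunction.vonMangoldt_nonneg
    have hl : 0 < Real.log n := by linarith
    rw [intervalIntegral.integral_const_mul, abs_mul, abs_of_nonneg (am_nonneg hM n)]
    have hc := cos_int hl.ne' A B
    rw [abs_of_pos hl] at hc
    have ha : am M n ≤ 2 * Real.log n * 1 * (√(n:ℝ))⁻¹ := by
      unfold am; rw [exp_half_sq h0]; gcongr; exacts [hg.1, hg.2]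
    calc _ ≤ (2 * Real.log n * 1 * (√(n:ℝ))⁻¹) * (2 / Real.log n) :=
          mul_le_mul ha hc (abs_nonneg _) (by positivity)
      _ = _ := by field_simp; ring
  refine (Finset.sum_le_sum h).trans ?_
  rw [← Finset.mul_sum]
  have h1 : ∑ n ∈ NM M, (√(n:ℝ))⁻¹ ≤ ∑ n ∈ Finset.Icc 1 ⌊Real.exp M⌋₊, (√(n:ℝ))⁻¹ :=
    Finset.sum_le_sum_of_subset_of_nonneg (Finset.Icc_subset_Icc_left (by norm_num)) (fun _ _ _ => by positivity)
  have h2 := sum_sqrt ⌊Real.exp M⌋₊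
  have h3 : √(⌊Real.exp M⌋₊:ℝ) ≤ Real.exp (M/2) := by
    rw [Real.exp_half]; exact Real.sqrt_le_sqrt (Nat.floor_le (Real.exp_pos _).le)
  linarith

lemma coscos (l l' A B : ℝ) (hAB : A ≤ B) (hl : 1/2 ≤ l) (hl' : 1/2 ≤ l') :
    |∫ t in A..B, Real.cos (t * l) * Real.cos (t * l')| ≤ if l = l' then (B - A)/2 + 1 else 2 / |l - l'| := by
  have e : ∀ t, Real.cos (t * l) * Real.cos (t * l')
      = (1/2) * Real.cos (t * (l - l')) + (1/2) * Real.cos (t * (l + l')) := by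
    intro t; rw [mul_sub, mul_add, Real.cos_sub, Real.cos_add]; ring
  simp only [e]
  rw [intervalIntegral.integral_add ((by fun_prop : Continuous _).intervalIntegrable _ _)
    ((by fun_prop : Continuous _).intervalIntegrable _ _),
    intervalIntegral.integral_const_mul, intervalIntegral.integral_const_mul]
  have h1 := cos_int (l := l + l') (by linarith) A B
  have h4 : (0:ℝ) < l + l' := by linarith
  rw [abs_of_pos h4] at h1
  split_ifs with h
  · subst h
    have h2 : 2 / (l + l) ≤ 2 := by rw [div_le_iff₀ h4]; linarith
    simp only [sub_self, mul_zero, Real.cos_zero, intervalIntegral.integral_const, smul_eq_mul, mul_one]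
    rw [abs_le] at h1 ⊢
    constructor <;> linarith [h1.1, h1.2]
  · have h2 := cos_int (sub_ne_zero.2 h) A B
    have h3 : |l - l'| ≤ l + l' := abs_le.2 ⟨by linarith, by linarith⟩
    have h5 : 2 / (l + l') ≤ 2 / |l - l'| := by
      have : 0 < |l - l'| := abs_pos.2 (sub_ne_zero.2 h)
      gcongr
    rw [abs_le] at h1 h2 ⊢
    constructor <;> linarith [h1.1, h1.2, h2.1, h2.2]

lemma log_diff {n m : ℕ} (hm : 0 < m) (h : m < n) : 1 / |Real.log n - Real.log m| ≤ n / |(n:ℝ) - m| := by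
  have hm' : (0:ℝ) < m := by exact_mod_cast hm
  have hn' : (m:ℝ) < n := by exact_mod_cast h
  have h1 : Real.log m - Real.log n ≤ m / n - 1 := by
    rw [← Real.log_div hm'.ne' (by linarith)]
    exact Real.log_le_sub_one_of_pos (by apply div_pos <;> linarith)
  have h2 : ((n:ℝ) - m)/n ≤ Real.log n - Real.log m := by
    rw [sub_div, div_self (by linarith)]; linarith
  have h3 : 0 < ((n:ℝ) - m)/n := div_pos (by linarith) (by linarith)
  rw [abs_of_pos (by linarith), abs_of_pos (by linarith : (0:ℝ) < n - m)]
  calc _ ≤ 1 / (((n:ℝ) - m)/n) := by gcongr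
    _ = _ := by rw [one_div_div]

lemma cc_NM {M A B : ℝ} (hAB : A ≤ B) {n m : ℕ} (hn : n ∈ NM M) (hm : m ∈ NM M) :
    |∫ t in A..B, Real.cos (t * Real.log n) * Real.cos (t * Real.log m)|
      ≤ (if n = m then (B - A)/2 + 1 else 0) + 2 * Real.exp M * |(n:ℝ) - m|⁻¹ := by
  wlog hnm : m ≤ n generalizing n m
  · have := this hm hn (by lia)
    simp only [mul_comm (Real.cos (_ * Real.log m))] at this
    rw [if_neg (by lia)] at this ⊢; rw [abs_sub_comm (n:ℝ)]; exact this
  obtain ⟨h0, h1, h2⟩ := NM_log hn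
  obtain ⟨h0', h1', h2'⟩ := NM_log hm
  refine (coscos _ _ A B hAB h1 h1').trans ?_
  rcases hnm.eq_or_lt with h | h
  · subst h; simp
  · have h3 : Real.log m < Real.log n := Real.log_lt_log h0' (by exact_mod_cast h)
    rw [if_neg h3.ne', if_neg h.ne', zero_add]
    have h4 := log_diff (by exact_mod_cast h0') h
    have h5 : (n:ℝ) ≤ Real.exp M := (Nat.le_floor_iff (Real.exp_pos _).le).1 (Finset.mem_Icc.1 hn).2
    calc _ = 2 * (1 / |Real.log n - Real.log m|) := by ring
      _ ≤ 2 * (n / |(n:ℝ) - m|) := by gcongr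
      _ ≤ 2 * (Real.exp M / |(n:ℝ) - m|) := by gcongr
      _ = _ := by ring

lemma harm {M : ℝ} {n : ℕ} (hn : n ∈ NM M) : ∑ m ∈ NM M, |(n:ℝ) - m|⁻¹ ≤ 2 * (1 + M) := by
  set N := ⌊Real.exp M⌋₊
  have hN : (harmonic N : ℝ) ≤ 1 + M := by
    refine (harmonic_le_one_add_log N).trans ?_
    have := (NM_log hn)
    have h5 : (N:ℝ) ≤ Real.exp M := Nat.floor_le (Real.exp_pos _).le
    have h6 : 0 < N := by have := Finset.mem_Icc.1 hn; lia
    have := Real.log_le_log (by exact_mod_cast h6) h5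
    rw [Real.log_exp] at this; linarith
  have hH : (harmonic N : ℝ) = ∑ k ∈ Finset.Icc 1 N, (k:ℝ)⁻¹ := by
    rw [harmonic_eq_sum_Icc]; push_cast; rfl
  have hn' := Finset.mem_Icc.1 hn
  rw [← Finset.sum_filter_add_sum_filter_not _ (fun m => m < n)]
  have a1 : ∑ m ∈ NM M with m < n, |(n:ℝ) - m|⁻¹ ≤ ∑ k ∈ Finset.Icc 1 N, (k:ℝ)⁻¹ := by
    have : ∑ m ∈ NM M with m < n, |(n:ℝ) - m|⁻¹ = ∑ k ∈ (((NM M).filter (· < n)).image (fun m => n - m)), (k:ℝ)⁻¹ := by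
      rw [Finset.sum_image]
      · refine Finset.sum_congr rfl fun m hm => ?_
        have h := (Finset.mem_filter.1 hm).2
        rw [Nat.cast_sub h.le, abs_of_pos (sub_pos.2 (by exact_mod_cast h))]
      · intro x hx y hy h
        simp at hx hy h; lia
    rw [this]
    apply Finset.sum_le_sum_of_subset_of_nonneg
    · intro k hk
      simp only [Finset.mem_image, Finset.mem_filter, Finset.mem_Icc] at hk ⊢
      obtain ⟨m, hm, rfl⟩ := hk; lia
    · intros; positivity
  have a2 : ∑ m ∈ NM M with ¬ m < n, |(n:ℝ) - m|⁻¹ ≤ ∑ k ∈ Finset.Icc 1 N, (k:ℝ)⁻¹ := by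
    have : ∑ m ∈ NM M with ¬ m < n, |(n:ℝ) - m|⁻¹ = ∑ k ∈ (((NM M).filter (¬ · < n)).image (fun m => m - n)), (k:ℝ)⁻¹ := by
      rw [Finset.sum_image]
      · refine Finset.sum_congr rfl fun m hm => ?_
        have h := (Finset.mem_filter.1 hm).2
        rw [Nat.cast_sub (by lia), abs_sub_comm, abs_of_nonneg (sub_nonneg.2 (by exact_mod_cast not_lt.1 h))]
      · intro x hx y hy h
        simp at hx hy h; lia
    rw [this]
    calc _ ≤ ∑ k ∈ Finset.Icc 0 N, (k:ℝ)⁻¹ := by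
          apply Finset.sum_le_sum_of_subset_of_nonneg
          · intro k hk
            simp only [Finset.mem_image, Finset.mem_filter, Finset.mem_Icc] at hk ⊢
            obtain ⟨m, hm, rfl⟩ := hk; lia
          · intros; positivity
      _ = _ := by
        rw [← Finset.add_sum_Ioc_eq_sum_Icc (by lia)]; simp; rfl
  rw [← hH] at a1 a2
  linarith

lemma am_sq {M : ℝ} (hM : 1 ≤ M) : ∑ n ∈ NM M, am M n ^ 2 ≤ 4 * (M^2 * (97/960) + 28 * M) := by
  have hM0 : 0 < M := by linarith
  have h : ∀ n ∈ NM M, am M n ^ 2 ≤ 4 * (vonMangoldt n / n * hv M (Real.log n)) := by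
    intro n hn
    obtain ⟨h0, h1, h2⟩ := NM_log hn
    have hL : vonMangoldt n ≤ Real.log n := ArithmeticFunction.vonMangoldt_le_log
    have hL0 : 0 ≤ vonMangoldt n := ArithmeticFunction.vonMangoldt_nonneg
    have hs : √(n:ℝ)^2 = n := Real.sq_sqrt h0.le
    have e : am M n ^ 2 = 4 * (vonMangoldt n * (vonMangoldt n * gk M (Real.log n)^2)/n) := by
      rw [am, exp_half_sq h0, gt_eq hM0 (by linarith) h2, mul_pow, mul_pow, mul_pow, inv_pow, hs]; ring
    rw [e, hv, div_mul_eq_mul_div]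
    gcongr
  refine (Finset.sum_le_sum h).trans ?_
  rw [← Finset.mul_sum]
  gcongr
  refine le_trans ?_ (sum_d hM)
  apply le_of_eq
  apply Finset.sum_subset (Finset.Icc_subset_Icc_left (by norm_num))
  intro n h1 h2
  have : n = 0 ∨ n = 1 := by simp only [Finset.mem_Icc] at h1 h2; lia
  rcases this with rfl | rfl <;> simp

lemma Dm_sq {M A B : ℝ} (hM : 1 ≤ M) (hAB : A ≤ B) :
    ∫ t in A..B, Dm M t ^ 2 ≤
      4 * (M^2 * (97/960) + 28 * M) * ((B - A)/2 + 1 + 4 * Real.exp M * (1 + M)) := by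
  have hM0 : 0 < M := by linarith
  have e : ∀ t, Dm M t ^ 2 = ∑ n ∈ NM M, ∑ m ∈ NM M, am M n * am M m *
      (Real.cos (t * Real.log n) * Real.cos (t * Real.log m)) := by
    intro t
    rw [sq, Dm_eq hM0, Finset.sum_mul_sum]
    exact Finset.sum_congr rfl fun n _ => Finset.sum_congr rfl fun m _ => by ring
  simp only [e]
  rw [intervalIntegral.integral_finsetSum (fun n _ => (by fun_prop : Continuous _).intervalIntegrable _ _)]
  have e2 : ∀ n ∈ NM M, ∫ t in A..B, ∑ m ∈ NM M, am M n * am M m *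
      (Real.cos (t * Real.log n) * Real.cos (t * Real.log m))
      ≤ ∑ m ∈ NM M, am M n * am M m * ((if n = m then (B - A)/2 + 1 else 0) + 2 * Real.exp M * |(n:ℝ) - m|⁻¹) := by
    intro n hn
    rw [intervalIntegral.integral_finsetSum (fun n _ => (by fun_prop : Continuous _).intervalIntegrable _ _)]
    refine Finset.sum_le_sum fun m hm => ?_
    rw [intervalIntegral.integral_const_mul]
    exact mul_le_mul_of_nonneg_left ((le_abs_self _).trans (cc_NM hAB hn hm))
      (mul_nonneg (am_nonneg hM0 _) (am_nonneg hM0 _))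
  refine (Finset.sum_le_sum e2).trans ?_
  have e3 : ∀ n ∈ NM M, ∀ m ∈ NM M,
      am M n * am M m * ((if n = m then (B - A)/2 + 1 else 0) + 2 * Real.exp M * |(n:ℝ) - m|⁻¹)
      ≤ (if n = m then am M n^2 * ((B - A)/2 + 1) else 0) + (am M n^2 * (Real.exp M * |(n:ℝ) - m|⁻¹)
        + am M m^2 * (Real.exp M * |(m:ℝ) - n|⁻¹)) := by
    intro n _ m _
    have hp : 0 ≤ Real.exp M * |(n:ℝ) - m|⁻¹ := by positivity
    rw [abs_sub_comm (m:ℝ) n, mul_assoc 2]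
    generalize Real.exp M * |(n:ℝ) - m|⁻¹ = p at *
    have := mul_nonneg hp (sq_nonneg (am M n - am M m))
    by_cases h : n = m
    · subst h; simp only [if_true]; nlinarith
    · rw [if_neg h, if_neg h]; nlinarith
  refine (Finset.sum_le_sum fun n hn => Finset.sum_le_sum (e3 n hn)).trans ?_
  simp only [Finset.sum_add_distrib]
  rw [Finset.sum_comm (f := fun (n m : ℕ) => am M m^2 * (Real.exp M * |(m:ℝ) - n|⁻¹))]
  have e4 : ∑ n ∈ NM M, ∑ m ∈ NM M, am M n^2 * (Real.exp M * |(n:ℝ) - m|⁻¹)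
      ≤ (∑ n ∈ NM M, am M n^2) * (Real.exp M * (2 * (1 + M))) := by
    rw [Finset.sum_mul]
    refine Finset.sum_le_sum fun n hn => ?_
    rw [← Finset.mul_sum, ← Finset.mul_sum]
    have := harm hn
    gcongr
  have e5 : ∑ n ∈ NM M, ∑ m ∈ NM M, (if n = m then am M n^2 * ((B - A)/2 + 1) else 0)
      = (∑ n ∈ NM M, am M n^2) * ((B - A)/2 + 1) := by
    rw [Finset.sum_mul]
    refine Finset.sum_congr rfl fun n hn => ?_
    rw [Finset.sum_ite_eq, if_pos hn]
  rw [e5]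
  have e6 := am_sq hM
  have e7 : 0 ≤ (B - A)/2 + 1 + 4 * Real.exp M * (1 + M) := by
    have : 0 ≤ 4 * Real.exp M * (1 + M) := by positivity
    linarith
  have := mul_le_mul_of_nonneg_right e6 e7
  linarith

end PC

open Filter Topology MeasureTheory Set
namespace PC

noncomputable def MT (T : ℝ) : ℝ := 0.96 * Real.log T

structure Good (T : ℝ) : Prop where
  hT : 0 < T
  hL : 100 ≤ Real.log T
  hb : ∀ ρ : Z, T/2 < (ρ:ℂ).im → (ρ:ℂ).im ≤ 4*T → MT T * |(ρ:ℂ).re - 1/2| ≤ 0.155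

lemma good_of (hbox : ∀ᶠ T in atTop, ∀ ρ ∈ zeroBand T, |ρ.re - 1/2| < 0.3185 / (2 * Real.log T)) :
    ∀ᶠ T in atTop, Good T := by
  have h1 := (tendsto_id.atTop_div_const (by norm_num : (0:ℝ) < 2)).eventually hbox
  have h2 := (tendsto_id.const_mul_atTop (by norm_num : (0:ℝ) < 2)).eventually hbox
  filter_upwards [h1, hbox, h2, Real.tendsto_log_atTop.eventually_ge_atTop 100, eventually_gt_atTop 0] with T h1 h3 h2 hL hT
  refine ⟨hT, hL, fun ρ ha hb => ?_⟩
  have key : ∀ T', T/2 ≤ T' → |(ρ:ℂ).re - 1/2| < 0.3185 / (2 * Real.log T') → MT T * |(ρ:ℂ).re - 1/2| ≤ 0.155 := by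
    intro T' hT' h
    have l1 : 0.99 * Real.log T ≤ Real.log T' := by
      have := Real.log_le_log (by linarith) hT'
      rw [Real.log_div hT.ne' (by norm_num)] at this
      linarith [Real.log_two_lt_d9]
    have l2 : |(ρ:ℂ).re - 1/2| ≤ 0.3185 / (2 * (0.99 * Real.log T)) := h.le.trans (by gcongr)
    calc _ ≤ 0.96 * Real.log T * (0.3185 / (2 * (0.99 * Real.log T))) := by unfold MT; gcongr
      _ ≤ 0.155 := by field_simp; norm_num
  have hz := (nontrivial_iff ρ).2 ρ.2
  rcases le_or_gt (ρ:ℂ).im T with h | h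
  · exact key (T/2) le_rfl (h1 ρ ⟨hz, ha, by simp only [id]; linarith⟩)
  rcases le_or_gt (ρ:ℂ).im (2*T) with h' | h'
  · exact key T (by linarith) (h3 ρ ⟨hz, h, h'⟩)
  · exact key (2*T) (by linarith) (h2 ρ ⟨hz, h', by simp only [id]; linarith⟩)

lemma band_fin (T : ℝ) : {ρ : Z | T < (ρ:ℂ).im ∧ (ρ:ℂ).im ≤ 2*T}.Finite := by
  refine (finite_zeros_sub xi_diff xi_zero (1 + (|T| + |2*T|))).subset fun ρ hρ => ?_
  have h1 := Complex.norm_le_abs_re_add_abs_im (ρ:ℂ)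
  have h2 := Z_re ρ
  rw [abs_of_pos h2.1] at h1
  have h3 : |(ρ:ℂ).im| ≤ |T| + |2*T| := abs_le.2 ⟨by linarith [hρ.1, neg_abs_le T, abs_nonneg (2*T)],
    by linarith [hρ.2, le_abs_self (2*T), abs_nonneg T]⟩
  show ‖(ρ:ℂ)‖ ≤ _
  linarith

noncomputable def Bs (T : ℝ) : Finset Z := (band_fin T).toFinset
lemma mem_Bs {T : ℝ} {ρ : Z} : ρ ∈ Bs T ↔ T < (ρ:ℂ).im ∧ (ρ:ℂ).im ≤ 2*T := by simp [Bs]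

noncomputable def fB (T t : ℝ) : ℝ := ∑ ρ ∈ Bs T, (mu ρ : ℝ) * kr (MT T) ρ t
noncomputable def NB (T : ℝ) : ℝ := ∑ ρ ∈ Bs T, (mu ρ : ℝ)

namespace Good
variable {T : ℝ}

lemma T_big (g : Good T) : 100 ≤ T ∧ Real.log T ≤ T := by
  have := Real.log_le_sub_one_of_pos g.hT
  exact ⟨by linarith [g.hL], by linarith⟩

lemma M_big (g : Good T) : 96 ≤ MT T := by unfold MT; linarith [g.hL]

lemma exp_half (g : Good T) : Real.exp (MT T / 2)^2 ≤ T := by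
  rw [← Real.exp_nat_mul]
  calc _ ≤ Real.exp (Real.log T) := Real.exp_le_exp.2 (by unfold MT; push_cast; linarith [g.hL])
    _ = T := Real.exp_log g.hT

lemma far (g : Good T) (ρ : Z) {t : ℝ} (h1 : T + 1 ≤ t) (h2 : t ≤ 2*T - 1)
    (h : (ρ:ℂ).im ≤ T/2 ∨ 4*T < (ρ:ℂ).im) : |kr (MT T) ρ t| ≤ 252 * ‖(ρ:ℂ)‖ ^ (-(3/2):ℝ) := by
  obtain ⟨hT, -⟩ := g.T_big
  set x := |(ρ:ℂ).im - t| with hx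
  have hxT : T/2 ≤ x := by
    rcases h with h | h
    · rw [hx, abs_sub_comm]; exact le_trans (by linarith) (le_abs_self _)
    · exact le_trans (by linarith) (le_abs_self _)
  have hn : ‖(ρ:ℂ)‖ ≤ 6 * x := by
    have h1 := Complex.norm_le_abs_re_add_abs_im (ρ:ℂ)
    have h2 := Z_re ρ
    rw [abs_of_pos h2.1] at h1
    have h3 : |(ρ:ℂ).im| ≤ x + t := by
      have := abs_add_le ((ρ:ℂ).im - t) t
      rw [sub_add_cancel, abs_of_pos (by linarith : 0 < t)] at this; exact this
    linarith
  have hk := kr_far' (by linarith [g.M_big] : 1 ≤ MT T) ρ t (by linarith)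
  refine hk.trans ?_
  have hr : (6*x) ^ (-(3/2):ℝ) ≤ ‖(ρ:ℂ)‖ ^ (-(3/2):ℝ) :=
    Real.rpow_le_rpow_of_nonpos (norm_pos_iff.2 (Z_ne ρ)) hn (by norm_num)
  set q := √(6*x) with hq
  have hq2 : q^2 = 6*x := Real.sq_sqrt (by linarith)
  have hq0 : 0 < q := Real.sqrt_pos.2 (by linarith)
  have he : Real.exp (MT T / 2) ≤ q := Real.le_sqrt_of_sq_le (by linarith [g.exp_half])
  have hr' : (6*x) ^ (-(3/2):ℝ) = (q^3)⁻¹ := by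
    rw [← hq2, ← Real.rpow_natCast, ← Real.rpow_mul hq0.le, ← Real.rpow_natCast, ← Real.rpow_neg hq0.le]; norm_num
  rw [← sq_abs, ← hx]
  rw [hr'] at hr
  calc _ ≤ 7 * q / x^2 := by gcongr
    _ = 252 * (q^3)⁻¹ := by
      have : x = q^2/6 := by linarith
      rw [this]; field_simp; norm_num
    _ ≤ _ := by gcongr

lemma box (g : Good T) {ρ : Z} (h : ρ ∈ Bs T) : MT T * |(ρ:ℂ).re - 1/2| ≤ 1 := by
  have := mem_Bs.1 h
  exact (g.hb ρ (by linarith [g.hT]) (by linarith [g.hT])).trans (by norm_num)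

lemma log_le (g : Good T) {t : ℝ} (h1 : 1 ≤ t) (h : t ≤ 3 * T) : Real.log t ≤ 2 * Real.log T := by
  have hT := g.T_big.1
  rw [← Nat.cast_two, ← Real.log_pow]
  exact Real.log_le_log (by linarith) (by nlinarith)

lemma log_near (g : Good T) {t : ℝ} (h1 : T ≤ t) (h : t ≤ 2 * T) : |Real.log t - Real.log T| ≤ 1 := by
  have hT := g.hT
  have h2 := Real.log_le_log hT h1
  have h3 := Real.log_le_log (by linarith) h
  rw [Real.log_mul (by norm_num) hT.ne'] at h3
  rw [abs_le]; constructor <;> linarith [Real.log_two_lt_d9]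
end Good

lemma fin_le_tsum {f : Z → ℝ} (hf : ∀ ρ, 0 ≤ f ρ) (hs : Summable f) (B : Finset Z) : ∑ ρ ∈ B, f ρ ≤ ∑' ρ, f ρ :=
  hs.sum_le_tsum B (fun ρ _ => hf ρ)

/-- interior approximation -/
lemma approx : ∃ C, 0 ≤ C ∧ ∀ T, Good T → ∀ t, T + 1 ≤ t → t ≤ 2*T - 1 →
    |fB T t - (Real.log T - Dm (MT T) t)| ≤ C := by
  obtain ⟨C1, h10, hf⟩ := f_formula
  obtain ⟨C2, h20, hd⟩ := density
  set W := ∑' ρ : Z, (mu ρ : ℝ) * ‖(ρ:ℂ)‖ ^ (-(3/2) : ℝ)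
  have hW : 0 ≤ W := tsum_nonneg fun ρ => by positivity
  refine ⟨C1 + 1 + (100 * C2 + 252 * W), by positivity, fun T g t h1 h2 => ?_⟩
  have hM : 1 ≤ MT T := by linarith [g.M_big]
  have hM0 : 0 < MT T := by linarith
  obtain ⟨hT, -⟩ := g.T_big
  obtain ⟨hs, hf⟩ := hf (MT T) hM t
  have he : Real.exp (MT T / 2) ≤ t := by
    have := g.exp_half
    nlinarith [Real.exp_pos (MT T / 2)]
  have hf := hf (by linarith) he
  obtain ⟨hds, hd⟩ := hd t (by linarith)
  have hl := g.log_near (t := t) (by linarith) (by linarith)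
  have hl2 := g.log_le (t := t) (by linarith) (by linarith)
  have hB := hs.sum_add_tsum_compl (s := Bs T)
  set b : Z → ℝ := fun ρ => 40 / MT T * ((mu ρ : ℝ) / (1 + (t - (ρ:ℂ).im)^2)) + 252 * ((mu ρ : ℝ) * ‖(ρ:ℂ)‖ ^ (-(3/2) : ℝ)) with hb
  have hbs : Summable b := (hds.mul_left _).add (summable_Z'.mul_left _)
  have hb0 : ∀ ρ, 0 ≤ b ρ := fun ρ => by simp only [hb]; positivity
  have hbt : ∑' ρ, b ρ ≤ 100 * C2 + 252 * W := by
    rw [hb, (hds.mul_left _).tsum_add (summable_Z'.mul_left _), tsum_mul_left, tsum_mul_left]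
    have : 40 / MT T * ∑' ρ : Z, (mu ρ : ℝ) / (1 + (t - (ρ:ℂ).im)^2) ≤ 40 / MT T * (C2 * (2 * Real.log T)) := by
      gcongr; exact hd.trans (by gcongr)
    have h3 : 40 / MT T * (C2 * (2 * Real.log T)) ≤ 100 * C2 := by
      have : 0 < Real.log T := by linarith [g.hL]
      rw [div_mul_eq_mul_div, div_le_iff₀ hM0]; unfold MT; nlinarith [mul_pos h20 this]
    linarith
  have hout : |∑' ρ : ↥(↑(Bs T) : Set Z)ᶜ, (mu (ρ:Z) : ℝ) * kr (MT T) (ρ:Z) t| ≤ ∑' ρ, b ρ := by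
    have hle : ∀ ρ : ↥(↑(Bs T) : Set Z)ᶜ, ‖(mu (ρ:Z) : ℝ) * kr (MT T) (ρ:Z) t‖ ≤ b (ρ:Z) := by
      rintro ⟨ρ, hρ⟩
      rw [mem_compl_iff, Finset.mem_coe, mem_Bs, not_and_or, not_lt, not_le] at hρ
      simp only [hb]
      rw [norm_mul, Real.norm_natCast, Real.norm_eq_abs]
      by_cases hc : T/2 < (ρ:ℂ).im ∧ (ρ:ℂ).im ≤ 4*T
      · have hx : 1 ≤ |(ρ:ℂ).im - t| := by
          rcases hρ with h | h
          · rw [abs_sub_comm]; exact le_trans (by linarith) (le_abs_self _)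
          · exact le_trans (by linarith) (le_abs_self _)
        have := kr_box hM ρ t ((g.hb ρ hc.1 hc.2).trans (by norm_num)) hx
        calc _ ≤ (mu ρ : ℝ) * (40 / MT T / (1 + (t - (ρ:ℂ).im)^2)) := by gcongr
          _ = 40 / MT T * ((mu ρ : ℝ) / (1 + (t - (ρ:ℂ).im)^2)) := by ring
          _ ≤ _ := le_add_of_nonneg_right (by positivity)
      · have := g.far ρ h1 h2 (by rw [not_and_or, not_lt, not_le] at hc; exact hc)
        calc _ ≤ (mu ρ : ℝ) * (252 * ‖(ρ:ℂ)‖ ^ (-(3/2) : ℝ)) := by gcongr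
          _ = 252 * ((mu ρ : ℝ) * ‖(ρ:ℂ)‖ ^ (-(3/2) : ℝ)) := by ring
          _ ≤ _ := le_add_of_nonneg_left (by positivity)
    have hbs' : Summable fun ρ : ↥(↑(Bs T) : Set Z)ᶜ => b (ρ:Z) := hbs.subtype _
    refine (tsum_of_norm_bounded hbs'.hasSum hle).trans ?_
    exact hbs.tsum_subtype_le b _ hb0
  have e : fB T t = ∑' ρ : Z, (mu ρ : ℝ) * kr (MT T) ρ t - ∑' ρ : ↥(↑(Bs T) : Set Z)ᶜ, (mu (ρ:Z) : ℝ) * kr (MT T) (ρ:Z) t := by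
    rw [← hB, fB]; ring
  rw [e]
  have hD : Dm (MT T) t = 2 * (∑' n : ℕ, ptm (MT T) t n).re := rfl
  rw [← hD] at hf
  rw [abs_le] at hf hl hout ⊢
  constructor <;> linarith [hf.1, hf.2, hl.1, hl.2, hout.1, hout.2]

noncomputable def Gd (T t : ℝ) : ℝ := ∑ ρ ∈ Bs T, (mu ρ : ℝ) * (40 / MT T * (1 + (t - (ρ:ℂ).im)^2)⁻¹)

lemma Gd_int (T : ℝ) : Integrable (Gd T) ∧ ∫ t, Gd T t = 40 / MT T * Real.pi * NB T := by
  have hi : ∀ ρ ∈ Bs T, Integrable fun t : ℝ => (mu ρ : ℝ) * (40 / MT T * (1 + (t - (ρ:ℂ).im)^2)⁻¹) := fun ρ _ =>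
    ((lor_int _).const_mul _).const_mul _
  refine ⟨integrable_finsetSum _ hi, ?_⟩
  unfold Gd NB
  rw [integral_finsetSum _ hi, Finset.mul_sum]
  refine Finset.sum_congr rfl fun ρ _ => ?_
  rw [integral_const_mul, integral_const_mul, integral_sub_right_eq_self (fun t : ℝ => (1 + t^2)⁻¹), integral_univ_inv_one_add_sq]
  ring

lemma fB_cont (T : ℝ) : Continuous (fB T) := by
  unfold fB
  exact continuous_finsetSum _ fun ρ _ => (kr_cont _).const_mul _

lemma fB_int {T : ℝ} (g : Good T) : Integrable (fB T) ∧ ∫ t, fB T t = 2 * Real.pi * NB T := by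
  have hM : 1 ≤ MT T := by linarith [g.M_big]
  have hi : ∀ ρ ∈ Bs T, Integrable fun t : ℝ => (mu ρ : ℝ) * kr (MT T) ρ t := fun ρ h =>
    (kr_int hM ρ (g.box h)).const_mul _
  refine ⟨integrable_finsetSum _ hi, ?_⟩
  unfold fB NB
  rw [integral_finsetSum _ hi, Finset.mul_sum]
  refine Finset.sum_congr rfl fun ρ h => ?_
  rw [integral_const_mul, kr_integral hM ρ (g.box h)]; ring

lemma abs_sum_mu (T : ℝ) (F : Z → ℝ) (G : Z → ℝ) (h : ∀ ρ ∈ Bs T, |F ρ| ≤ G ρ) :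
    |∑ ρ ∈ Bs T, (mu ρ : ℝ) * F ρ| ≤ ∑ ρ ∈ Bs T, (mu ρ : ℝ) * G ρ := by
  refine (Finset.abs_sum_le_sum_abs _ _).trans (Finset.sum_le_sum fun ρ hρ => ?_)
  rw [abs_mul, Nat.abs_cast]
  exact mul_le_mul_of_nonneg_left (h ρ hρ) (by positivity)

lemma fB_bounds : ∃ C, 0 < C ∧ ∀ T, Good T →
    (∀ t, T - 1 ≤ t → t ≤ 2*T + 1 → |fB T t| ≤ C * Real.log T ^ 2) ∧
    (∀ t, t ∉ Ioc (T-1) (2*T+1) → |fB T t| ≤ Gd T t ∧ |fB T t| ≤ C) := by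
  obtain ⟨C2, h20, hd⟩ := density
  refine ⟨100 * C2, by positivity, fun T g => ?_⟩
  have hM : 1 ≤ MT T := by linarith [g.M_big]
  have hM0 : 0 < MT T := by linarith
  obtain ⟨hT, -⟩ := g.T_big
  have hL0 : 0 < Real.log T := by linarith [g.hL]
  have key : ∀ s, 2 ≤ s → s ≤ 3 * T → ∀ c, 0 ≤ c → 
      ∑ ρ ∈ Bs T, (mu ρ : ℝ) * (c * (1 + (s - (ρ:ℂ).im)^2)⁻¹) ≤ c * (C2 * (2 * Real.log T)) := by
    intro s h2 h3 c hc
    obtain ⟨hds, hd⟩ := hd s h2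
    have := (fin_le_tsum (fun ρ => by positivity) hds (Bs T)).trans
      (hd.trans (mul_le_mul_of_nonneg_left (g.log_le (by linarith) h3) h20.le))
    calc _ = c * ∑ ρ ∈ Bs T, (mu ρ : ℝ) / (1 + (s - (ρ:ℂ).im)^2) := by
          rw [Finset.mul_sum]; exact Finset.sum_congr rfl fun ρ _ => by ring
      _ ≤ _ := by gcongr
  have h3 : 40 / MT T * (C2 * (2 * Real.log T)) ≤ 100 * C2 := by
    rw [div_mul_eq_mul_div, div_le_iff₀ hM0]; unfold MT; nlinarith [mul_pos h20 hL0]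
  constructor
  · intro t h1 h2
    have a := abs_sum_mu T (fun ρ => kr (MT T) ρ t) (fun ρ => 40 * MT T * (1 + (t - (ρ:ℂ).im)^2)⁻¹)
      (fun ρ hρ => by rw [← div_eq_mul_inv]; exact kr_box' hM ρ t (g.box hρ))
    refine (a.trans (key t (by linarith) (by linarith) _ (by positivity))).trans ?_
    unfold MT
    nlinarith [mul_pos h20 (mul_pos hL0 hL0)]
  · intro t ht
    rw [mem_Ioc, not_and_or, not_lt, not_le] at ht
    have hx : ∀ ρ ∈ Bs T, 1 ≤ |(ρ:ℂ).im - t| := by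
      intro ρ hρ
      have := mem_Bs.1 hρ
      rcases ht with h | h
      · exact le_trans (by linarith) (le_abs_self _)
      · rw [abs_sub_comm]; exact le_trans (by linarith) (le_abs_self _)
    have a := abs_sum_mu T (fun ρ => kr (MT T) ρ t) (fun ρ => 40 / MT T * (1 + (t - (ρ:ℂ).im)^2)⁻¹)
      (fun ρ hρ => by rw [← div_eq_mul_inv]; exact kr_box hM ρ t (g.box hρ) (hx ρ hρ))
    refine ⟨a, a.trans ?_⟩
    obtain ⟨s, hs1, hs2, hs⟩ : ∃ s, 2 ≤ s ∧ s ≤ 3*T ∧ ∀ ρ ∈ Bs T, (s - (ρ:ℂ).im)^2 ≤ (t - (ρ:ℂ).im)^2 := by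
      rcases ht with h | h
      · refine ⟨T - 1, by linarith, by linarith, fun ρ hρ => ?_⟩
        have := mem_Bs.1 hρ
        nlinarith
      · refine ⟨2*T + 1, by linarith, by linarith, fun ρ hρ => ?_⟩
        have := mem_Bs.1 hρ
        nlinarith
    refine le_trans (Finset.sum_le_sum fun ρ hρ => ?_) ((key s hs1 hs2 (40 / MT T) (by positivity)).trans h3)
    have := hs ρ hρ
    gcongr

end PC

open Filter Topology MeasureTheory Set
namespace PC

lemma splitI {F G : ℝ → ℝ} {T K : ℝ} (hT : 100 ≤ T) (hF : Continuous F) (hFi : Integrable F) (hG : Integrable G)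
    (hG0 : ∀ t, 0 ≤ G t) (h1 : ∀ t, t ∉ Ioc (T-1) (2*T+1) → |F t| ≤ G t)
    (h2 : ∀ t, T - 1 ≤ t → t ≤ 2*T+1 → |F t| ≤ K) :
    |(∫ t, F t) - ∫ t in (T+1)..(2*T-1), F t| ≤ 4 * K + ∫ t, G t := by
  have e1 := integral_add_compl (measurableSet_Ioc (a := T-1) (b := 2*T+1)) hFi
  rw [← intervalIntegral.integral_of_le (by linarith)] at e1
  have hi : ∀ a b, IntervalIntegrable F volume a b := fun a b => hF.intervalIntegrable a b
  rw [← intervalIntegral.integral_add_adjacent_intervals (hi _ (T+1)) (hi _ _),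
    ← intervalIntegral.integral_add_adjacent_intervals (hi (T+1) (2*T-1)) (hi _ _)] at e1
  have e2 : |∫ t in (T-1)..(T+1), F t| ≤ K * |T + 1 - (T - 1)| := by
    rw [← Real.norm_eq_abs]
    refine intervalIntegral.norm_integral_le_of_norm_le_const fun t ht => ?_
    · rw [uIoc_of_le (by linarith)] at ht
      exact h2 t ht.1.le (by linarith [ht.2])
  have e3 : |∫ t in (2*T-1)..(2*T+1), F t| ≤ K * |2*T + 1 - (2*T - 1)| := by
    rw [← Real.norm_eq_abs]
    refine intervalIntegral.norm_integral_le_of_norm_le_const fun t ht => ?_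
    · rw [uIoc_of_le (by linarith)] at ht
      exact h2 t (by linarith [ht.1]) ht.2
  rw [show T + 1 - (T - 1) = 2 by ring, abs_two] at e2
  rw [show 2*T + 1 - (2*T - 1) = 2 by ring, abs_two] at e3
  have e4 : |∫ t in (Ioc (T-1) (2*T+1))ᶜ, F t| ≤ ∫ t in (Ioc (T-1) (2*T+1))ᶜ, G t := by
    rw [← Real.norm_eq_abs]
    exact norm_integral_le_of_norm_le hG.integrableOn
      ((ae_restrict_iff' measurableSet_Ioc.compl).2 (ae_of_all _ fun t ht => h1 t ht))
  have e5 : ∫ t in (Ioc (T-1) (2*T+1))ᶜ, G t ≤ ∫ t, G t :=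
    setIntegral_le_integral hG (ae_of_all _ hG0)
  rw [abs_le] at e2 e3 e4 ⊢
  constructor <;> linarith [e2.1, e2.2, e3.1, e3.2, e4.1, e4.2]

lemma int_LD {T : ℝ} (g : Good T) (h3 : Real.log T ^ 3 * Real.exp (MT T) ≤ T) :
    ∫ t in (T+1)..(2*T-1), (Real.log T - Dm (MT T) t)^2
      ≤ T * Real.log T ^ 2 + 2 * T * MT T ^ 2 * (97/960) + 80 * T * Real.log T := by
  have hM : 1 ≤ MT T := by linarith [g.M_big]
  have hM0 : 0 < MT T := by linarith
  have hL := g.hL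
  obtain ⟨hT, hLT⟩ := g.T_big
  have hD := Dm_cont hM0
  have e : ∀ t, (Real.log T - Dm (MT T) t)^2 = Real.log T ^ 2 - 2 * Real.log T * Dm (MT T) t + Dm (MT T) t ^ 2 :=
    fun t => by ring
  simp only [e]
  rw [intervalIntegral.integral_add ((by fun_prop : Continuous _).intervalIntegrable _ _)
    ((by fun_prop : Continuous _).intervalIntegrable _ _), intervalIntegral.integral_sub
    ((by fun_prop : Continuous _).intervalIntegrable _ _)
    ((by fun_prop : Continuous _).intervalIntegrable _ _), intervalIntegral.integral_const,
    intervalIntegral.integral_const_mul, smul_eq_mul]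
  have h1 := Dm_int hM0 (T+1) (2*T-1)
  have h2 := Dm_sq (A := T+1) (B := 2*T-1) hM (by linarith)
  rw [show (2 * T - 1 - (T + 1)) / 2 + 1 = T/2 by ring] at h2
  have he : Real.exp (MT T / 2) ≤ T := by
    have := g.exp_half
    nlinarith [Real.exp_pos (MT T / 2), Real.one_le_exp (by linarith : 0 ≤ MT T / 2)]
  have h1' : -(2 * Real.log T * ∫ t in (T+1)..(2*T-1), Dm (MT T) t) ≤ 16 * Real.log T * T := by
    have := (abs_le.1 h1).1
    nlinarith
  have h4 : 4 * (MT T^2 * (97/960) + 28 * MT T) * (4 * Real.exp (MT T) * (1 + MT T)) ≤ 8 * T * Real.log T := by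
    have hML : MT T ≤ Real.log T := by unfold MT; linarith
    have a1 : MT T^2 * (97/960) + 28 * MT T ≤ 0.4 * Real.log T^2 := by unfold MT; nlinarith
    have a2 : 1 + MT T ≤ 1 * Real.log T := by unfold MT; linarith
    calc _ ≤ 4 * (0.4 * Real.log T^2) * (4 * Real.exp (MT T) * (1 * Real.log T)) := by gcongr
      _ = 6.4 * (Real.log T ^ 3 * Real.exp (MT T)) := by ring
      _ ≤ 8 * T * 1 := by linarith
      _ ≤ _ := by gcongr; linarith
  have h5 : MT T ≤ Real.log T := by unfold MT; linarith
  have h6 : 56 * MT T * T ≤ 56 * Real.log T * T := by gcongr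
  rw [mul_add] at h2
  have h7 : (2 * T - 1 - (T + 1)) * Real.log T ^ 2 ≤ T * Real.log T ^ 2 := by gcongr; linarith
  linarith

lemma ev_small (C : ℝ) : ∀ᶠ T : ℝ in atTop, Real.log T ^ 3 * Real.exp (MT T) ≤ T ∧
    C * Real.log T ^ 4 ≤ T := by
  have h1 := (isLittleO_pow_exp_pos_mul_atTop 3 (by norm_num : (0:ℝ) < 0.04)).bound (c := 1) one_pos
  have h2 := (isLittleO_pow_exp_pos_mul_atTop 4 (by norm_num : (0:ℝ) < 1)).bound (c := (|C|+1)⁻¹) (by positivity)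
  filter_upwards [Real.tendsto_log_atTop.eventually h1, Real.tendsto_log_atTop.eventually h2, eventually_gt_atTop 0,
    Real.tendsto_log_atTop.eventually_ge_atTop 0] with T h1 h2 h0 hL
  rw [Real.norm_of_nonneg (by positivity), Real.norm_of_nonneg (Real.exp_pos _).le] at h1 h2
  rw [one_mul] at h1
  rw [one_mul, Real.exp_log h0, inv_mul_eq_div, le_div_iff₀ (by positivity)] at h2
  constructor
  · calc _ ≤ Real.exp (0.04 * Real.log T) * Real.exp (MT T) := by gcongr
      _ = T := by
        rw [← Real.exp_add, MT, ← add_mul]; norm_num; exact Real.exp_log h0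
  · have : 0 ≤ Real.log T ^ 4 := by positivity
    nlinarith [le_abs_self C]

lemma analytic : ∃ C, 0 < C ∧ ∀ᶠ T in atTop, Good T → 
    T * Real.log T - C * T ≤ 2 * Real.pi * NB T ∧
    ∫ t, fB T t ^ 2 ≤ 1.01 * (T * Real.log T ^ 2 + 2 * T * MT T ^ 2 * (97/960)) + C * T * Real.log T := by
  obtain ⟨C1, h10, happ⟩ := approx
  obtain ⟨Cb, hb0, hbd⟩ := fB_bounds
  set K2 := 140 * (10 + C1)
  have hK2 : 0 ≤ K2 := by positivity
  refine ⟨(11 + C1 + K2) + (81 + 101 * C1^2 + 1 + Cb * K2), by positivity, ?_⟩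
  filter_upwards [ev_small (4 * Cb), ev_small (4 * Cb^2)] with T hs1 hs2 g
  obtain ⟨hex, hs1⟩ := hs1
  replace hs2 := hs2.2
  have hM : 1 ≤ MT T := by linarith [g.M_big]
  have hM0 : 0 < MT T := by linarith
  have hL := g.hL
  obtain ⟨hT, hLT⟩ := g.T_big
  have hpi := Real.pi_gt_three
  have hpi' := Real.pi_lt_d2
  have hD := Dm_cont hM0
  have hfc := fB_cont T
  obtain ⟨hfi, hfI⟩ := fB_int g
  obtain ⟨hGi, hGI⟩ := Gd_int T
  obtain ⟨hb1, hb2⟩ := hbd T g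
  have hG0 : ∀ t, 0 ≤ Gd T t := fun t => by unfold Gd; positivity
  have hN0 : 0 ≤ NB T := by unfold NB; positivity
  have happ := happ T g
  -- first moment
  have a1 := splitI hT hfc hfi hGi hG0 (fun t ht => (hb2 t ht).1) hb1
  have a2 : |∫ t in (T+1)..(2*T-1), (fB T t - (Real.log T - Dm (MT T) t))| ≤ C1 * |2*T - 1 - (T+1)| := by
    rw [← Real.norm_eq_abs]
    refine intervalIntegral.norm_integral_le_of_norm_le_const fun t ht => ?_
    · rw [uIoc_of_le (by linarith)] at ht
      exact happ t ht.1.le ht.2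
  rw [intervalIntegral.integral_sub (hfc.intervalIntegrable _ _) ((by fun_prop : Continuous _).intervalIntegrable _ _),
    intervalIntegral.integral_sub ((by fun_prop : Continuous _).intervalIntegrable _ _) (hD.intervalIntegrable _ _),
    intervalIntegral.integral_const, smul_eq_mul, abs_of_pos (by linarith : 0 < 2*T - 1 - (T+1))] at a2
  have a3 := Dm_int hM0 (T+1) (2*T-1)
  have he : Real.exp (MT T / 2) ≤ T := by
    have := g.exp_half
    nlinarith [Real.exp_pos (MT T / 2), Real.one_le_exp (by linarith : 0 ≤ MT T / 2)]
  have hL24 : Cb * Real.log T ^ 2 ≤ Cb * Real.log T ^ 4 := by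
    gcongr 
    · linarith
    · norm_num
  rw [hfI, hGI] at a1
  have hC1T : C1 * (2*T - 1 - (T+1)) ≤ C1 * T := by gcongr; linarith
  have hGs : 40 / MT T * Real.pi * NB T ≤ 0.5 * Real.pi * NB T := by
    gcongr; rw [div_le_iff₀ hM0]; linarith [g.M_big]
  have hTL : T * 1 ≤ T * Real.log T := by gcongr; linarith
  have hC1TL : C1 * T * 1 ≤ C1 * T * Real.log T := by gcongr; linarith
  have hNle : NB T ≤ (10 + C1) * (T * Real.log T) := by
    have h1 := (abs_le.1 a1).2
    have h2 := (abs_le.1 a2).2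
    have h3 := (abs_le.1 a3).1
    have h4 : 1.5 * Real.pi * NB T ≤ (10 + C1) * (T * Real.log T) := by linarith
    have h5 : 1 * NB T ≤ 1.5 * Real.pi * NB T := by gcongr; linarith
    linarith
  have hGN : 40 / MT T * Real.pi * NB T ≤ K2 * T := by
    have h1 : 40 / MT T * Real.pi ≤ 140 / Real.log T := by
      rw [div_mul_eq_mul_div, div_le_div_iff₀ hM0 (by linarith)]; unfold MT; nlinarith
    calc _ ≤ 140 / Real.log T * ((10 + C1) * (T * Real.log T)) := by gcongr
      _ = _ := by simp only [K2]; field_simp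
  refine ⟨?_, ?_⟩
  · have h1 := (abs_le.1 a1).1
    have h2 := (abs_le.1 a2).1
    have h3 := (abs_le.1 a3).2
    have h4 : 0 ≤ (81 + 101 * C1^2 + 1 + Cb * K2) * T := by positivity
    linarith
  -- second moment
  have b1 := splitI (F := fun t => fB T t ^ 2) (G := fun t => Cb * Gd T t) (K := (Cb * Real.log T^2)^2) hT (by fun_prop)
    (by
      refine ((hfi.norm.const_mul (Cb * Real.log T^2 + Cb))).mono' (by fun_prop) (ae_of_all _ fun t => ?_)
      rw [Real.norm_eq_abs, Real.norm_eq_abs, sq, abs_mul]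
      refine mul_le_mul_of_nonneg_right ?_ (abs_nonneg _)
      have : 0 ≤ Cb * Real.log T^2 := by positivity
      by_cases ht : t ∈ Ioc (T-1) (2*T+1)
      · linarith [hb1 t ht.1.le ht.2]
      · linarith [(hb2 t ht).2])
    (hGi.const_mul _) (fun t => mul_nonneg hb0.le (hG0 t))
    (fun t ht => by
      have := hb2 t ht
      rw [abs_pow, sq]; exact mul_le_mul this.2 this.1 (abs_nonneg _) hb0.le)
    (fun t h1 h2 => by
      rw [abs_pow]; exact pow_le_pow_left₀ (abs_nonneg _) (hb1 t h1 h2) 2)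
  rw [integral_const_mul, hGI] at b1
  have b2 : ∫ t in (T+1)..(2*T-1), fB T t ^ 2 ≤
      ∫ t in (T+1)..(2*T-1), (1.01 * (Real.log T - Dm (MT T) t)^2 + 101 * C1^2) := by
    refine intervalIntegral.integral_mono_on (by linarith) ((by fun_prop : Continuous _).intervalIntegrable _ _)
      ((by fun_prop : Continuous _).intervalIntegrable _ _) fun t ht => ?_
    have h := happ t ht.1 ht.2
    have h' := sq_le_sq.2 (h.trans (le_abs_self C1))
    nlinarith [sq_nonneg (0.1 * (Real.log T - Dm (MT T) t) - 10 * (fB T t - (Real.log T - Dm (MT T) t)))]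
  rw [intervalIntegral.integral_add ((by fun_prop : Continuous _).intervalIntegrable _ _)
    ((by fun_prop : Continuous _).intervalIntegrable _ _), intervalIntegral.integral_const_mul,
    intervalIntegral.integral_const, smul_eq_mul] at b2
  have b3 := int_LD g hex
  have b4 := (abs_le.1 b1).2
  have b5 : (2*T - 1 - (T+1)) * (101 * C1^2) ≤ 101 * C1^2 * (T * Real.log T) := by
    have : (2*T - 1 - (T+1)) ≤ T * Real.log T := by linarith
    nlinarith [sq_nonneg C1]
  have b6 : Cb * (40 / MT T * Real.pi * NB T) ≤ Cb * K2 * (T * Real.log T) := by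
    calc _ ≤ Cb * (K2 * T) := by gcongr
      _ = Cb * K2 * (T * 1) := by ring
      _ ≤ _ := by gcongr
  have b7 : 4 * (Cb * Real.log T^2)^2 ≤ T * Real.log T := by linarith
  have b8 : 0 ≤ (11 + C1 + K2) * (T * Real.log T) := by positivity
  linarith

end PC

open Filter Topology MeasureTheory Set
namespace PC

noncomputable def sg (ρ : Z) : Z := ⟨1 - (starRingEnd ℂ) (ρ:ℂ), xi_refl_zero ρ.2⟩

lemma sg_re (ρ : Z) : ((sg ρ : Z) : ℂ).re = 1 - (ρ:ℂ).re := by simp [sg]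
lemma sg_im (ρ : Z) : ((sg ρ : Z) : ℂ).im = (ρ:ℂ).im := by simp [sg]
lemma sg_sg (ρ : Z) : sg (sg ρ) = ρ := by
  apply Subtype.ext; simp [sg]
lemma sg_mem {T : ℝ} {ρ : Z} (h : ρ ∈ Bs T) : sg ρ ∈ Bs T := by
  rw [mem_Bs] at h ⊢; rwa [sg_im]
lemma mu_sg (ρ : Z) : mu (sg ρ : Z) = mu ρ := mu_refl ρ
lemma mu_pos (ρ : Z) : 1 ≤ mu ρ := mult_pos xi_diff xi_zero ρ.2

lemma sum_sg (T : ℝ) (f : Z → ℝ) : ∑ ρ ∈ Bs T, f (sg ρ) = ∑ ρ ∈ Bs T, f ρ :=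
  Finset.sum_nbij' sg sg (fun _ h => sg_mem h) (fun _ h => sg_mem h) (fun _ _ => sg_sg _) (fun _ _ => sg_sg _)
    (fun _ _ => rfl)

noncomputable def IE (M : ℝ) (ρ ρ' : ℂ) : ℝ := ∫ v in (0:ℝ)..M, gk M v ^ 2 *
      Real.exp (v * (ρ.re - 1/2 + (ρ'.re - 1/2))) * Real.cos (v * (ρ.im - ρ'.im))
noncomputable def IC (M : ℝ) (ρ ρ' : ℂ) : ℝ := ∫ v in (0:ℝ)..M, gk M v ^ 2 *
      Real.cosh (v * (ρ.re - 1/2 + (ρ'.re - 1/2))) * Real.cos (v * (ρ.im - ρ'.im))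

lemma IE_IC (M : ℝ) (ρ ρ' : Z) : IE M ρ ρ' + IE M (sg ρ : Z) (sg ρ' : Z) = 2 * IC M ρ ρ' := by
  have hg := gk_cont M
  unfold IE IC
  rw [← intervalIntegral.integral_add (Continuous.intervalIntegrable (by fun_prop) _ _)
    (Continuous.intervalIntegrable (by fun_prop) _ _), ← intervalIntegral.integral_const_mul]
  congr 1
  ext v
  rw [sg_re, sg_re, sg_im, sg_im, Real.cosh_eq]
  rw [show v * (1 - (ρ:ℂ).re - 1/2 + (1 - (ρ':ℂ).re - 1/2)) = -(v * ((ρ:ℂ).re - 1/2 + ((ρ':ℂ).re - 1/2))) by ring]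
  ring

lemma S_eq {T : ℝ} (g : Good T) : ∫ t, fB T t ^ 2 =
    4 * Real.pi * ∑ ρ ∈ Bs T, ∑ ρ' ∈ Bs T, (mu ρ : ℝ) * mu ρ' * IC (MT T) ρ ρ' := by
  have hM : 1 ≤ MT T := by linarith [g.M_big]
  have hi : ∀ ρ ∈ Bs T, ∀ ρ' ∈ Bs T, Integrable fun t : ℝ => (mu ρ : ℝ) * mu ρ' * (kr (MT T) ρ t * kr (MT T) ρ' t) := by
    intro ρ h ρ' h'
    refine Integrable.const_mul ?_ _
    refine (kr_int hM ρ' (g.box h')).bdd_mul (c := 40 * MT T) (kr_cont ρ).aestronglyMeasurable (Eventually.of_forall fun t => ?_)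
    rw [Real.norm_eq_abs]
    refine (kr_box' hM ρ t (g.box h)).trans ?_
    exact div_le_self (by linarith) (by nlinarith [sq_nonneg (t - (ρ:ℂ).im)])
  have e : ∀ t, fB T t ^ 2 = ∑ ρ ∈ Bs T, ∑ ρ' ∈ Bs T, (mu ρ : ℝ) * mu ρ' * (kr (MT T) ρ t * kr (MT T) ρ' t) := fun t => by
    unfold fB
    rw [sq, Finset.sum_mul_sum]
    refine Finset.sum_congr rfl fun _ _ => Finset.sum_congr rfl fun _ _ => by ring
  simp only [e]
  rw [integral_finsetSum _ fun ρ h => integrable_finsetSum _ (hi ρ h)]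
  have e1 : ∑ ρ ∈ Bs T, ∫ t, ∑ ρ' ∈ Bs T, (mu ρ : ℝ) * mu ρ' * (kr (MT T) ρ t * kr (MT T) ρ' t) =
      4 * Real.pi * ∑ ρ ∈ Bs T, ∑ ρ' ∈ Bs T, (mu ρ : ℝ) * mu ρ' * IE (MT T) ρ ρ' := by
    rw [Finset.mul_sum]
    refine Finset.sum_congr rfl fun ρ h => ?_
    rw [integral_finsetSum _ (hi ρ h), Finset.mul_sum]
    refine Finset.sum_congr rfl fun ρ' h' => ?_
    rw [integral_const_mul, kr_pair hM ρ ρ' (g.box h), IE]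
    ring
  rw [e1]
  congr 1
  have e2 : ∑ ρ ∈ Bs T, ∑ ρ' ∈ Bs T, (mu ρ : ℝ) * mu ρ' * IE (MT T) ρ ρ' =
      ∑ ρ ∈ Bs T, ∑ ρ' ∈ Bs T, (mu ρ : ℝ) * mu ρ' * IE (MT T) (sg ρ : Z) (sg ρ' : Z) := by
    rw [← sum_sg]
    refine Finset.sum_congr rfl fun ρ h => ?_
    rw [← sum_sg]
    refine Finset.sum_congr rfl fun ρ' h' => ?_
    rw [mu_sg, mu_sg]
  have e3 : (∑ ρ ∈ Bs T, ∑ ρ' ∈ Bs T, (mu ρ : ℝ) * mu ρ' * IE (MT T) ρ ρ') +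
      ∑ ρ ∈ Bs T, ∑ ρ' ∈ Bs T, (mu ρ : ℝ) * mu ρ' * IE (MT T) (sg ρ : Z) (sg ρ' : Z) =
      2 * ∑ ρ ∈ Bs T, ∑ ρ' ∈ Bs T, (mu ρ : ℝ) * mu ρ' * IC (MT T) ρ ρ' := by
    rw [← Finset.sum_add_distrib, Finset.mul_sum]
    refine Finset.sum_congr rfl fun ρ h => ?_
    rw [← Finset.sum_add_distrib, Finset.mul_sum]
    refine Finset.sum_congr rfl fun ρ' h' => ?_
    rw [← mul_add, IE_IC]; ring
  linarith

open Classical in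
noncomputable def nn (T : ℝ) (ρ : Z) : ℕ := ∑ ρ' ∈ Bs T, if (ρ':ℂ).im = (ρ:ℂ).im then mu ρ' else 0

lemma S_ge {T : ℝ} (g : Good T) : 4 * Real.pi * (MT T * (181/480)) * ∑ ρ ∈ Bs T, (mu ρ : ℝ) * nn T ρ ≤ ∫ t, fB T t ^ 2 := by
  have hM : 0 < MT T := by linarith [g.M_big]
  rw [S_eq g, mul_assoc]
  refine mul_le_mul_of_nonneg_left ?_ (by positivity)
  rw [Finset.mul_sum]
  refine Finset.sum_le_sum fun ρ h => ?_
  unfold nn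
  rw [Nat.cast_sum, Finset.mul_sum, Finset.mul_sum]
  refine Finset.sum_le_sum fun ρ' h' => ?_
  have b1 := mem_Bs.1 h
  have b2 := mem_Bs.1 h'
  have c1 := g.hb ρ (by linarith [g.hT]) (by linarith [g.hT])
  have c2 := g.hb ρ' (by linarith [g.hT]) (by linarith [g.hT])
  have hc : MT T * |(ρ:ℂ).re - 1/2 + ((ρ':ℂ).re - 1/2)| ≤ 0.31 := by
    have := mul_le_mul_of_nonneg_left (abs_add_le ((ρ:ℂ).re - 1/2) ((ρ':ℂ).re - 1/2)) hM.le
    linarith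
  split_ifs with hh
  · have : MT T * (181/480) ≤ IC (MT T) ρ ρ' := by
      refine (pol0 (c := (ρ:ℂ).re - 1/2 + ((ρ':ℂ).re - 1/2)) hM).trans (le_of_eq ?_)
      unfold IC; simp [hh]
    have h2 : (0:ℝ) ≤ (mu ρ : ℝ) * mu ρ' := by positivity
    have := mul_le_mul_of_nonneg_left this h2
    linarith
  · have := pol hM hc ((ρ:ℂ).im - (ρ':ℂ).im)
    have h2 : (0:ℝ) ≤ (mu ρ : ℝ) * mu ρ' := by positivity
    have := mul_nonneg h2 this
    unfold IC
    simpa using this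

lemma mu_le_nn {T : ℝ} {ρ : Z} (h : ρ ∈ Bs T) : mu ρ ≤ nn T ρ := by
  classical
  unfold nn
  have := Finset.single_le_sum (f := fun ρ' : Z => if (ρ':ℂ).im = (ρ:ℂ).im then mu ρ' else 0) (fun _ _ => Nat.zero_le _) h
  simpa using this

lemma nn_two {T : ℝ} {ρ : Z} (h : ρ ∈ Bs T) (hh : ¬ ((ρ:ℂ).re = 1/2 ∧ mu ρ = 1)) : 2 ≤ nn T ρ := by
  classical
  have hp := mu_pos ρ
  by_cases hr : (ρ:ℂ).re = 1/2
  · have : mu ρ ≠ 1 := fun h => hh ⟨hr, h⟩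
    have := mu_le_nn h
    omega
  · have hne : ρ ≠ sg ρ := fun e => hr (by have := sg_re ρ; rw [← e] at this; linarith)
    have := Finset.sum_le_sum_of_subset (f := fun ρ' : Z => if (ρ':ℂ).im = (ρ:ℂ).im then mu ρ' else 0)
      (s := {ρ, sg ρ}) (t := Bs T) (by
        intro x hx
        rw [Finset.mem_insert, Finset.mem_singleton] at hx
        rcases hx with rfl | rfl
        · exact h
        · exact sg_mem h)
    rw [Finset.sum_pair hne] at this
    simp only [sg_im, mu_sg, if_true] at this
    unfold nn
    omega

open Classical in
lemma nls_eq (T : ℝ) : NlineSimple T = ∑ ρ ∈ Bs T, if (ρ:ℂ).re = 1/2 ∧ mu ρ = 1 then (1:ℝ) else 0 := by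
  have e : {ρ ∈ zeroBand T | ρ.re = 1/2 ∧ zetaMult ρ = 1} =
      (((Bs T).filter fun ρ : Z => (ρ:ℂ).re = 1/2 ∧ mu ρ = 1).image (Subtype.val : Z → ℂ) : Finset ℂ) := by
    ext s
    simp only [Finset.coe_image, Set.mem_image, Finset.mem_coe, Finset.mem_filter, mem_Bs]
    constructor
    · rintro ⟨⟨h1, h2, h3⟩, h4, h5⟩
      exact ⟨⟨s, (nontrivial_iff s).1 h1⟩, ⟨⟨h2, h3⟩, h4, by rw [← h5]; exact (zetaMult_eq h1.2.1 h1.2.2).symm⟩, rfl⟩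
    · rintro ⟨ρ, ⟨⟨h2, h3⟩, h4, h5⟩, rfl⟩
      exact ⟨⟨(nontrivial_iff _).2 ρ.2, h2, h3⟩, h4, by rw [zetaMult_eq (Z_re ρ).1 (Z_re ρ).2]; exact h5⟩
  unfold NlineSimple
  rw [e, finsum_mem_coe_finset, Finset.sum_image (fun _ _ _ _ h => Subtype.ext h), Finset.sum_filter]

lemma comb (T : ℝ) : 2 * NB T - NlineSimple T ≤ ∑ ρ ∈ Bs T, (mu ρ : ℝ) * nn T ρ := by
  classical
  rw [nls_eq, NB, Finset.mul_sum, ← Finset.sum_sub_distrib]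
  refine Finset.sum_le_sum fun ρ h => ?_
  split_ifs with hh
  · have h1 : (1:ℝ) ≤ nn T ρ := by
      have := mu_le_nn h
      rw [hh.2] at this
      exact_mod_cast this
    rw [hh.2]; push_cast; linarith
  · have h1 : (2:ℝ) ≤ nn T ρ := by exact_mod_cast nn_two h hh
    have h2 : (0:ℝ) ≤ mu ρ := by positivity
    nlinarith

lemma fin_arith {T L p C N S NS : ℝ} (hT : 0 < T) (hp : 0 < p) (hL : 100 ≤ L) (hC : 0 < C) (hLC : 1000 * C ≤ L)
    (h1 : T * L - C * T ≤ 2 * p * N)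
    (h2 : S ≤ 1.01 * (T * L^2 + 2 * T * (0.96 * L)^2 * (97/960)) + C * T * L)
    (h3 : 4 * p * (0.96 * L * (181/480)) * (2 * N - NS) ≤ S) :
    0.33333816 * (T / (2 * p)) * L ≤ NS := by
  have hq : 0.33333816 * (T / (2 * p)) * L = 0.33333816 * T * L / (2 * p) := by ring
  rw [hq, div_le_iff₀ (by positivity)]
  have hTL : 0 < T * L := by positivity
  have a1 : C * T ≤ 0.001 * (T * L) := by nlinarith
  have h4 : L * (0.724 * (2 * (2 * p * N) - 2 * p * NS)) ≤ L * (1.1982 * (T * L) + C * T) := by nlinarith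
  have h5 := le_of_mul_le_mul_left h4 (by linarith)
  nlinarith

end PC

theorem simple_critical_bound_b_point3185
    (hbox : ∀ᶠ T in atTop, ∀ ρ ∈ zeroBand T, |ρ.re - 1/2| < 0.3185 / (2 * Real.log T)) :
    ∃ ε : ℝ → ℝ, Tendsto ε atTop (nhds 0) ∧
      ∀ᶠ T in atTop, (0.33333816 + ε T) * (T / (2 * Real.pi)) * Real.log T ≤ NlineSimple T := by
  refine ⟨fun _ => 0, tendsto_const_nhds, ?_⟩
  obtain ⟨C, hC, han⟩ := PC.analytic
  filter_upwards [PC.good_of hbox, han, Real.tendsto_log_atTop.eventually_ge_atTop (1000 * C)] with T g h hL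
  obtain ⟨h1, h2⟩ := h g
  rw [add_zero]
  refine PC.fin_arith g.hT Real.pi_pos g.hL hC hL h1 h2 ?_
  have h3 := PC.S_ge g
  have hM : 0 < PC.MT T := by linarith [g.M_big]
  have h4 := mul_le_mul_of_nonneg_left (PC.comb T) (a := 4 * Real.pi * (PC.MT T * (181/480))) (by have := Real.pi_pos; positivity)
  exact h4.trans h3
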